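/- Let G be a finite connected simple graph of minimum degree at least 2 that is not isomorphic to any graph of the exceptional family B. Then fdom(G) ≥ 5/2; equivalently, there exists a finitely supported probability distribution over the dominating sets of G under which every vertex belongs to the random dominating set with probability at most 2/5. -/

import Mathlib

open Finset
open scoped Classical

/-- `D` is a dominating set of `G`. -/
def IsDominatingSet {V : Type*} (G : SimpleGraph V) (D : Finset V) : Prop :=
  ∀ v : V, ∃ u ∈ D, u = v ∨ G.Adj u v

/-- A finitely supported probability distribution over dominating sets of `G`
under which each vertex has marginal probability at most `p`. -/
def IsDomDistribution {V : Type*} [Fintype V] [DecidableEq V]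
    (G : SimpleGraph V) (w : Finset V → ℝ) (p : ℝ) : Prop :=
  (∀ D, 0 ≤ w D) ∧ (∑ D : Finset V, w D) = 1 ∧
    (∀ D, w D ≠ 0 → IsDominatingSet G D) ∧
    (∀ v : V, ∑ D ∈ Finset.univ.filter (fun D : Finset V => v ∈ D), w D ≤ p)

/-- The fractional domatic number of `G`. -/
noncomputable def fdom {V : Type*} [Fintype V] [DecidableEq V] (G : SimpleGraph V) : ℝ :=
  sSup {x : ℝ | ∃ p : ℝ, 0 < p ∧ p ≤ 1 ∧ x = 1 / p ∧ ∃ w : Finset V → ℝ, IsDomDistribution G w p}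

/-- The 4-cycle `C₄`. -/
def badC4 : SimpleGraph (Fin 4) := SimpleGraph.fromRel (fun i j => j = i + 1)

/-- The complete bipartite graph `K_{2,3}`. -/
def badK23 : SimpleGraph (Fin 2 ⊕ Fin 3) := completeBipartiteGraph (Fin 2) (Fin 3)

/-- Two 4-cycles sharing exactly one vertex. -/
def badTwoC4 : SimpleGraph (Fin 7) :=
  SimpleGraph.fromRel (fun i j =>
    (i, j) ∈ ([(0,1),(1,2),(2,3),(3,0),(0,4),(4,5),(5,6),(6,0)] : List (Fin 7 × Fin 7)))

/-- The 7-cycle `v0 v1 … v6` together with a list of chords. -/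
def cyc7 (chords : List (Fin 7 × Fin 7)) : SimpleGraph (Fin 7) :=
  SimpleGraph.fromRel (fun i j => j = i + 1 ∨ (i, j) ∈ chords)

/-- `G` is isomorphic to one of the eight exceptional graphs of the family `B`. -/
def InBadFamily {V : Type*} (G : SimpleGraph V) : Prop :=
  Nonempty (G ≃g badC4) ∨ Nonempty (G ≃g badK23) ∨ Nonempty (G ≃g cyc7 []) ∨
    Nonempty (G ≃g badTwoC4) ∨ Nonempty (G ≃g cyc7 [(2,5)]) ∨
    Nonempty (G ≃g cyc7 [(0,3),(0,4)]) ∨ Nonempty (G ≃g cyc7 [(1,5),(2,6)]) ∨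
    Nonempty (G ≃g cyc7 [(1,5),(2,6),(2,5)])

section

universe u

variable {V : Type u}

/-- A random subset of `V`, defined on a finite probability space. -/
structure RandSet (V : Type u) where
  Ω : Type
  [fin : Fintype Ω]
  p : Ω → ℝ
  nonneg : ∀ ω, 0 ≤ p ω
  total : ∑ ω, p ω = 1
  D : Ω → Set V

attribute [instance] RandSet.fin

/-- Indicator of a proposition. -/
noncomputable def ind (P : Prop) : ℝ := if P then 1 else 0

theorem ind_true {P : Prop} (h : P) : ind P = 1 := if_pos h
theorem ind_false {P : Prop} (h : ¬P) : ind P = 0 := if_neg h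
theorem ind_nonneg (P : Prop) : 0 ≤ ind P := by unfold ind; split_ifs <;> norm_num
theorem ind_le_one (P : Prop) : ind P ≤ 1 := by unfold ind; split_ifs <;> norm_num
theorem ind_mono {P Q : Prop} (h : P → Q) : ind P ≤ ind Q := by
  unfold ind; split_ifs with h1 h2 <;> first | exact absurd (h h1) h2 | norm_num

namespace RandSet

/-- Expectation. -/
noncomputable def ex (X : RandSet V) (f : X.Ω → ℝ) : ℝ := ∑ ω, X.p ω * f ω

/-- The probability that `v` belongs to the random set. -/
noncomputable def pr (X : RandSet V) (v : V) : ℝ := X.ex fun ω => ind (v ∈ X.D ω)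

variable (X : RandSet V)

theorem ex_mono {f g : X.Ω → ℝ} (h : ∀ ω, X.p ω ≠ 0 → f ω ≤ g ω) : X.ex f ≤ X.ex g := by
  refine Finset.sum_le_sum fun ω _ => ?_
  by_cases h0 : X.p ω = 0
  · simp [h0]
  · exact mul_le_mul_of_nonneg_left (h ω h0) (X.nonneg ω)

theorem ex_congr {f g : X.Ω → ℝ} (h : ∀ ω, X.p ω ≠ 0 → f ω = g ω) : X.ex f = X.ex g :=
  le_antisymm (X.ex_mono fun ω h0 => (h ω h0).le) (X.ex_mono fun ω h0 => (h ω h0).ge)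

theorem ex_add (f g : X.Ω → ℝ) : X.ex (fun ω => f ω + g ω) = X.ex f + X.ex g := by
  simp only [ex, mul_add, Finset.sum_add_distrib]

theorem ex_sub (f g : X.Ω → ℝ) : X.ex (fun ω => f ω - g ω) = X.ex f - X.ex g := by
  simp only [ex, mul_sub, Finset.sum_sub_distrib]

theorem ex_mul (c : ℝ) (f : X.Ω → ℝ) : X.ex (fun ω => c * f ω) = c * X.ex f := by
  simp only [ex, Finset.mul_sum]; exact Finset.sum_congr rfl fun _ _ => by ring

theorem ex_const (c : ℝ) : X.ex (fun _ => c) = c := by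
  simp only [ex, ← Finset.sum_mul, X.total, one_mul]

theorem ex_nonneg {f : X.Ω → ℝ} (h : ∀ ω, 0 ≤ f ω) : 0 ≤ X.ex f :=
  Finset.sum_nonneg fun ω _ => mul_nonneg (X.nonneg ω) (h ω)

/-- Extension of the probability space by a Markov kernel. -/
def bind {Ω' : Type} [Fintype Ω'] (K : X.Ω → Ω' → ℝ) (h0 : ∀ ω ω', 0 ≤ K ω ω')
    (h1 : ∀ ω, ∑ ω', K ω ω' = 1) (D' : X.Ω → Ω' → Set V) : RandSet V where
  Ω := X.Ω × Ω'
  p := fun ω => X.p ω.1 * K ω.1 ω.2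
  nonneg := fun ω => mul_nonneg (X.nonneg _) (h0 _ _)
  total := by
    rw [Fintype.sum_prod_type]
    simp only [← Finset.mul_sum, h1, mul_one, X.total]
  D := fun ω => D' ω.1 ω.2

theorem ex_bind {Ω' : Type} [Fintype Ω'] (K : X.Ω → Ω' → ℝ) (h0 h1) (D' : X.Ω → Ω' → Set V)
    (f : X.Ω × Ω' → ℝ) :
    (X.bind K h0 h1 D').ex f = X.ex fun ω => ∑ ω', K ω ω' * f (ω, ω') := by
  refine (Fintype.sum_prod_type _).trans (Finset.sum_congr rfl fun ω _ => ?_)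
  rw [Finset.mul_sum]
  exact Finset.sum_congr rfl fun _ _ => mul_assoc _ _ _

theorem pr_bind {Ω' : Type} [Fintype Ω'] (K : X.Ω → Ω' → ℝ) (h0 h1) (D' : X.Ω → Ω' → Set V)
    (v : V) :
    (X.bind K h0 h1 D').pr v = X.ex fun ω => ∑ ω', K ω ω' * ind (v ∈ D' ω ω') :=
  X.ex_bind K h0 h1 D' _

/-- The same probability space with another random set. -/
def withSet (D' : X.Ω → Set V) : RandSet V := { X with D := D' }

/-- `κ` is uniformly distributed on five colours. -/
def Unif (κ : X.Ω → Fin 5) : Prop := ∀ c, X.ex (fun ω => ind (κ ω = c)) = 1 / 5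

variable {X}

theorem Unif.comp {κ : X.Ω → Fin 5} (h : X.Unif κ) (σ : Equiv.Perm (Fin 5)) :
    X.Unif (fun ω => σ (κ ω)) := by
  intro c
  rw [← h (σ.symm c)]
  congr 1; ext ω; congr 1; rw [Equiv.eq_symm_apply]

/-- Coupling of two random sets along uniform colours. -/
noncomputable def couple {X Y : RandSet V} (κ : X.Ω → Fin 5) {μ : Y.Ω → Fin 5}
    (hμ : Y.Unif μ) (D' : X.Ω → Y.Ω → Set V) : RandSet V :=
  X.bind (fun ω ω' => 5 * Y.p ω' * ind (κ ω = μ ω'))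
    (fun _ ω' => mul_nonneg (mul_nonneg (by norm_num) (Y.nonneg ω')) (ind_nonneg _))
    (fun ω => by
      have := hμ (κ ω)
      simp only [ex] at this
      simp only [mul_assoc]
      rw [← Finset.mul_sum]
      simp only [eq_comm (a := κ ω), this]; norm_num) D'

theorem couple_supp {X Y : RandSet V} {κ : X.Ω → Fin 5} {μ : Y.Ω → Fin 5}
    {hμ : Y.Unif μ} {D' : X.Ω → Y.Ω → Set V} {ω : X.Ω × Y.Ω} (h : (couple κ hμ D').p ω ≠ 0) :
    X.p ω.1 ≠ 0 ∧ Y.p ω.2 ≠ 0 ∧ κ ω.1 = μ ω.2 := by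
  simp only [couple, bind, ne_eq, mul_eq_zero, not_or] at h
  refine ⟨h.1, h.2.1.2, ?_⟩
  by_contra hc
  exact h.2.2 (ind_false hc)

theorem couple_fst {X Y : RandSet V} (κ : X.Ω → Fin 5) {μ : Y.Ω → Fin 5}
    (hμ : Y.Unif μ) (D' : X.Ω → Y.Ω → Set V) (f : X.Ω → ℝ) :
    (couple κ hμ D').ex (fun ω => f ω.1) = X.ex f := by
  refine (X.ex_bind _ _ _ _ _).trans ?_
  congr 1; ext ω
  change ∑ ω', 5 * Y.p ω' * ind (κ ω = μ ω') * f ω = f ω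
  rw [← Finset.sum_mul]
  have := hμ (κ ω)
  simp only [ex] at this
  simp only [mul_assoc]
  rw [← Finset.mul_sum]
  simp only [eq_comm (a := κ ω), this]; norm_num

theorem couple_snd {X Y : RandSet V} {κ : X.Ω → Fin 5} {μ : Y.Ω → Fin 5} (hκ : X.Unif κ)
    (hμ : Y.Unif μ) (D' : X.Ω → Y.Ω → Set V) (f : Y.Ω → ℝ) :
    (couple κ hμ D').ex (fun ω => f ω.2) = Y.ex f := by
  refine (X.ex_bind _ _ _ _ _).trans ?_
  simp only [ex, Finset.mul_sum]
  rw [Finset.sum_comm]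
  refine Finset.sum_congr rfl fun ω' _ => ?_
  have := hκ (μ ω')
  simp only [ex] at this
  calc ∑ x, X.p x * (5 * Y.p ω' * ind (κ x = μ ω') * f ω')
      = (5 * Y.p ω' * f ω') * ∑ x, X.p x * ind (κ x = μ ω') := by
        rw [Finset.mul_sum]; exact Finset.sum_congr rfl fun _ _ => by ring
    _ = _ := by rw [this]; ring

end RandSet

/-- `v` is dominated by `D`. -/
def DomBy (G : SimpleGraph V) (D : Set V) (v : V) : Prop := v ∈ D ∨ ∃ u ∈ D, G.Adj u v

theorem DomBy.mono {G H : SimpleGraph V} {D D' : Set V} {v : V} (h : DomBy G D v)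
    (hD : D ⊆ D') (hG : ∀ u ∈ D, G.Adj u v → H.Adj u v) : DomBy H D' v :=
  h.imp (fun h => hD h) fun ⟨u, hu, ha⟩ => ⟨u, hD hu, hG u hu ha⟩

/-- `G[W]` has a random dominating set with marginals at most `2/5`. -/
def GoodOn (G : SimpleGraph V) (W : Set V) : Prop :=
  ∃ X : RandSet V, (∀ ω, X.D ω ⊆ W) ∧ (∀ ω, X.p ω ≠ 0 → ∀ v ∈ W, DomBy G (X.D ω) v) ∧
    ∀ v ∈ W, X.pr v ≤ 2 / 5

/-- `W` carries a random set with marginals at most `2/5` together with a uniform colour, such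
that `a` is chosen exactly for the colours in `R`, and everything is dominated, except possibly
`a` for the colours in `m`. -/
def Rooted (G : SimpleGraph V) (W : Set V) (a : V) (R m : Set (Fin 5)) : Prop :=
  ∃ (X : RandSet V) (κ : X.Ω → Fin 5), X.Unif κ ∧ (∀ ω, X.D ω ⊆ W) ∧
    (∀ ω, X.p ω ≠ 0 → (a ∈ X.D ω ↔ κ ω ∈ R) ∧
      ∀ v ∈ W, (v = a → κ ω ∉ m) → DomBy G (X.D ω) v) ∧
    ∀ v ∈ W, X.pr v ≤ 2 / 5

theorem Rooted.perm {G : SimpleGraph V} {W : Set V} {a : V} {R m : Set (Fin 5)}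
    (h : Rooted G W a R m) (σ : Equiv.Perm (Fin 5)) {R' m' : Set (Fin 5)}
    (hR : ∀ c, c ∈ R ↔ σ c ∈ R') (hm : ∀ c, c ∈ m → σ c ∈ m') : Rooted G W a R' m' := by
  obtain ⟨X, κ, hκ, h1, h2, h3⟩ := h
  refine ⟨X, fun ω => σ (κ ω), hκ.comp σ, h1, fun ω h0 => ⟨?_, fun v hv hva => ?_⟩, h3⟩
  · rw [(h2 ω h0).1, hR]
  · exact (h2 ω h0).2 v hv fun e hc => hva e (hm _ hc)

theorem Rooted.goodOn {G : SimpleGraph V} {W : Set V} {a : V} {R : Set (Fin 5)}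
    (h : Rooted G W a R ∅) : GoodOn G W := by
  obtain ⟨X, κ, hκ, h1, h2, h3⟩ := h
  exact ⟨X, h1, fun ω h0 v hv => (h2 ω h0).2 v hv fun _ h => h, h3⟩

theorem GoodOn.mono {G H : SimpleGraph V} {W : Set V} (h : GoodOn G W)
    (hGH : ∀ u ∈ W, ∀ v ∈ W, G.Adj u v → H.Adj u v) : GoodOn H W := by
  obtain ⟨X, h1, h2, h3⟩ := h
  exact ⟨X, h1, fun ω h0 v hv => (h2 ω h0 v hv).mono subset_rfl
    fun u hu => hGH u (h1 ω hu) v hv, h3⟩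

/-- The marginals of a good law can be raised to exactly `2/5`. -/
theorem GoodOn.exact [Finite V] {G : SimpleGraph V} {W : Set V} (h : GoodOn G W) :
    ∃ X : RandSet V, (∀ ω, X.D ω ⊆ W) ∧
      (∀ ω, X.p ω ≠ 0 → ∀ v ∈ W, DomBy G (X.D ω) v) ∧ ∀ v ∈ W, X.pr v = 2 / 5 := by
  suffices H : ∀ S : Set V, S.Finite → ∃ X : RandSet V, (∀ ω, X.D ω ⊆ W) ∧
      (∀ ω, X.p ω ≠ 0 → ∀ v ∈ W, DomBy G (X.D ω) v) ∧ (∀ v ∈ W, X.pr v ≤ 2 / 5) ∧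
      ∀ v ∈ W, v ∈ S → X.pr v = 2 / 5 by
    obtain ⟨X, h1, h2, -, h3⟩ := H _ Set.finite_univ
    exact ⟨X, h1, h2, fun v hv => h3 v hv trivial⟩
  intro S hS
  induction S, hS using Set.Finite.induction_on with
  | empty =>
    obtain ⟨X, h1, h2, h3⟩ := h
    exact ⟨X, h1, h2, h3, fun _ _ h => h.elim⟩
  | @insert a S _ _ ih =>
    obtain ⟨X, h1, h2, h3, h4⟩ := ih
    by_cases ha : a ∈ W
    swap
    · exact ⟨X, h1, h2, h3, fun v hv hS => hS.elim (fun e => (ha (e ▸ hv)).elim) (h4 v hv)⟩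
    set t : ℝ := (2 / 5 - X.pr a) / (1 - X.pr a) with ht
    have hP := h3 a ha
    have ht0 : 0 ≤ t := div_nonneg (by linarith) (by linarith)
    have ht1 : t ≤ 1 := by rw [ht, div_le_one (by linarith)]; linarith
    have key : X.pr a + t * (1 - X.pr a) = 2 / 5 := by
      rw [ht, div_mul_cancel₀ _ (by linarith)]; ring
    let Y := X.bind (fun _ b => if b then t else 1 - t)
      (fun _ b => by cases b <;> simp [ht0, ht1]) (fun _ => by simp)
      (fun ω b => {v | v ∈ X.D ω ∨ (b = true ∧ v = a)})
    have hYa : Y.pr a = 2 / 5 := by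
      rw [← key]
      simp only [Y, RandSet.pr_bind]
      rw [show X.pr a + t * (1 - X.pr a) = t + (1 - t) * X.pr a by ring]
      rw [RandSet.pr, ← X.ex_mul, ← X.ex_const t, ← X.ex_add, X.ex_const]
      refine X.ex_congr fun ω _ => ?_
      by_cases h : a ∈ X.D ω <;> simp [h, ind]
    have hYv : ∀ v, v ≠ a → Y.pr v = X.pr v := by
      intro v hv
      simp only [Y, RandSet.pr_bind]
      rw [RandSet.pr]
      refine X.ex_congr fun ω _ => ?_
      by_cases h : v ∈ X.D ω <;> simp [h, ind, hv]
    refine ⟨Y, fun ω v hv => ?_, fun ω h0 v hv => ?_, fun v hv => ?_, fun v hv hS => ?_⟩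
    · rcases hv with hv | ⟨-, rfl⟩
      · exact h1 _ hv
      · exact ha
    · exact (h2 ω.1 (left_ne_zero_of_mul h0) v hv).mono (fun u hu => Or.inl hu) fun _ _ h => h
    · by_cases e : v = a
      · rw [e, hYa]
      · rw [hYv v e]; exact h3 v hv
    · by_cases e : v = a
      · rw [e, hYa]
      · rw [hYv v e]; exact h4 v hv (hS.resolve_left e)

theorem GoodOn.rooted [Finite V] {G : SimpleGraph V} {W : Set V} (h : GoodOn G W) {a : V}
    (ha : a ∈ W) : Rooted G W a {0, 1} ∅ := by
  obtain ⟨X, h1, h2, h3⟩ := h.exact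
  let K : X.Ω → Fin 5 → ℝ := fun ω =>
    if a ∈ X.D ω then ![1 / 2, 1 / 2, 0, 0, 0] else ![0, 0, 1 / 3, 1 / 3, 1 / 3]
  have hK1 : ∀ ω, ∑ c, K ω c = 1 := fun ω => by
    by_cases h : a ∈ X.D ω <;> simp [K, h, Fin.sum_univ_succ] <;> norm_num
  refine ⟨X.bind K (fun ω c => ?_) hK1 fun ω _ => X.D ω, fun ω => ω.2, fun c => ?_,
    fun ω => h1 ω.1, fun ω h0 => ⟨?_, fun v hv _ => h2 ω.1 (left_ne_zero_of_mul h0) v hv⟩,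
    fun v hv => ?_⟩
  · by_cases h : a ∈ X.D ω <;> simp only [K, h, if_true, if_false] <;> fin_cases c <;> norm_num
  · refine (X.ex_bind _ _ _ _ _).trans ?_
    have : ∀ ω, ∑ c', K ω c' * ind (c' = c) = K ω c := fun ω => by simp [ind]
    simp only [this]
    by_cases hc : c = 0 ∨ c = 1
    · have : X.ex (fun ω => K ω c) = 1 / 2 * X.pr a := by
        rw [RandSet.pr, ← X.ex_mul]
        refine X.ex_congr fun ω _ => ?_
        by_cases h : a ∈ X.D ω <;> rcases hc with rfl | rfl <;> simp [K, h, ind]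
      rw [this, h3 a ha]; norm_num
    · have : X.ex (fun ω => K ω c) = 1 / 3 - 1 / 3 * X.pr a := by
        rw [RandSet.pr, ← X.ex_mul, ← X.ex_const (1 / 3), ← X.ex_sub, X.ex_const]
        refine X.ex_congr fun ω _ => ?_
        by_cases h : a ∈ X.D ω <;> fin_cases c <;> simp_all [K, ind]
      rw [this, h3 a ha]; norm_num
  · obtain ⟨ω, c⟩ := ω
    have h0 : K ω c ≠ 0 := right_ne_zero_of_mul h0
    change a ∈ X.D ω ↔ c ∈ ({0, 1} : Set (Fin 5))
    by_cases h : a ∈ X.D ω <;> simp only [K, h, if_true, if_false] at h0 ⊢ <;>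
      fin_cases c <;> simp_all
  · rw [RandSet.pr_bind]
    simp only [← Finset.sum_mul, hK1, one_mul]
    exact (h3 v hv).le

/-- The 2-element subsets of a 5-element colour set, as bit masks. -/
def pairMasks : List ℕ := [17, 12, 20, 10, 18, 9, 24, 3, 6, 5]

/-- The closed neighbourhood of `v` in the graph with edge list `es`. -/
def closedNbrs (es : List (ℕ × ℕ)) (v : ℕ) : List ℕ :=
  v :: es.flatMap fun e => bif e.1.beq v then [e.2] else bif e.2.beq v then [e.1] else []

/-- Backtracking search for a list of labels. Each entry of the first argument holds the labels
allowed for the next vertex, the mask of the vertices it covers, and the mask of the colours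
which have to be covered from then on. -/
def backtrack : List (List ℕ × ℕ × ℕ) → ℕ → Option (List ℕ)
  | [], _ => some []
  | (as, s, d) :: t, cov => as.findSome? fun a =>
      bif ((cov ||| a * s) &&& d).beq d then (backtrack t (cov ||| a * s)).map (a :: ·) else none

/-- The input of `backtrack` for the graph on `m` vertices with edge list `es`, where the
vertex `root` gets label `{0, 1}` and may miss the colours in `miss`. -/
def searchSteps (m : ℕ) (es : List (ℕ × ℕ)) (root miss : ℕ) : List (List ℕ × ℕ × ℕ) :=
  (List.range m).map fun v =>
    (bif v.beq root then [3] else pairMasks,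
      ((closedNbrs es v).map fun u => 2 ^ (5 * u)).foldl (· ||| ·) 0,
      ((List.range m).map fun u =>
        bif ((closedNbrs es u).foldl max 0).beq v then
          (bif u.beq root then 31 - miss else 31) * 2 ^ (5 * u) else 0).foldl (· ||| ·) 0)

/-- Every vertex sees all five colours in its closed neighbourhood, up to the exception allowed
for `root`, and every label has at most two colours. -/
def validLabels (m : ℕ) (es : List (ℕ × ℕ)) (root miss : ℕ) (ls : List ℕ) : Bool :=
  (ls.getD root 0).beq 3 && (List.range m).all fun v =>
    pairMasks.contains (ls.getD v 0) && (List.range 5).all fun c =>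
      (v.beq root && miss.testBit c) ||
        (closedNbrs es v).any fun u => u.blt m && (ls.getD u 0).testBit c

/-- The graph on `m` vertices with edge list `es` has a valid labelling. -/
def labelable (m : ℕ) (es : List (ℕ × ℕ)) (root miss : ℕ) : Bool :=
  match backtrack (searchSteps m es root miss) 0 with
  | none => false
  | some ls => validLabels m es root miss ls

/-- Spanning subgraphs of the exceptional graphs, as edge lists. -/
def coreC4 : ℕ × List (ℕ × ℕ) := (4, [(0, 1), (1, 2), (2, 3), (3, 0)])
def coreK23 : ℕ × List (ℕ × ℕ) := (5, [(0, 2), (0, 3), (0, 4), (1, 2), (1, 3), (1, 4)])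
def coreC7 : ℕ × List (ℕ × ℕ) := (7, [(0, 1), (1, 2), (2, 3), (3, 4), (4, 5), (5, 6), (6, 0)])
def coreTwoC4 : ℕ × List (ℕ × ℕ) :=
  (7, [(0, 1), (1, 2), (2, 3), (3, 0), (0, 4), (4, 5), (5, 6), (6, 0)])

/-- The list of spanning subgraphs of exceptional graphs. -/
def cores : List (ℕ × List (ℕ × ℕ)) := [coreC4, coreK23, coreC7, coreTwoC4]

/-- `g` identifies the graph on `n` vertices with edge list `es` with a spanning subgraph of
`H[W]`. -/
structure Emb (H : SimpleGraph V) (W : Set V) (n : ℕ) (es : List (ℕ × ℕ)) (g : ℕ → V) : Prop where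
  inj : ∀ i < n, ∀ j < n, g i = g j → i = j
  mem : ∀ i < n, g i ∈ W
  surj : ∀ v ∈ W, ∃ i < n, g i = v
  adj : ∀ e ∈ es, H.Adj (g e.1) (g e.2)

/-- `H[W]` has a spanning subgraph from the list `cores`. -/
def BadOn (H : SimpleGraph V) (W : Set V) : Prop :=
  ∃ B ∈ cores, ∃ g, Emb H W B.1 B.2 g

theorem Emb.mono {G H : SimpleGraph V} {W : Set V} {n : ℕ} {es : List (ℕ × ℕ)} {g : ℕ → V}
    (E : Emb G W n es g) (h : G ≤ H) : Emb H W n es g :=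
  ⟨E.inj, E.mem, E.surj, fun e he => h (E.adj e he)⟩

theorem BadOn.mono {G H : SimpleGraph V} {W : Set V} (E : BadOn G W) (h : G ≤ H) :
    BadOn H W :=
  let ⟨B, hB, g, E⟩ := E
  ⟨B, hB, g, E.mono h⟩

theorem cores_lt {B : ℕ × List (ℕ × ℕ)} (hB : B ∈ cores) :
    0 < B.1 ∧ ∀ e ∈ B.2, e.1 < B.1 ∧ e.2 < B.1 := by
  revert B; decide

theorem mem_closedNbrs {es : List (ℕ × ℕ)} {u v : ℕ} (h : u ∈ closedNbrs es v) :
    u = v ∨ (v, u) ∈ es ∨ (u, v) ∈ es := by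
  simp only [closedNbrs, List.mem_cons, List.mem_flatMap] at h
  rcases h with h | ⟨⟨a, b⟩, he, h⟩
  · exact Or.inl h
  · right
    cases h1 : a.beq v
    · cases h2 : b.beq v
      · simp [h1, h2] at h
      · simp [h1, h2] at h
        rw [Nat.beq_eq] at h2
        subst h h2; exact Or.inr he
    · simp [h1] at h
      rw [Nat.beq_eq] at h1
      subst h h1; exact Or.inl he

theorem sum_testBit_le {a : ℕ} (ha : a ∈ pairMasks) :
    ∑ c : Fin 5, ind (a.testBit c = true) ≤ 2 := by
  have : (∑ c : Fin 5, if a.testBit c = true then 1 else 0) ≤ 2 := by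
    revert a; decide
  calc ∑ c : Fin 5, ind (a.testBit c = true)
      = ((∑ c : Fin 5, if a.testBit c = true then 1 else 0 : ℕ) : ℝ) := by
        push_cast; exact Finset.sum_congr rfl fun c _ => by unfold ind; split_ifs <;> rfl
    _ ≤ 2 := by exact_mod_cast this

theorem sum_ind_eq (c : Fin 5) : ∑ c', ind (c' = c) = 1 := by
  rw [Finset.sum_eq_single c (fun b _ h => ind_false h) fun h => (h (Finset.mem_univ c)).elim]
  exact ind_true rfl

theorem Emb.rooted {G : SimpleGraph V} {W : Set V} {n root miss : ℕ} {es : List (ℕ × ℕ)}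
    {g : ℕ → V} (E : Emb G W n es g) (hr : root < n) (h : labelable n es root miss = true) :
    Rooted G W (g root) {0, 1} {c | miss.testBit c = true} := by
  obtain ⟨ls, hls⟩ : ∃ ls, validLabels n es root miss ls = true := by
    unfold labelable at h
    split at h
    · cases h
    · exact ⟨_, h⟩
  simp only [validLabels, Bool.and_eq_true, List.all_eq_true, List.mem_range,
    Bool.or_eq_true, List.any_eq_true, Nat.beq_eq, Nat.blt_eq, List.contains_iff_mem] at hls
  obtain ⟨h3, hv⟩ := hls
  have hmem : ∀ (c : Fin 5) i, i < n →
      ((∃ j < n, g j = g i ∧ (ls.getD j 0).testBit c = true) ↔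
        (ls.getD i 0).testBit c = true) := fun c i hi =>
    ⟨fun ⟨j, hj, e, h⟩ => E.inj j hj i hi e ▸ h, fun h => ⟨i, hi, rfl, h⟩⟩
  have hex : ∀ f : Fin 5 → ℝ, ∑ c, 1 / 5 * f c = 1 / 5 * ∑ c, f c := fun f =>
    (Finset.mul_sum _ _ _).symm
  have hroot : ∀ c : Fin 5, Nat.testBit 3 c = true ↔ c = 0 ∨ c = 1 := by decide
  let X : RandSet V := {
    Ω := Fin 5
    p := fun _ => 1 / 5
    nonneg := fun _ => by norm_num
    total := by simp
    D := fun c => {v | ∃ j < n, g j = v ∧ (ls.getD j 0).testBit c = true} }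
  refine ⟨X, id, fun c => ?_, ?_, fun c _ => ⟨?_, fun v hvW hva => ?_⟩, fun v hvW => ?_⟩
  · exact (hex fun c' => ind (c' = c)).trans (by rw [sum_ind_eq]; norm_num)
  · rintro c v ⟨j, hj, rfl, -⟩
    exact E.mem j hj
  · refine (hmem c root hr).trans ?_
    rw [h3]
    exact hroot c
  · obtain ⟨i, hi, rfl⟩ := E.surj v hvW
    rcases (hv i hi).2 c c.2 with ⟨e, hm⟩ | ⟨u, hu, hun, hc⟩
    · exact (hva (by rw [e]) hm).elim
    · rcases mem_closedNbrs hu with rfl | hu | hu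
      · exact Or.inl ⟨u, hun, rfl, hc⟩
      · exact Or.inr ⟨g u, ⟨u, hun, rfl, hc⟩, (E.adj _ hu).symm⟩
      · exact Or.inr ⟨g u, ⟨u, hun, rfl, hc⟩, E.adj _ hu⟩
  · obtain ⟨i, hi, rfl⟩ := E.surj v hvW
    have := sum_testBit_le (hv i hi).1
    calc X.pr (g i) = 1 / 5 * ∑ c : Fin 5, ind (g i ∈ X.D c) :=
        hex fun c => ind (g i ∈ X.D c)
      _ = 1 / 5 * ∑ c : Fin 5, ind ((ls.getD i 0).testBit c = true) := by
        congr 2; ext c; congr 1; exact propext (hmem c i hi)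
      _ ≤ 2 / 5 := by linarith

theorem Emb.goodOn {G : SimpleGraph V} {W : Set V} {n : ℕ} {es : List (ℕ × ℕ)} {g : ℕ → V}
    (E : Emb G W n es g) (hn : 0 < n) (h : labelable n es 0 0 = true) : GoodOn G W := by
  have := E.rooted hn h
  simp only [Nat.zero_testBit, Bool.false_eq_true, Set.ofPred_false] at this
  exact this.goodOn

/-- Continue the enumeration `g` of `n` vertices by a list of further vertices. -/
def extendEnum (g : ℕ → V) (n : ℕ) (xs : List V) (i : ℕ) : V :=
  if i < n then g i else xs.getD (i - n) (g 0)

theorem extendEnum_lt {g : ℕ → V} {n : ℕ} {xs : List V} {i : ℕ} (h : i < n) :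
    extendEnum g n xs i = g i := if_pos h

theorem extendEnum_self {g : ℕ → V} {n : ℕ} {x : V} {xs : List V} :
    extendEnum g n (x :: xs) n = x := by simp [extendEnum]

theorem extendEnum_add {g : ℕ → V} {n k : ℕ} {xs : List V} :
    extendEnum g n xs (n + k) = xs.getD k (g 0) := by simp [extendEnum]

theorem Emb.extend {G H : SimpleGraph V} {W W' : Set V} {n : ℕ} {es es' : List (ℕ × ℕ)}
    {g : ℕ → V} (E : Emb H W n es g) {xs : List V} (hnd : xs.Nodup) (hxs : ∀ x ∈ xs, x ∉ W)
    (hW : ∀ v, v ∈ W' ↔ v ∈ W ∨ v ∈ xs)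
    (hadj : ∀ e ∈ es', G.Adj (extendEnum g n xs e.1) (extendEnum g n xs e.2)) :
    Emb G W' (n + xs.length) es' (extendEnum g n xs) := by
  have hge : ∀ i, ∀ _ : n ≤ i, ∀ _ : i < n + xs.length,
      extendEnum g n xs i = xs[i - n]'(by omega) := fun i hi h => by
    rw [extendEnum, if_neg (by omega), List.getD_eq_getElem]
  refine ⟨fun i hi j hj e => ?_, fun i hi => ?_, fun v hv => ?_, hadj⟩
  · rcases lt_or_ge i n with h1 | h1 <;> rcases lt_or_ge j n with h2 | h2
    · rw [extendEnum_lt h1, extendEnum_lt h2] at e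
      exact E.inj i h1 j h2 e
    · rw [extendEnum_lt h1, hge j h2 hj] at e
      exact (hxs _ (List.getElem_mem _) (e ▸ E.mem i h1)).elim
    · rw [extendEnum_lt h2, hge i h1 hi] at e
      exact (hxs _ (List.getElem_mem _) (e ▸ E.mem j h2)).elim
    · rw [hge i h1 hi, hge j h2 hj] at e
      have := (List.Nodup.getElem_inj_iff hnd).1 e
      omega
  · rw [hW]
    rcases lt_or_ge i n with h1 | h1
    · rw [extendEnum_lt h1]; exact Or.inl (E.mem i h1)
    · rw [hge i h1 hi]; exact Or.inr (List.getElem_mem _)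
  · rcases (hW v).1 hv with h | h
    · obtain ⟨i, hi, rfl⟩ := E.surj v h
      exact ⟨i, by omega, extendEnum_lt hi⟩
    · obtain ⟨k, hk, rfl⟩ := List.getElem_of_mem h
      refine ⟨n + k, by omega, ?_⟩
      rw [hge _ (by omega) (by omega)]
      simp

theorem RandSet.goodOn_bind {G : SimpleGraph V} {W : Set V} (X : RandSet V) {Ω' : Type}
    [Fintype Ω'] (K : X.Ω → Ω' → ℝ) (h0 : ∀ ω ω', 0 ≤ K ω ω') (h1 : ∀ ω, ∑ ω', K ω ω' = 1)
    (D' : X.Ω → Ω' → Set V) (hsub : ∀ ω ω', D' ω ω' ⊆ W)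
    (hdom : ∀ ω ω', X.p ω ≠ 0 → K ω ω' ≠ 0 → ∀ v ∈ W, DomBy G (D' ω ω') v)
    (hpr : ∀ v ∈ W, X.ex (fun ω => ∑ ω', K ω ω' * ind (v ∈ D' ω ω')) ≤ 2 / 5) : GoodOn G W :=
  ⟨X.bind K h0 h1 D', fun ω => hsub ω.1 ω.2,
    fun ω h => hdom ω.1 ω.2 (left_ne_zero_of_mul h) (right_ne_zero_of_mul h),
    fun v hv => (X.pr_bind K h0 h1 D' v).trans_le (hpr v hv)⟩

/-- Connectedness of `H[W]`, phrased with cuts. -/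
def CutConn (H : SimpleGraph V) (W : Set V) : Prop :=
  ∀ A ⊆ W, A.Nonempty → (W \ A).Nonempty → ∃ a ∈ A, ∃ b ∈ W \ A, H.Adj a b

/-- The degrees in `H[W]` are at least two. -/
def MinDegTwo (H : SimpleGraph V) (W : Set V) : Prop :=
  ∀ v ∈ W, ∃ a ∈ W, ∃ b ∈ W, a ≠ b ∧ H.Adj v a ∧ H.Adj v b

/-- The induction hypothesis: the dichotomy holds on all proper subsets. -/
def SmallerOK (V : Type u) : Prop :=
  ∀ W : Set V, W ≠ Set.univ → ∀ H : SimpleGraph V, CutConn H W → MinDegTwo H W →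
    W.Nonempty → GoodOn H W ∨ BadOn H W

/-- The dichotomy transfers from the subtype of `W` to `W`. -/
theorem dichotomy_of_subtype {W : Set V} {H : SimpleGraph V}
    (h : GoodOn (H.comap (Subtype.val : W → V)) Set.univ ∨
      BadOn (H.comap (Subtype.val : W → V)) Set.univ) : GoodOn H W ∨ BadOn H W := by
  refine h.imp ?_ ?_
  · rintro ⟨X, -, h2, h3⟩
    refine ⟨⟨X.Ω, X.p, X.nonneg, X.total, fun ω => Subtype.val '' X.D ω⟩, ?_, ?_, ?_⟩
    · rintro ω _ ⟨v, -, rfl⟩; exact v.2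
    · intro ω h0 v hv
      rcases h2 ω h0 ⟨v, hv⟩ trivial with h | ⟨u, hu, ha⟩
      · exact Or.inl ⟨_, h, rfl⟩
      · exact Or.inr ⟨u, ⟨u, hu, rfl⟩, ha⟩
    · intro v hv
      refine le_of_eq_of_le ?_ (h3 ⟨v, hv⟩ trivial)
      simp only [RandSet.pr, RandSet.ex]
      refine Finset.sum_congr rfl fun ω _ => ?_
      congr 2
      simp [hv]
  · rintro ⟨B, hB, g, E⟩
    refine ⟨B, hB, fun i => g i, fun i hi j hj e => E.inj i hi j hj (Subtype.ext e),
      fun i _ => (g i).2, fun v hv => ?_, fun e he => E.adj e he⟩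
    obtain ⟨i, hi, e⟩ := E.surj ⟨v, hv⟩ trivial
    exact ⟨i, hi, by rw [e]⟩

theorem CutConn.subtype {W : Set V} {H : SimpleGraph V} (h : CutConn H W) :
    CutConn (H.comap (Subtype.val : W → V)) Set.univ := by
  rintro A - ⟨a, ha⟩ ⟨b, -, hb⟩
  obtain ⟨_, ⟨x, hx, rfl⟩, y, ⟨hyW, hy⟩, hxy⟩ := h (Subtype.val '' A)
    (by rintro _ ⟨v, -, rfl⟩; exact v.2) ⟨a, a, ha, rfl⟩
    ⟨b, b.2, by rintro ⟨v, hv, e⟩; exact hb (Subtype.ext e ▸ hv)⟩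
  exact ⟨x, hx, ⟨y, hyW⟩, ⟨trivial, fun h => hy ⟨_, h, rfl⟩⟩, hxy⟩

theorem MinDegTwo.subtype {W : Set V} {H : SimpleGraph V} (h : MinDegTwo H W) :
    MinDegTwo (H.comap (Subtype.val : W → V)) Set.univ := by
  rintro ⟨v, hv⟩ -
  obtain ⟨a, ha, b, hb, hab, h1, h2⟩ := h v hv
  exact ⟨⟨a, ha⟩, trivial, ⟨b, hb⟩, trivial, fun e => hab (congrArg Subtype.val e), h1, h2⟩

/-- Adjacency in the graph with edge list `es`. -/
def listAdj (es : List (ℕ × ℕ)) (i j : ℕ) : Bool := es.contains (i, j) || es.contains (j, i)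

/-- The pairs `i < j` of nonadjacent vertices. -/
def nonEdges (B : ℕ × List (ℕ × ℕ)) : List (ℕ × ℕ) :=
  (List.range B.1).flatMap fun j => (List.range j).flatMap fun i =>
    bif listAdj B.2 i j then [] else [(i, j)]

/-- No neighbour of `i` has degree at least three. -/
def farFromHubs (B : ℕ × List (ℕ × ℕ)) (i : ℕ) : Bool :=
  (List.range B.1).all fun j => !listAdj B.2 i j ||
    ((List.range B.1).filter fun k => listAdj B.2 j k).length.ble 2

/-- The triples of pairwise nonadjacent vertices whose neighbours have degree two. -/
def farTriples (B : ℕ × List (ℕ × ℕ)) : List (ℕ × ℕ × ℕ) :=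
  let I := (List.range B.1).filter fun i => farFromHubs B i
  I.flatMap fun i => I.flatMap fun j =>
    bif i.beq j || listAdj B.2 i j then [] else
      I.flatMap fun k =>
        bif i.beq k || listAdj B.2 i k || j.beq k || listAdj B.2 j k then [] else [(i, j, k)]

theorem mem_nonEdges {B : ℕ × List (ℕ × ℕ)} {i j : ℕ} (hij : i < j) (hj : j < B.1)
    (h : ¬listAdj B.2 i j = true) : (i, j) ∈ nonEdges B := by
  simp only [nonEdges, List.mem_flatMap, List.mem_range]
  exact ⟨j, hj, i, hij, by simp [Bool.eq_false_iff.2 h]⟩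

theorem mem_farTriples {B : ℕ × List (ℕ × ℕ)} {i j k : ℕ} (hi : i < B.1) (hj : j < B.1)
    (hk : k < B.1) (fi : farFromHubs B i = true) (fj : farFromHubs B j = true)
    (fk : farFromHubs B k = true) (hij : i ≠ j) (hik : i ≠ k) (hjk : j ≠ k)
    (aij : ¬listAdj B.2 i j = true) (aik : ¬listAdj B.2 i k = true)
    (ajk : ¬listAdj B.2 j k = true) : (i, j, k) ∈ farTriples B := by
  simp only [farTriples, List.mem_flatMap, List.mem_filter, List.mem_range]
  have h1 : ∀ {a b : ℕ}, a ≠ b → a.beq b = false := fun h => by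
    rw [Bool.eq_false_iff, Ne, Nat.beq_eq]; exact h
  refine ⟨i, ⟨hi, fi⟩, j, ⟨hj, fj⟩, ?_⟩
  rw [Bool.eq_false_iff.2 aij, h1 hij]
  simp only [Bool.or_self, cond_false, List.mem_flatMap, List.mem_filter, List.mem_range]
  refine ⟨k, ⟨hk, fk⟩, ?_⟩
  rw [Bool.eq_false_iff.2 aik, h1 hik, Bool.eq_false_iff.2 ajk, h1 hjk]
  simp

theorem core_root : ∀ B ∈ [coreK23, coreC7, coreTwoC4], ∀ a ∈ List.range B.1,
    labelable B.1 B.2 a 4 = true := by decide +kernel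

theorem coreC4_root : ∀ a ∈ List.range 4, labelable 4 coreC4.2 a 12 = true := by decide +kernel

theorem core_addEdge : ∀ B ∈ [coreC4, coreK23], ∀ e ∈ nonEdges B,
    labelable B.1 (B.2 ++ [e]) 0 0 = true := by decide +kernel

theorem coreC7_shortChord : ∀ i ∈ List.range 7,
    labelable 7 (coreC7.2 ++ [(i, (i + 2) % 7)]) 0 0 = true := by decide +kernel

theorem coreC7_twoChords : ∀ i ∈ List.range 7,
    labelable 7 (coreC7.2 ++ [(i, (i + 3) % 7), ((i + 2) % 7, (i + 5) % 7)]) 0 0 = true := by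
  decide +kernel

theorem coreTwoC4_addEdge : ∀ e ∈ nonEdges coreTwoC4,
    e ∈ [(1, 4), (1, 6), (3, 4), (3, 6)] ∨ labelable 7 (coreTwoC4.2 ++ [e]) 0 0 = true := by
  decide +kernel

theorem core_subdivide : ∀ B ∈ [coreK23, coreC7, coreTwoC4], ∀ e ∈ B.2,
    labelable (B.1 + 3) (B.2.filter (· != e) ++
      [(e.1, B.1), (B.1, B.1 + 1), (B.1 + 1, B.1 + 2), (B.1 + 2, e.2)]) 0 0 = true := by
  decide +kernel

theorem core_addThree : ∀ B ∈ cores, ∀ e ∈ nonEdges B,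
    labelable (B.1 + 3) (B.2 ++
      [(e.1, B.1), (B.1, B.1 + 1), (B.1 + 1, B.1 + 2), (B.1 + 2, e.2)]) 0 0 = true := by
  decide +kernel

theorem core_addOne : ∀ B ∈ [coreK23, coreC7, coreTwoC4], ∀ e ∈ nonEdges B,
    labelable (B.1 + 1) (B.2 ++ [(e.1, B.1), (B.1, e.2)]) 0 0 = true := by decide +kernel

theorem core_addStar : ∀ B ∈ cores, ∀ t ∈ farTriples B,
    labelable (B.1 + 4) (B.2 ++ [(B.1, B.1 + 1), (B.1, B.1 + 2), (B.1, B.1 + 3),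
      (B.1 + 1, t.1), (B.1 + 2, t.2.1), (B.1 + 3, t.2.2)]) 0 0 = true := by decide +kernel

theorem core_addLongStar : ∀ B ∈ cores, ∀ t ∈ farTriples B, t.1 < t.2.1 →
    labelable (B.1 + 5) (B.2 ++ [(B.1, B.1 + 1), (B.1, B.1 + 2), (B.1, B.1 + 3),
      (B.1 + 1, t.1), (B.1 + 2, t.2.1), (B.1 + 3, B.1 + 4), (B.1 + 4, t.2.2)]) 0 0 = true := by
  decide +kernel

theorem farTriples_maximal : ∀ B ∈ cores, ∀ t ∈ farTriples B, ∀ l ∈ List.range B.1,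
    farFromHubs B l = true → l = t.1 ∨ l = t.2.1 ∨ l = t.2.2 ∨
      listAdj B.2 t.1 l = true ∨ listAdj B.2 t.2.1 l = true ∨ listAdj B.2 t.2.2 l = true := by
  decide +kernel

theorem listAdj_iff {es : List (ℕ × ℕ)} {i j : ℕ} :
    listAdj es i j = true ↔ (i, j) ∈ es ∨ (j, i) ∈ es := by
  simp [listAdj]

theorem Emb.adj_of_listAdj {G : SimpleGraph V} {W : Set V} {n : ℕ} {es : List (ℕ × ℕ)} {g : ℕ → V}
    (E : Emb G W n es g) {i j : ℕ} (h : listAdj es i j = true) : G.Adj (g i) (g j) :=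
  (listAdj_iff.1 h).elim (fun h => E.adj _ h) fun h => (E.adj _ h).symm

theorem Emb.addEdges {G : SimpleGraph V} {W : Set V} {n : ℕ} {es es' : List (ℕ × ℕ)} {g : ℕ → V}
    (E : Emb G W n es g) (h : ∀ e ∈ es', G.Adj (g e.1) (g e.2)) : Emb G W n (es ++ es') g :=
  ⟨E.inj, E.mem, E.surj, fun e he => (List.mem_append.1 he).elim (E.adj e) (h e)⟩

theorem Emb.reindex {G : SimpleGraph V} {W : Set V} {n : ℕ} {es es' : List (ℕ × ℕ)} {g : ℕ → V}
    (E : Emb G W n es g) (σ : ℕ → ℕ) (h1 : ∀ i < n, σ i < n)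
    (h2 : ∀ i < n, ∀ j < n, σ i = σ j → i = j) (h3 : ∀ i < n, ∃ j < n, σ j = i)
    (h : ∀ e ∈ es', listAdj es (σ e.1) (σ e.2) = true) : Emb G W n es' (fun i => g (σ i)) :=
  ⟨fun i hi j hj e => h2 i hi j hj (E.inj _ (h1 i hi) _ (h1 j hj) e), fun i hi => E.mem _ (h1 i hi),
    fun v hv => by
      obtain ⟨i, hi, rfl⟩ := E.surj v hv
      obtain ⟨j, hj, rfl⟩ := h3 i hi
      exact ⟨j, hj, rfl⟩,
    fun e he => E.adj_of_listAdj (h e he)⟩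

theorem Emb.nonempty_iso {G : SimpleGraph V} {n : ℕ} {es : List (ℕ × ℕ)} {g : ℕ → V}
    (E : Emb G Set.univ n es g) {ι : Type} (f : ι ≃ Fin n) {T : SimpleGraph ι}
    (h : ∀ i j : ι, G.Adj (g (f i)) (g (f j)) ↔ T.Adj i j) : Nonempty (G ≃g T) := by
  have hb : Function.Bijective fun i : ι => g (f i) := by
    refine ⟨fun i j e => f.injective (Fin.ext (E.inj _ (f i).2 _ (f j).2 e)), fun v => ?_⟩
    obtain ⟨i, hi, e⟩ := E.surj v trivial
    exact ⟨f.symm ⟨i, hi⟩, by simpa using e⟩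
  exact ⟨(RelIso.mk (Equiv.ofBijective _ hb) (fun {a b} => h a b) : T ≃g G).symm⟩

/-- Either `G` has an edge which is not in the core, or the core is all of `G`. -/
theorem Emb.extra_or_eq {G : SimpleGraph V} {B : ℕ × List (ℕ × ℕ)} {g : ℕ → V}
    (E : Emb G Set.univ B.1 B.2 g) :
    (∃ e ∈ nonEdges B, G.Adj (g e.1) (g e.2)) ∨
      ∀ i < B.1, ∀ j < B.1, G.Adj (g i) (g j) ↔ listAdj B.2 i j = true := by
  by_contra! hc
  obtain ⟨h1, i, hi, j, hj, h⟩ := hc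
  rcases h with ⟨h2, h3⟩ | ⟨h2, h3⟩
  · rcases lt_trichotomy i j with hij | rfl | hij
    · exact h1 _ (mem_nonEdges hij hj h3) h2
    · exact G.loopless.irrefl _ h2
    · refine h1 _ (mem_nonEdges hij hi fun h => h3 ?_) h2.symm
      exact listAdj_iff.2 (listAdj_iff.1 h).symm
  · exact h2 (E.adj_of_listAdj h3)

instance (l : List (Fin 7 × Fin 7)) : DecidableRel (cyc7 l).Adj := fun a b =>
  inferInstanceAs (Decidable
    (a ≠ b ∧ ((b = a + 1 ∨ (a, b) ∈ l) ∨ (a = b + 1 ∨ (b, a) ∈ l))))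

instance : DecidableRel badC4.Adj := fun a b =>
  inferInstanceAs (Decidable (a ≠ b ∧ (b = a + 1 ∨ a = b + 1)))

instance : DecidableRel badTwoC4.Adj := fun a b =>
  inferInstanceAs (Decidable (a ≠ b ∧
    ((a, b) ∈ ([(0,1),(1,2),(2,3),(3,0),(0,4),(4,5),(5,6),(6,0)] : List (Fin 7 × Fin 7)) ∨
    (b, a) ∈ ([(0,1),(1,2),(2,3),(3,0),(0,4),(4,5),(5,6),(6,0)] : List (Fin 7 × Fin 7)))))

instance : DecidableRel badK23.Adj := fun a b =>
  inferInstanceAs (Decidable ((a.isLeft ∧ b.isRight) ∨ (a.isRight ∧ b.isLeft)))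

/-- Adjacency in the 7-cycle with the long chords `{i, i + 3}` for `f i = true`. -/
def circAdj (f : Fin 7 → Bool) (i j : Fin 7) : Bool :=
  match j - i with
  | 1 => true
  | 6 => true
  | 3 => f i
  | 4 => f j
  | _ => false

/-- The long chord patterns of the five exceptional graphs with spanning 7-cycle. -/
theorem circAdj_classification : ∀ f : Fin 7 → Bool, (∀ i, ¬(f i = true ∧ f (i + 2) = true)) →
    ∃ r : Fin 7, ∃ l ∈ ([[], [(2,5)], [(0,3),(0,4)], [(1,5),(2,6)], [(1,5),(2,6),(2,5)]] :
      List (List (Fin 7 × Fin 7))),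
      ∀ i j, circAdj f (i + r) (j + r) = true ↔ (cyc7 l).Adj i j := by
  decide +kernel

theorem Emb.coreC7_cases {G : SimpleGraph V} {g : ℕ → V}
    (E : Emb G Set.univ 7 coreC7.2 g) : GoodOn G Set.univ ∨ InBadFamily G := by
  by_cases h2 : ∃ i ∈ List.range 7, G.Adj (g i) (g ((i + 2) % 7))
  · obtain ⟨i, hi, h⟩ := h2
    exact Or.inl ((E.addEdges (es' := [_]) (by simpa using h)).goodOn (by norm_num)
      (coreC7_shortChord i hi))
  by_cases h3 : ∃ i ∈ List.range 7,
      G.Adj (g i) (g ((i + 3) % 7)) ∧ G.Adj (g ((i + 2) % 7)) (g ((i + 5) % 7))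
  · obtain ⟨i, hi, h⟩ := h3
    exact Or.inl ((E.addEdges (es' := [_, _]) (by simpa using h)).goodOn (by norm_num)
      (coreC7_twoChords i hi))
  right
  have A1 : ∀ i : Fin 7, G.Adj (g i) (g ((i + 1 : Fin 7) : ℕ)) := fun i => by
    refine E.adj (i, ((i + 1 : Fin 7) : ℕ)) ?_
    revert i; decide
  have A2 : ∀ i : Fin 7, ¬G.Adj (g i) (g ((i + 2 : Fin 7) : ℕ)) := fun i h =>
    h2 ⟨i, List.mem_range.2 i.2, by rwa [Fin.val_add] at h⟩
  have hf : ∀ i : Fin 7, ¬(decide (G.Adj (g i) (g ((i + 3 : Fin 7) : ℕ))) = true ∧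
      decide (G.Adj (g ((i + 2 : Fin 7) : ℕ)) (g ((i + 2 + 3 : Fin 7) : ℕ))) = true) := by
    intro i h
    rw [decide_eq_true_eq, decide_eq_true_eq, add_assoc, Fin.val_add, Fin.val_add,
      Fin.val_add] at h
    exact h3 ⟨i, List.mem_range.2 i.2, h⟩
  obtain ⟨r, l, hl, hr⟩ := circAdj_classification _ hf
  have key : ∀ i j : Fin 7, G.Adj (g i) (g j) ↔
      circAdj (fun i => decide (G.Adj (g i) (g ((i + 3 : Fin 7) : ℕ)))) i j = true := by
    intro i j
    obtain ⟨d, rfl⟩ : ∃ d, j = i + d := ⟨j - i, by abel⟩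
    have e1 : ∀ k : Fin 7, i = i + k + -k := fun k => by abel
    unfold circAdj
    rw [add_sub_cancel_left]
    fin_cases d
    · simp
    · simpa using A1 i
    · simpa using A2 i
    · simp
    · have : i + 4 + 3 = i := by rw [add_assoc]; exact add_zero i
      simp [this, G.adj_comm]
    · have := A2 (i + 5)
      rw [show i + 5 + 2 = i by rw [add_assoc]; exact add_zero i, G.adj_comm] at this
      simpa using this
    · have := A1 (i + 6)
      rw [show i + 6 + 1 = i by rw [add_assoc]; exact add_zero i, G.adj_comm] at this
      simpa using this
  have hiso : Nonempty (G ≃g cyc7 l) := E.nonempty_iso (Equiv.addRight r) fun i j =>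
    (key _ _).trans (hr i j)
  simp only [List.mem_cons, List.not_mem_nil, or_false] at hl
  unfold InBadFamily
  rcases hl with rfl | rfl | rfl | rfl | rfl <;> simp only [hiso, true_or, or_true]

theorem BadOn.good_or_inBadFamily {G : SimpleGraph V} (h : BadOn G Set.univ) :
    GoodOn G Set.univ ∨ InBadFamily G := by
  obtain ⟨B, hB, g, E⟩ := h
  have hsmall : B ∈ [coreC4, coreK23] → (∃ e ∈ nonEdges B, G.Adj (g e.1) (g e.2)) →
      GoodOn G Set.univ := fun hB' ⟨e, he, h⟩ =>
    (E.addEdges (es' := [e]) (by simpa using h)).goodOn (cores_lt hB).1 (core_addEdge B hB' e he)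
  simp only [cores, List.mem_cons, List.not_mem_nil, or_false] at hB
  unfold InBadFamily
  rcases hB with rfl | rfl | rfl | rfl
  · rcases E.extra_or_eq with h | h
    · exact Or.inl (hsmall (by simp) h)
    · refine Or.inr (Or.inl (E.nonempty_iso (Equiv.refl (Fin 4)) fun i j =>
        (h _ i.2 _ j.2).trans ?_))
      revert i j; decide
  · rcases E.extra_or_eq with h | h
    · exact Or.inl (hsmall (by simp) h)
    · refine Or.inr (Or.inr (Or.inl (E.nonempty_iso (finSumFinEquiv : Fin 2 ⊕ Fin 3 ≃ Fin 5)
        fun i j => (h _ (Fin.is_lt _) _ (Fin.is_lt _)).trans ?_)))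
      revert i j; decide
  · exact E.coreC7_cases
  · rcases E.extra_or_eq with ⟨e, he, h⟩ | h
    · have E' := E.addEdges (es' := [e]) (by simpa using h)
      rcases coreTwoC4_addEdge e he with he | he
      · have hσ : ∀ e ∈ [(1, 4), (1, 6), (3, 4), (3, 6)], ∃ p ∈ [[0, 3, 2, 1, 4, 5, 6],
            [0, 3, 2, 1, 6, 5, 4], [0, 1, 2, 3, 4, 5, 6], [0, 1, 2, 3, 6, 5, 4]],
            (∀ i < 7, p.getD i 0 < 7) ∧ (∀ i < 7, ∀ j < 7, p.getD i 0 = p.getD j 0 → i = j) ∧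
            (∀ i < 7, ∃ j < 7, p.getD j 0 = i) ∧ ∀ e' ∈ coreC7.2,
              listAdj (coreTwoC4.2 ++ [e]) (p.getD e'.1 0) (p.getD e'.2 0) = true := by
          decide +kernel
        obtain ⟨p, -, h1, h2, h3, h4⟩ := hσ e he
        exact (E'.reindex (fun i => p.getD i 0) h1 h2 h3 h4).coreC7_cases
      · exact Or.inl (E'.goodOn (by decide) he)
    · refine Or.inr (Or.inr (Or.inr (Or.inr (Or.inl (E.nonempty_iso (Equiv.refl (Fin 7))
        fun i j => (h _ i.2 _ j.2).trans ?_)))))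
      revert i j; decide +kernel

theorem CutConn.of_gate {G : SimpleGraph V} {W A : Set V} (h : CutConn G W) (hA : A ⊆ W) {a : V}
    (hg : ∀ x ∈ A, ∀ y ∈ W \ A, G.Adj x y → x = a) : CutConn G A := by
  rintro C hC ⟨c, hc⟩ ⟨d, hd⟩
  by_cases ha : a ∈ C
  · obtain ⟨x, hx, y, hy, hxy⟩ := h (A \ C) (Set.sdiff_subset.trans hA) ⟨d, hd⟩
      ⟨c, hA (hC hc), fun h => h.2 hc⟩
    by_cases hyA : y ∈ A
    · exact ⟨y, by_contra fun h => hy.2 ⟨hyA, h⟩, x, hx, hxy.symm⟩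
    · exact (hx.2 (hg x hx.1 y ⟨hy.1, hyA⟩ hxy ▸ ha)).elim
  · obtain ⟨x, hx, y, hy, hxy⟩ := h C (hC.trans hA) ⟨c, hc⟩ ⟨d, hA hd.1, hd.2⟩
    by_cases hyA : y ∈ A
    · exact ⟨x, hx, y, ⟨hyA, hy.2⟩, hxy⟩
    · exact (ha (hg x (hC hx) y ⟨hy.1, hyA⟩ hxy ▸ hx)).elim

theorem Rooted.mono_miss {G : SimpleGraph V} {W : Set V} {a : V} {R m m' : Set (Fin 5)}
    (h : Rooted G W a R m) (hm : m ⊆ m') : Rooted G W a R m' :=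
  h.perm (Equiv.refl _) (fun _ => Iff.rfl) fun _ h => hm h

theorem BadOn.rooted {G : SimpleGraph V} {W : Set V} (h : BadOn G W) {a : V} (ha : a ∈ W) :
    Rooted G W a {0, 1} {2} ∨
      Rooted G W a {0, 1} {2, 3} ∧ ∃ g, Emb G W 4 coreC4.2 g ∧ g 0 = a := by
  obtain ⟨B, hB, g, E⟩ := h
  obtain ⟨i, hi, rfl⟩ := E.surj a ha
  have h4 : {c : Fin 5 | Nat.testBit 4 c = true} ⊆ {2} := by
    simp only [Set.subset_def, Set.mem_ofPred_eq, Set.mem_singleton_iff]; decide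
  have h12 : {c : Fin 5 | Nat.testBit 12 c = true} ⊆ {2, 3} := by
    simp only [Set.subset_def, Set.mem_ofPred_eq, Set.mem_insert_iff, Set.mem_singleton_iff]; decide
  rcases List.mem_cons.1 hB with rfl | hB
  · right
    refine ⟨(E.rooted hi (coreC4_root i (List.mem_range.2 hi))).mono_miss h12, ?_⟩
    have hσ : ∀ i < 4, (∀ j < 4, (i + j) % 4 < 4) ∧
        (∀ j < 4, ∀ k < 4, (i + j) % 4 = (i + k) % 4 → j = k) ∧
        (∀ j < 4, ∃ k < 4, (i + k) % 4 = j) ∧ ∀ e ∈ coreC4.2,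
          listAdj coreC4.2 ((i + e.1) % 4) ((i + e.2) % 4) = true := by decide +kernel
    obtain ⟨h1, h2, h3, h4⟩ := hσ i hi
    refine ⟨_, E.reindex (fun j => (i + j) % 4) h1 h2 h3 h4, ?_⟩
    change g (i % 4) = g i
    rw [Nat.mod_eq_of_lt (show i < 4 from hi)]
  · exact Or.inl ((E.rooted hi (core_root B hB i (List.mem_range.2 hi))).mono_miss h4)

theorem rooted_of_dichotomy [Finite V] {G : SimpleGraph V} {W : Set V}
    (h : GoodOn G W ∨ BadOn G W) {a : V} (ha : a ∈ W) : Rooted G W a {0, 1} {2} ∨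
      Rooted G W a {0, 1} {2, 3} ∧ ∃ g, Emb G W 4 coreC4.2 g ∧ g 0 = a :=
  h.elim (fun h => Or.inl ((h.rooted ha).mono_miss (Set.empty_subset _))) fun h => h.rooted ha

theorem rooted_weaken {G : SimpleGraph V} {W : Set V} {a : V}
    (h : Rooted G W a {0, 1} {2} ∨
      Rooted G W a {0, 1} {2, 3} ∧ ∃ g, Emb G W 4 coreC4.2 g ∧ g 0 = a) :
    Rooted G W a {0, 1} {2, 3} :=
  h.elim (fun h => h.mono_miss (by simp)) fun h => h.1

theorem rooted_of_pendant [Finite V] (hs : SmallerOK V) {G : SimpleGraph V} (n : ℕ) :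
    ∀ (W : Set V) (a : V), W.ncard = n → W ≠ Set.univ → a ∈ W → CutConn G W →
      (∀ v ∈ W, v ≠ a → ∃ b ∈ W, ∃ c ∈ W, b ≠ c ∧ G.Adj v b ∧ G.Adj v c) →
      (∃ b ∈ W, G.Adj a b) → Rooted G W a {0, 1} {2, 3} := by
  induction n with
  | zero =>
    intro W a hn _ ha
    rw [Set.ncard_eq_zero] at hn
    simp [hn] at ha
  | succ n ih =>
    intro W a hn hW ha hc hd ⟨a₁, h1W, h1⟩
    by_cases h2 : ∃ b ∈ W, b ≠ a₁ ∧ G.Adj a b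
    · obtain ⟨b, hb, hne, hab⟩ := h2
      refine rooted_weaken (rooted_of_dichotomy (hs W hW G hc (fun v hv => ?_) ⟨a, ha⟩) ha)
      by_cases e : v = a
      · subst e; exact ⟨b, hb, a₁, h1W, hne, hab, h1⟩
      · exact hd v hv e
    · push Not at h2
      have hu : ∀ b ∈ W, G.Adj a b → b = a₁ := fun b hb h => by_contra fun e => h2 b hb e h
      have hne : a₁ ≠ a := h1.ne'
      have hsub : W \ {a} ⊆ W := Set.sdiff_subset
      have hR : Rooted G (W \ {a}) a₁ {0, 1} {2, 3} := by
        refine ih (W \ {a}) a₁ ?_ (fun h => ?_) ⟨h1W, hne⟩ (hc.of_gate hsub (a := a₁) ?_) ?_ ?_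
        · rw [Set.ncard_sdiff_singleton_of_mem ha, hn]; rfl
        · exact (h ▸ Set.mem_univ a : a ∈ W \ {a}).2 rfl
        · intro x hx y hy hxy
          have : y = a := by_contra fun e => hy.2 ⟨hy.1, e⟩
          subst this
          exact hu x hx.1 hxy.symm
        · intro v hv hva
          obtain ⟨b, hb, c, hc, hbc, h3, h4⟩ := hd v hv.1 hv.2
          exact ⟨b, ⟨hb, fun e => hva (hu v hv.1 ((e : b = a) ▸ h3.symm))⟩, c,
            ⟨hc, fun e => hva (hu v hv.1 ((e : c = a) ▸ h4.symm))⟩, hbc, h3, h4⟩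
        · obtain ⟨b, hb, c, hc, hbc, h3, h4⟩ := hd a₁ h1W hne
          by_cases e : b = a
          · exact ⟨c, ⟨hc, fun h => hbc (e.trans (h : c = a).symm)⟩, h4⟩
          · exact ⟨b, ⟨hb, e⟩, h3⟩
      obtain ⟨X, κ, hκ, k1, k2, k3⟩ := hR
      have haX : ∀ ω, a ∉ X.D ω := fun ω h => (k1 ω h).2 rfl
      have hR' : Rooted G W a {2, 3} {4} := by
        refine ⟨X.withSet fun ω => {v | v ∈ X.D ω ∨ v = a ∧ (κ ω = 2 ∨ κ ω = 3)}, κ, hκ,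
          fun ω v hv => ?_, fun ω h0 => ⟨?_, fun v hv hva => ?_⟩, fun v hv => ?_⟩
        · rcases hv with hv | ⟨rfl, -⟩
          · exact (k1 ω hv).1
          · exact ha
        · change (a ∈ X.D ω ∨ a = a ∧ (κ ω = 2 ∨ κ ω = 3)) ↔ (κ ω = 2 ∨ κ ω = 3)
          exact ⟨fun h => h.elim (fun h => (haX ω h).elim) And.right, fun h => Or.inr ⟨rfl, h⟩⟩
        · have k := k2 ω h0
          by_cases e : v = a
          · subst e
            have h5 : ∀ c : Fin 5, c ≠ 4 → c = 0 ∨ c = 1 ∨ c = 2 ∨ c = 3 := by decide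
            rcases h5 _ (hva rfl) with h | h | h
            · exact Or.inr ⟨a₁, Or.inl (k.1.2 (Or.inl h)), h1.symm⟩
            · exact Or.inr ⟨a₁, Or.inl (k.1.2 (Or.inr h)), h1.symm⟩
            · exact Or.inl (Or.inr ⟨rfl, h⟩)
          · by_cases e1 : v = a₁ ∧ (κ ω = 2 ∨ κ ω = 3)
            · exact Or.inr ⟨a, Or.inr ⟨rfl, e1.2⟩, by rw [e1.1]; exact h1⟩
            · exact (k.2 v ⟨hv, e⟩ fun e2 h => e1 ⟨e2, h⟩).mono (fun u hu => Or.inl hu)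
                fun _ _ h => h
        · by_cases e : v = a
          · subst e
            refine le_of_eq ((X.ex_congr (g := fun ω => ind (κ ω = 2) + ind (κ ω = 3))
              fun ω _ => ?_).trans ?_)
            · change ind (v ∈ X.D ω ∨ v = v ∧ (κ ω = 2 ∨ κ ω = 3)) = _
              by_cases e2 : κ ω = 2
              · rw [ind_true (Or.inr ⟨rfl, Or.inl e2⟩), ind_true e2, ind_false (by rw [e2]; decide)]
                norm_num
              · by_cases e3 : κ ω = 3
                · rw [ind_true (Or.inr ⟨rfl, Or.inr e3⟩), ind_true e3, ind_false e2]
                  norm_num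
                · rw [ind_false, ind_false e2, ind_false e3, add_zero]
                  exact fun h => h.elim (haX ω) fun h => h.2.elim e2 e3
            · rw [X.ex_add, hκ, hκ]; norm_num
          · refine le_of_eq_of_le (X.ex_congr fun ω _ => ?_) (k3 v ⟨hv, e⟩)
            change ind (v ∈ X.D ω ∨ v = a ∧ (κ ω = 2 ∨ κ ω = 3)) = _
            unfold ind
            simp [e]
      refine hR'.perm (Equiv.addRight 3) ?_ ?_ <;>
      · simp only [Set.mem_insert_iff, Set.mem_singleton_iff, Equiv.coe_addRight]; decide

theorem goodOn_couple {G : SimpleGraph V} {X Y : RandSet V} {κ : X.Ω → Fin 5} {μ : Y.Ω → Fin 5}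
    (hμ : Y.Unif μ)
    (hdom : ∀ ω ω', X.p ω ≠ 0 → Y.p ω' ≠ 0 → κ ω = μ ω' → ∀ v, DomBy G (X.D ω ∪ Y.D ω') v)
    (hκ : X.Unif κ)
    (hpr : ∀ v, (X.pr v ≤ 2 / 5 ∧ ∀ ω ω', X.p ω ≠ 0 → Y.p ω' ≠ 0 → κ ω = μ ω' → v ∈ Y.D ω' →
      v ∈ X.D ω) ∨ (Y.pr v ≤ 2 / 5 ∧ ∀ ω ω', X.p ω ≠ 0 → Y.p ω' ≠ 0 → κ ω = μ ω' → v ∈ X.D ω →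
      v ∈ Y.D ω')) : GoodOn G Set.univ := by
  let Z := RandSet.couple κ hμ fun ω ω' => X.D ω ∪ Y.D ω'
  refine ⟨Z, fun _ => Set.subset_univ _, fun ω h0 v _ => ?_, fun v _ => ?_⟩
  · obtain ⟨h1, h2, h3⟩ := RandSet.couple_supp h0
    exact hdom ω.1 ω.2 h1 h2 h3 v
  · rcases hpr v with ⟨hp, h⟩ | ⟨hp, h⟩
    · refine le_trans (Z.ex_mono fun ω h0 => ?_)
        ((RandSet.couple_fst κ hμ _ fun ω => ind (v ∈ X.D ω)).trans_le hp)
      obtain ⟨h1, h2, h3⟩ := RandSet.couple_supp h0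
      exact ind_mono fun hv => hv.elim id (h ω.1 ω.2 h1 h2 h3)
    · refine le_trans (Z.ex_mono fun ω h0 => ?_)
        ((RandSet.couple_snd hκ hμ _ fun ω => ind (v ∈ Y.D ω)).trans_le hp)
      obtain ⟨h1, h2, h3⟩ := RandSet.couple_supp h0
      exact ind_mono fun hv => hv.elim (h ω.1 ω.2 h1 h2 h3) id

/-- A graph violating the dichotomy, of minimal order and edge-minimal. -/
structure MinCounterexample (G : SimpleGraph V) : Prop where
  conn : CutConn G Set.univ
  deg : MinDegTwo G Set.univ
  not_good : ¬GoodOn G Set.univ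
  not_bad : ¬BadOn G Set.univ
  small : SmallerOK V
  edge : ∀ H < G, CutConn H Set.univ → MinDegTwo H Set.univ →
    GoodOn H Set.univ ∨ BadOn H Set.univ

namespace MinCounterexample

variable {G : SimpleGraph V}

theorem conn' (hG : MinCounterexample G) {A : Set V} {x y : V} (hx : x ∈ A) (hy : y ∉ A) :
    ∃ a ∈ A, ∃ b ∉ A, G.Adj a b := by
  obtain ⟨a, ha, b, hb, h⟩ := hG.conn A (Set.subset_univ _) ⟨x, hx⟩ ⟨y, trivial, hy⟩
  exact ⟨a, ha, b, hb.2, h⟩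

theorem bridge_rooted [Finite V] (hG : MinCounterexample G) {A : Set V} {a b : V}
    (ha : a ∈ A) (hb : b ∉ A) (h : ∀ x ∈ A, ∀ y ∉ A, G.Adj x y → x = a ∧ y = b) :
    Rooted G A a {0, 1} {2, 3} := by
  refine rooted_of_pendant hG.small _ A a rfl (fun e => hb (e ▸ trivial)) ha
    (hG.conn.of_gate (Set.subset_univ _) fun x hx y hy hxy => (h x hx y hy.2 hxy).1) ?_ ?_
  · intro v hv hva
    obtain ⟨p, -, q, -, hpq, hp, hq⟩ := hG.deg v trivial
    exact ⟨p, by_contra fun e => hva (h v hv p e hp).1, q,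
      by_contra fun e => hva (h v hv q e hq).1, hpq, hp, hq⟩
  · obtain ⟨p, -, q, -, hpq, hp, hq⟩ := hG.deg a trivial
    by_cases e : p ∈ A
    · exact ⟨p, e, hp⟩
    · refine ⟨q, by_contra fun e' => hpq ?_, hq⟩
      rw [(h a ha p e hp).2, (h a ha q e' hq).2]

/-- There are no bridges. -/
theorem exists_other_crossing [Finite V] (hG : MinCounterexample G) {A : Set V} {a b : V}
    (ha : a ∈ A) (hb : b ∉ A) (hab : G.Adj a b) :
    ∃ x ∈ A, ∃ y ∉ A, G.Adj x y ∧ (x ≠ a ∨ y ≠ b) := by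
  by_contra! hc
  have hX := hG.bridge_rooted ha hb hc
  have hY : Rooted G Aᶜ b {0, 1} {2, 3} :=
    hG.bridge_rooted (b := a) (a := b) hb (fun h => h ha) fun x hx y hy hxy =>
      (hc y (not_not.1 hy) x hx hxy.symm).symm
  have hY' : Rooted G Aᶜ b {2, 3} {0, 1} :=
    hY.perm ((Equiv.swap 0 2).trans (Equiv.swap 1 3))
      (by simp only [Set.mem_insert_iff, Set.mem_singleton_iff]; decide)
      (by simp only [Set.mem_insert_iff, Set.mem_singleton_iff]; decide)
  obtain ⟨X, κ, hκ, x1, x2, x3⟩ := hX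
  obtain ⟨Y, μ, hμ, y1, y2, y3⟩ := hY'
  refine hG.not_good (goodOn_couple hμ (fun ω ω' h0 h0' hk v => ?_) hκ fun v => ?_)
  · by_cases hv : v ∈ A
    · by_cases e : v = a ∧ κ ω ∈ ({2, 3} : Set (Fin 5))
      · exact Or.inr ⟨b, Or.inr ((y2 ω' h0').1.2 (hk ▸ e.2)), by rw [e.1]; exact hab.symm⟩
      · exact ((x2 ω h0).2 v hv fun e1 e2 => e ⟨e1, e2⟩).mono Set.subset_union_left
          fun _ _ h => h
    · by_cases e : v = b ∧ μ ω' ∈ ({0, 1} : Set (Fin 5))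
      · exact Or.inr ⟨a, Or.inl ((x2 ω h0).1.2 (hk ▸ e.2)), by rw [e.1]; exact hab⟩
      · exact ((y2 ω' h0').2 v hv fun e1 e2 => e ⟨e1, e2⟩).mono Set.subset_union_right
          fun _ _ h => h
  · by_cases hv : v ∈ A
    · exact Or.inl ⟨x3 v hv, fun ω ω' _ _ _ h => (y1 ω' h hv).elim⟩
    · exact Or.inr ⟨y3 v hv, fun ω ω' _ _ _ h => (hv (x1 ω h)).elim⟩

theorem side_conn_deg [Finite V] (hG : MinCounterexample G) {A : Set V} {a c : V} (ha : a ∈ A)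
    (hc : c ∉ A) (h : ∀ x ∈ A, ∀ y ∉ A, G.Adj x y → y = c) :
    CutConn G (insert c A) ∧ MinDegTwo G (insert c A) := by
  constructor
  · refine hG.conn.of_gate (Set.subset_univ _) (a := c) fun x hx y hy hxy => ?_
    rcases hx with rfl | hx
    · rfl
    · exact (hy.2 (Or.inl (h x hx y (fun e => hy.2 (Or.inr e)) hxy))).elim
  · rintro v (rfl | hv)
    · obtain ⟨x, hx, y, hy, hxy⟩ := hG.conn' ha hc
      obtain rfl := h x hx y hy hxy
      obtain ⟨x', hx', y', hy', hxy', hne⟩ := hG.exists_other_crossing hx hy hxy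
      obtain rfl := h x' hx' y' hy' hxy'
      exact ⟨x, Or.inr hx, x', Or.inr hx', fun e => hne.elim (fun h => h e.symm) fun h => h rfl,
        hxy.symm, hxy'.symm⟩
    · obtain ⟨p, -, q, -, hpq, hp, hq⟩ := hG.deg v trivial
      have : ∀ p, G.Adj v p → p ∈ insert c A := fun p hp => by
        by_cases e : p ∈ A
        · exact Or.inr e
        · exact Or.inl (h v hv p e hp)
      exact ⟨p, this p hp, q, this q hq, hpq, hp, hq⟩

theorem not_good_glue (hG : MinCounterexample G) {A B : Set V} {c : V}
    (hAB : ∀ v, v ∈ A ∨ v ∈ B)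
    (hcA : c ∈ A) (hcB : c ∈ B) (hc : ∀ v, v ∈ A → v ∈ B → v = c)
    (hX : Rooted G A c {0, 1} {2}) (hY : Rooted G B c {0, 1} {2, 3}) : False := by
  have hY' : Rooted G B c {0, 1} {3, 4} :=
    hY.perm ((Equiv.swap 2 3).trans (Equiv.swap 2 4))
      (by simp only [Set.mem_insert_iff, Set.mem_singleton_iff]; decide)
      (by simp only [Set.mem_insert_iff, Set.mem_singleton_iff]; decide)
  obtain ⟨X, κ, hκ, x1, x2, x3⟩ := hX
  obtain ⟨Y, μ, hμ, y1, y2, y3⟩ := hY'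
  refine hG.not_good (goodOn_couple hμ (fun ω ω' h0 h0' hk v => ?_) hκ fun v => ?_)
  · have hA : v ∈ A → (v = c → κ ω ≠ 2) → DomBy G (X.D ω ∪ Y.D ω') v := fun hv h =>
      ((x2 ω h0).2 v hv h).mono Set.subset_union_left fun _ _ h => h
    have hB : v ∈ B → (v = c → μ ω' ∉ ({3, 4} : Set (Fin 5))) → DomBy G (X.D ω ∪ Y.D ω') v :=
      fun hv h => ((y2 ω' h0').2 v hv h).mono Set.subset_union_right fun _ _ h => h
    by_cases h2 : κ ω = 2
    · by_cases hv : v ∈ B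
      · refine hB hv fun _ => ?_
        rw [← hk, h2]
        simp only [Set.mem_insert_iff, Set.mem_singleton_iff]; decide
      · refine hA ((hAB v).resolve_right hv) fun e => (hv (e ▸ hcB)).elim
    · by_cases hv : v ∈ A
      · exact hA hv fun _ => h2
      · refine hB ((hAB v).resolve_left hv) fun e => (hv (e ▸ hcA)).elim
  · by_cases hv : v ∈ A
    · refine Or.inl ⟨x3 v hv, fun ω ω' h0 h0' hk h => ?_⟩
      obtain rfl := hc v hv (y1 ω' h)
      exact (x2 ω h0).1.2 (hk ▸ (y2 ω' h0').1.1 h)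
    · exact Or.inr ⟨y3 v ((hAB v).resolve_left hv), fun ω ω' _ _ _ h => (hv (x1 ω h)).elim⟩

end MinCounterexample

theorem Emb.coreTwoC4 {G : SimpleGraph V} {A B : Set V} {g g' : ℕ → V} {c : V}
    (E : Emb G A 4 coreC4.2 g) (E' : Emb G B 4 coreC4.2 g') (h : g 0 = c) (h' : g' 0 = c)
    (hAB : ∀ v, v ∈ A ∨ v ∈ B) (hc : ∀ v, v ∈ A → v ∈ B → v = c) : BadOn G Set.univ := by
  have h0 : ∀ i < 4, i ≠ 0 → g' i ∉ A := fun i hi hne hA =>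
    hne (E'.inj i hi 0 (by norm_num) ((hc _ hA (E'.mem i hi)).trans h'.symm))
  refine ⟨_root_.coreTwoC4, by simp [cores], _,
    E.extend (xs := [g' 1, g' 2, g' 3]) ?_ ?_ (fun v => ⟨fun _ => ?_, fun _ => trivial⟩) ?_⟩
  · have := E'.inj
    simp only [List.nodup_cons, List.mem_cons, List.not_mem_nil, or_false, not_or]
    refine ⟨⟨fun e => ?_, fun e => ?_⟩, fun e => ?_, by simp⟩
    · exact absurd (this 1 (by norm_num) 2 (by norm_num) e) (by norm_num)
    · exact absurd (this 1 (by norm_num) 3 (by norm_num) e) (by norm_num)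
    · exact absurd (this 2 (by norm_num) 3 (by norm_num) e) (by norm_num)
  · simp only [List.mem_cons, List.not_mem_nil, or_false]
    rintro _ (rfl | rfl | rfl) <;> exact h0 _ (by norm_num) (by norm_num)
  · refine (em (v ∈ A)).imp_right fun hv => ?_
    obtain ⟨i, hi, rfl⟩ := E'.surj v ((hAB v).resolve_left hv)
    have h3 : g' 0 ∈ A := h'.symm ▸ h ▸ E.mem 0 (by norm_num)
    interval_cases i
    · exact (hv h3).elim
    all_goals simp
  · have e1 := E.adj
    have e2 := E'.adj
    simp only [coreC4, List.forall_mem_cons, List.not_mem_nil, false_imp_iff, implies_true,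
      and_true] at e1 e2
    rw [h'] at e2
    simp [_root_.coreTwoC4, extendEnum, h] at e1 ⊢
    tauto

namespace MinCounterexample

variable {G : SimpleGraph V}

/-- There are no cut vertices. -/
theorem exists_crossing_avoiding [Finite V] (hG : MinCounterexample G) {A : Set V} {a b c : V}
    (hc : c ∉ A) (ha : a ∈ A) (hb : b ∉ A) (hbc : b ≠ c) :
    ∃ x ∈ A, ∃ y ∉ A, y ≠ c ∧ G.Adj x y := by
  by_contra! h
  have hA : ∀ x ∈ A, ∀ y ∉ A, G.Adj x y → y = c := fun x hx y hy hxy =>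
    by_contra fun e => h x hx y hy e hxy
  have hB : ∀ x ∈ (insert c A)ᶜ, ∀ y ∉ (insert c A)ᶜ, G.Adj x y → y = c := fun x hx y hy hxy =>
    (not_not.1 hy).elim id fun hy => (hx (Or.inl (hA y hy x (fun e => hx (Or.inr e)) hxy.symm))).elim
  have hbB : b ∈ (insert c A)ᶜ := fun h => h.elim hbc hb
  have hcB : c ∉ (insert c A)ᶜ := fun h => h (Or.inl rfl)
  obtain ⟨c1, d1⟩ := hG.side_conn_deg ha hc hA
  obtain ⟨c2, d2⟩ := hG.side_conn_deg hbB hcB hB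
  have r1 := rooted_of_dichotomy (hG.small _ (fun e => hbB ((Set.ext_iff.1 e b).2 trivial))
    G c1 d1 ⟨c, Or.inl rfl⟩) (Set.mem_insert c A)
  have r2 := rooted_of_dichotomy (hG.small _ (fun e =>
    ((Set.ext_iff.1 e a).2 trivial).elim (fun e => hc (e ▸ ha)) fun h => h (Or.inr ha))
    G c2 d2 ⟨c, Or.inl rfl⟩) (Set.mem_insert c _)
  have hAB : ∀ v, v ∈ insert c A ∨ v ∈ insert c (insert c A)ᶜ := fun v =>
    (em (v ∈ insert c A)).imp_right Or.inr
  have hcc : ∀ v, v ∈ insert c A → v ∈ insert c (insert c A)ᶜ → v = c := fun v hv h =>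
    h.elim id fun h => (h hv).elim
  rcases r1 with r1 | r1
  · exact hG.not_good_glue hAB (Or.inl rfl) (Or.inl rfl) hcc r1 (rooted_weaken r2)
  rcases r2 with r2 | r2
  · exact hG.not_good_glue (fun v => (hAB v).symm) (Or.inl rfl) (Or.inl rfl)
      (fun v h1 h2 => hcc v h2 h1) r2 r1.1
  obtain ⟨-, g, E, h0⟩ := r1
  obtain ⟨-, g', E', h0'⟩ := r2
  exact hG.not_bad (E.coreTwoC4 E' h0 h0' hAB hcc)

end MinCounterexample

/-- A vertex with at least three neighbours. -/
def Hub (G : SimpleGraph V) (x : V) : Prop :=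
  ∃ a b c, a ≠ b ∧ a ≠ c ∧ b ≠ c ∧ G.Adj x a ∧ G.Adj x b ∧ G.Adj x c

/-- The neighbours of `x` are exactly `a` and `b`. -/
def Two (G : SimpleGraph V) (x a b : V) : Prop := a ≠ b ∧ ∀ w, G.Adj x w ↔ w = a ∨ w = b

theorem Two.symm {G : SimpleGraph V} {x a b : V} (h : Two G x a b) : Two G x b a :=
  ⟨h.1.symm, fun w => (h.2 w).trans or_comm⟩

theorem Two.left {G : SimpleGraph V} {x a b : V} (h : Two G x a b) : G.Adj x a :=
  (h.2 a).2 (Or.inl rfl)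

theorem Two.right {G : SimpleGraph V} {x a b : V} (h : Two G x a b) : G.Adj x b :=
  (h.2 b).2 (Or.inr rfl)

theorem Two.not_hub {G : SimpleGraph V} {x a b : V} (h : Two G x a b) : ¬Hub G x := by
  rintro ⟨p, q, r, hpq, hpr, hqr, hp, hq, hr⟩
  rw [h.2] at hp hq hr
  grind

theorem Two.exists_other {G : SimpleGraph V} {x a b u : V} (h : Two G x a b) (hu : G.Adj x u) :
    ∃ v, Two G x u v := by
  rcases (h.2 u).1 hu with rfl | rfl
  · exact ⟨_, h⟩
  · exact ⟨_, h.symm⟩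

/-- A hub has a neighbour avoiding any two vertices. -/
theorem Hub.exists_adj {G : SimpleGraph V} {x : V} (h : Hub G x) (p q : V) :
    ∃ a, a ≠ p ∧ a ≠ q ∧ G.Adj x a := by
  obtain ⟨a, b, c, hab, hac, hbc, ha, hb, hc⟩ := h
  grind

/-- A hub has two neighbours avoiding any vertex. -/
theorem Hub.exists_two {G : SimpleGraph V} {x : V} (h : Hub G x) (p : V) :
    ∃ a b, a ≠ b ∧ a ≠ p ∧ b ≠ p ∧ G.Adj x a ∧ G.Adj x b := by
  obtain ⟨a, -, ha, hxa⟩ := h.exists_adj p p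
  obtain ⟨b, hbp, hba, hxb⟩ := h.exists_adj p a
  exact ⟨a, b, hba.symm, ha, hbp, hxa, hxb⟩

namespace MinCounterexample

variable {G : SimpleGraph V}

theorem two_of_not_hub (hG : MinCounterexample G) {x : V} (hx : ¬Hub G x) : ∃ a b, Two G x a b := by
  obtain ⟨a, -, b, -, hab, ha, hb⟩ := hG.deg x trivial
  refine ⟨a, b, hab, fun w => ⟨fun hw => ?_, ?_⟩⟩
  · by_contra! h
    exact hx ⟨a, b, w, hab, h.1.symm, h.2.symm, ha, hb, hw⟩
  · rintro (rfl | rfl) <;> assumption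

theorem not_adj_hubs [Finite V] (hG : MinCounterexample G) {u v : V} (hu : Hub G u)
    (hv : Hub G v) : ¬G.Adj u v := by
  intro huv
  let H : SimpleGraph V := G.deleteEdges {s(u, v)}
  have hH : ∀ x y, H.Adj x y ↔ G.Adj x y ∧ ¬(x = u ∧ y = v ∨ x = v ∧ y = u) := fun x y => by
    simp [H, SimpleGraph.deleteEdges_adj]
  have hlt : H < G := by
    refine lt_of_le_of_ne (SimpleGraph.deleteEdges_le _) fun e => ?_
    have := (hH u v).1 (e ▸ huv)
    simp at this
  have key := hG.edge H hlt ?_ ?_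
  · rcases key with h | h
    · exact hG.not_good (h.mono fun x _ y _ h => hlt.le h)
    · exact hG.not_bad (h.mono hlt.le)
  · rintro A - ⟨a, ha⟩ ⟨b, -, hb⟩
    obtain ⟨x, hx, y, hy, hxy⟩ := hG.conn' ha hb
    by_cases e : x = u ∧ y = v ∨ x = v ∧ y = u
    · obtain ⟨x', hx', y', hy', hxy', hne⟩ := hG.exists_other_crossing hx hy hxy
      exact ⟨x', hx', y', ⟨trivial, hy'⟩, (hH _ _).2 ⟨hxy', by grind⟩⟩
    · exact ⟨x, hx, y, ⟨trivial, hy⟩, (hH _ _).2 ⟨hxy, e⟩⟩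
  · intro w _
    by_cases e1 : w = u
    · obtain ⟨a, b, h1, h2, h3, h4, h5⟩ := hu.exists_two v
      have := huv.ne
      exact ⟨a, trivial, b, trivial, h1, (hH _ _).2 (by grind), (hH _ _).2 (by grind)⟩
    by_cases e2 : w = v
    · obtain ⟨a, b, h1, h2, h3, h4, h5⟩ := hv.exists_two u
      have := huv.ne
      exact ⟨a, trivial, b, trivial, h1, (hH _ _).2 (by grind), (hH _ _).2 (by grind)⟩
    · obtain ⟨a, -, b, -, h1, h2, h3⟩ := hG.deg w trivial
      exact ⟨a, trivial, b, trivial, h1, (hH _ _).2 (by grind), (hH _ _).2 (by grind)⟩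

end MinCounterexample

theorem cores_two_adj : ∀ B ∈ cores, ∀ i ∈ List.range B.1, ∃ j ∈ List.range B.1,
    ∃ k ∈ List.range B.1, j ≠ k ∧ listAdj B.2 i j = true ∧ listAdj B.2 i k = true := by
  decide +kernel

theorem cores_asymm : ∀ B ∈ cores, ∀ e ∈ B.2, (e.2, e.1) ∉ B.2 := by decide +kernel

/-- The vertices of the cycle obtained from `coreC4` by subdividing the edge starting in `k`. -/
def subdividedC4 (k i : ℕ) : ℕ := [k, 4, 5, 6, (k + 1) % 4, (k + 2) % 4, (k + 3) % 4].getD i 0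

theorem subdividedC4_spec : ∀ e ∈ coreC4.2, (∀ i < 7, subdividedC4 e.1 i < 7) ∧
    (∀ i < 7, ∀ j < 7, subdividedC4 e.1 i = subdividedC4 e.1 j → i = j) ∧
    (∀ i < 7, ∃ j < 7, subdividedC4 e.1 j = i) ∧
    ∀ e' ∈ coreC7.2, listAdj (coreC4.2.filter (· != e) ++ [(e.1, 4), (4, 5), (5, 6), (6, e.2)])
      (subdividedC4 e.1 e'.1) (subdividedC4 e.1 e'.2) = true := by
  decide +kernel

theorem Emb.of_list {G : SimpleGraph V} {xs : List V} {es : List (ℕ × ℕ)} (a : V)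
    (hnd : xs.Nodup) (hmem : ∀ v, v ∈ xs)
    (hadj : ∀ e ∈ es, G.Adj (xs.getD e.1 a) (xs.getD e.2 a)) :
    Emb G Set.univ xs.length es (fun i => xs.getD i a) := by
  have E0 : Emb G ∅ 0 [] fun _ => a := ⟨by simp, by simp, by simp, by simp⟩
  have := E0.extend (G := G) (W' := Set.univ) (es' := es) hnd (by simp) (by simpa using hmem)
    (by simpa [extendEnum] using hadj)
  have h : extendEnum (fun _ => a) 0 xs = fun i => xs.getD i a := by
    ext i; simp [extendEnum]
  rwa [h, zero_add] at this

theorem Emb.subdivide {G H : SimpleGraph V} {W : Set V} {B : ℕ × List (ℕ × ℕ)} (hB : B ∈ cores)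
    {g : ℕ → V} (E : Emb H W B.1 B.2 g) {e : ℕ × ℕ} (he : e ∈ B.2) {x y z : V}
    (hnd : [x, y, z].Nodup) (hW : ∀ v, v ∉ W ↔ v ∈ [x, y, z])
    (hH : ∀ a b, H.Adj a b → ¬(a = g e.1 ∧ b = g e.2 ∨ a = g e.2 ∧ b = g e.1) → G.Adj a b)
    (h1 : G.Adj (g e.1) x) (h2 : G.Adj x y) (h3 : G.Adj y z) (h4 : G.Adj z (g e.2)) :
    GoodOn G Set.univ ∨ BadOn G Set.univ := by
  obtain ⟨hn, hlt⟩ := cores_lt hB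
  have E' : Emb G Set.univ (B.1 + 3) (B.2.filter (· != e) ++
      [(e.1, B.1), (B.1, B.1 + 1), (B.1 + 1, B.1 + 2), (B.1 + 2, e.2)])
      (extendEnum g B.1 [x, y, z]) := by
    refine E.extend hnd (fun v hv => (hW v).2 hv) (fun v => ?_) fun e' he' => ?_
    · rw [← hW]; exact ⟨fun _ => em _, fun _ => trivial⟩
    · rcases List.mem_append.1 he' with he' | he'
      · obtain ⟨h5, h6⟩ := List.mem_filter.1 he'
        have h6 : e' ≠ e := by simpa using h6
        rw [extendEnum_lt (hlt _ h5).1, extendEnum_lt (hlt _ h5).2]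
        refine hH _ _ (E.adj _ h5) ?_
        rintro (⟨p, q⟩ | ⟨p, q⟩)
        · exact h6 (Prod.ext (E.inj _ (hlt _ h5).1 _ (hlt _ he).1 p)
            (E.inj _ (hlt _ h5).2 _ (hlt _ he).2 q))
        · refine cores_asymm B hB e he ?_
          rw [← E.inj _ (hlt _ h5).1 _ (hlt _ he).2 p, ← E.inj _ (hlt _ h5).2 _ (hlt _ he).1 q]
          exact h5
      · simp only [List.mem_cons, List.not_mem_nil, or_false] at he'
        rcases he' with rfl | rfl | rfl | rfl <;>
          simp [extendEnum_add, extendEnum_self, extendEnum_lt (hlt _ he).1,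
            extendEnum_lt (hlt _ he).2, h1, h2, h3, h4]
  rcases List.mem_cons.1 hB with rfl | hB
  · right
    obtain ⟨s1, s2, s3, s4⟩ := subdividedC4_spec e he
    exact ⟨coreC7, by simp [cores], _, E'.reindex (subdividedC4 e.1) s1 s2 s3 s4⟩
  · exact Or.inl (E'.goodOn (by omega) (core_subdivide B hB e he))

/-- Extension of a law by a function of the random set. -/
theorem GoodOn.extend {G H : SimpleGraph V} {W : Set V} (h : GoodOn H W) (F : Set V → Set V)
    (hF : ∀ D ⊆ W, (∀ v ∈ W, DomBy H D v) → ∀ v, DomBy G (F D) v)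
    (hpr : ∀ v, ∃ u ∈ W, ∀ D ⊆ W, (∀ v ∈ W, DomBy H D v) → v ∈ F D → u ∈ D) :
    GoodOn G Set.univ := by
  obtain ⟨X, h1, h2, h3⟩ := h
  refine ⟨X.withSet fun ω => F (X.D ω), fun _ => Set.subset_univ _,
    fun ω h0 v _ => hF _ (h1 ω) (h2 ω h0) v, fun v _ => ?_⟩
  obtain ⟨u, hu, h⟩ := hpr v
  exact (X.ex_mono fun ω h0 => ind_mono (h _ (h1 ω) (h2 ω h0))).trans (h3 u hu)

namespace MinCounterexample

variable {G : SimpleGraph V}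

theorem mem_of_closed (hG : MinCounterexample G) {A : Set V} {a : V} (ha : a ∈ A)
    (h : ∀ x ∈ A, ∀ y, G.Adj x y → y ∈ A) (v : V) : v ∈ A := by
  by_contra hv
  obtain ⟨x, hx, y, hy, hxy⟩ := hG.conn' ha hv
  exact hy (h x hx y hxy)

theorem mem_of_gate [Finite V] (hG : MinCounterexample G) {A : Set V} {a c : V} (ha : a ∈ A)
    (hc : c ∉ A) (h : ∀ x ∈ A, ∀ y, G.Adj x y → y ∈ A ∨ y = c) (v : V) : v ∈ A ∨ v = c := by
  by_contra! hv
  obtain ⟨x, hx, y, hy, hyc, hxy⟩ := hG.exists_crossing_avoiding hc ha hv.1 hv.2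
  exact (h x hx y hxy).elim hy hyc

theorem no_four_path [Finite V] (hG : MinCounterexample G) {x₁ x₂ x₃ x₄ u v : V}
    (hnd : [x₁, x₂, x₃, x₄].Nodup) (h1 : Two G x₁ u x₂) (h2 : Two G x₂ x₁ x₃)
    (h3 : Two G x₃ x₂ x₄) (h4 : Two G x₄ x₃ v) : False := by
  simp only [List.nodup_cons, List.mem_cons, List.not_mem_nil, or_false, not_or,
    not_false_eq_true, List.nodup_nil, and_true] at hnd
  obtain ⟨⟨h12, h13, h14⟩, ⟨h23, h24⟩, h34⟩ := hnd
  have l1 := h1.left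
  have r1 := h1.right
  have l2 := h2.left
  have r2 := h2.right
  have l3 := h3.left
  have r3 := h3.right
  have l4 := h4.left
  have r4 := h4.right
  obtain ⟨hu2, n1⟩ := h1
  obtain ⟨-, n2⟩ := h2
  obtain ⟨-, n3⟩ := h3
  obtain ⟨hv3, n4⟩ := h4
  have hsy : ∀ a b, G.Adj a b → G.Adj b a := fun _ _ h => h.symm
  have hirr : ∀ a, ¬G.Adj a a := fun a => G.loopless.irrefl a
  by_cases hu4 : u = x₄
  · subst hu4
    have hv : v = x₁ := by grind
    subst hv
    have hall := hG.mem_of_closed (A := {v, x₂, x₃, u}) (a := v) (by simp) (by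
      rintro x (rfl | rfl | rfl | rfl) y h <;> simp only [Set.mem_insert_iff,
        Set.mem_singleton_iff] <;> grind)
    exact hG.not_bad ⟨coreC4, by simp [cores], _, Emb.of_list (xs := [v, x₂, x₃, u]) v
      (by simp; grind) (by simpa using hall) (by simp [coreC4]; grind)⟩
  have hux : u ≠ x₃ := by grind
  have hux1 : u ≠ x₁ := by grind
  have hvx1 : v ≠ x₁ := by grind
  have hvx2 : v ≠ x₂ := by grind
  have hvx4 : v ≠ x₄ := by grind
  by_cases huv : u = v
  · subst huv
    have hall := hG.mem_of_gate (A := {x₁, x₂, x₃, x₄}) (a := x₁) (c := u) (by simp) (by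
      simp; grind) (by
      rintro x (rfl | rfl | rfl | rfl) y h <;> simp only [Set.mem_insert_iff,
        Set.mem_singleton_iff] <;> grind)
    refine hG.not_good ((Emb.of_list (xs := [u, x₁, x₂, x₃, x₄])
      (es := [(0, 1), (1, 2), (2, 3), (3, 4), (4, 0)]) u
      (by simp; grind) (fun v => ?_) (by simp; grind)).goodOn (by simp)
      (show labelable 5 _ 0 0 = true by decide +kernel))
    have := hall v
    simp only [Set.mem_insert_iff, Set.mem_singleton_iff] at this
    simp; tauto
  let H : SimpleGraph V := G ⊔ SimpleGraph.edge x₁ v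
  have hH : ∀ a b, H.Adj a b ↔ G.Adj a b ∨ (a = x₁ ∧ b = v ∨ a = v ∧ b = x₁) := fun a b => by
    simp only [H, SimpleGraph.sup_adj, SimpleGraph.edge_adj]
    grind
  let W : Set V := {w | w ≠ x₂ ∧ w ≠ x₃ ∧ w ≠ x₄}
  have hWd : ∀ w, w ∈ W ↔ w ≠ x₂ ∧ w ≠ x₃ ∧ w ≠ x₄ := fun w => Iff.rfl
  have hWu : W ≠ Set.univ := fun e => ((hWd x₂).1 (e ▸ trivial)).1 rfl
  have hconn : CutConn H W := by
    rintro A hA ⟨a, ha⟩ ⟨b, hbW, hb⟩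
    by_cases e1 : x₁ ∈ A
    · by_cases e2 : v ∈ A
      · obtain ⟨p, hp, q, hq, hpq⟩ := hG.conn' (A := {w | w ∈ A ∨ w = x₂ ∨ w = x₃ ∨ w = x₄})
          (x := a) (y := b) (Or.inl ha) (fun h => h.elim hb (by grind))
        simp only [Set.mem_ofPred_eq, not_or] at hp hq
        exact ⟨p, by grind, q, ⟨hq.2, hq.1⟩, (hH _ _).2 (Or.inl hpq)⟩
      · exact ⟨x₁, e1, v, ⟨⟨hvx2, hv3.symm, hvx4⟩, e2⟩, (hH _ _).2 (by grind)⟩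
    · by_cases e2 : v ∈ A
      · exact ⟨v, e2, x₁, ⟨⟨h12, h13, h14⟩, e1⟩, (hH _ _).2 (by grind)⟩
      · obtain ⟨p, hp, q, hq, hpq⟩ := hG.conn' ha hb
        have := hA hp
        exact ⟨p, hp, q, ⟨by grind, hq⟩, (hH _ _).2 (Or.inl hpq)⟩
  have hdeg : MinDegTwo H W := by
    intro w hw
    by_cases e1 : w = x₁
    · subst e1
      exact ⟨u, by grind, v, by grind, huv, (hH _ _).2 (by grind), (hH _ _).2 (by grind)⟩
    obtain ⟨p, -, q, -, hpq, hp, hq⟩ := hG.deg w trivial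
    by_cases e2 : w = v
    · subst e2
      by_cases e3 : p = x₄
      · exact ⟨q, by grind, x₁, by grind, by grind, (hH _ _).2 (by grind), (hH _ _).2 (by grind)⟩
      · exact ⟨p, by grind, x₁, by grind, by grind, (hH _ _).2 (by grind), (hH _ _).2 (by grind)⟩
    · exact ⟨p, by grind, q, by grind, by grind, (hH _ _).2 (by grind), (hH _ _).2 (by grind)⟩
  rcases hG.small W hWu H hconn hdeg ⟨x₁, h12, h13, h14⟩ with h | ⟨B, hB, g, E⟩
  · refine hG.not_good (h.extend (fun D => {w | w ∈ D ∨ w = x₂ ∧ v ∈ D ∨ w = x₄ ∧ x₁ ∈ D ∨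
      w = x₃ ∧ x₁ ∉ D ∧ v ∉ D}) (fun D hD hdom w => ?_) fun w => ?_)
    · have hx1 := hdom x₁ (by grind)
      have hv := hdom v (by grind)
      by_cases e2 : w = x₂
      · subst e2
        by_cases k1 : x₁ ∈ D
        · exact Or.inr ⟨x₁, by simp [k1], by grind⟩
        by_cases k2 : v ∈ D
        · exact Or.inl (by simp [k2])
        · exact Or.inr ⟨x₃, by simp [k1, k2], by grind⟩
      by_cases e3 : w = x₃
      · subst e3
        by_cases k2 : v ∈ D
        · exact Or.inr ⟨x₂, by simp [k2], by grind⟩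
        by_cases k1 : x₁ ∈ D
        · exact Or.inr ⟨x₄, by simp [k1], by grind⟩
        · exact Or.inl (by simp [k1, k2])
      by_cases e4 : w = x₄
      · subst e4
        by_cases k1 : x₁ ∈ D
        · exact Or.inl (by simp [k1])
        by_cases k2 : v ∈ D
        · exact Or.inr ⟨v, by simp [k2], by grind⟩
        · exact Or.inr ⟨x₃, by simp [k1, k2], by grind⟩
      rcases hdom w ⟨e2, e3, e4⟩ with k | ⟨p, hp, k⟩
      · exact Or.inl (Or.inl k)
      rcases (hH _ _).1 k with k | ⟨rfl, rfl⟩ | ⟨rfl, rfl⟩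
      · exact Or.inr ⟨p, Or.inl hp, k⟩
      · exact Or.inr ⟨x₄, by simp [hp], by grind⟩
      · exact Or.inr ⟨x₂, by simp [hp], by grind⟩
    · by_cases e2 : w = x₂
      · refine ⟨v, by grind, fun D hD _ hw => ?_⟩
        have := hD (a := w)
        simp only [Set.mem_ofPred_eq] at hw
        grind
      by_cases e4 : w = x₄
      · refine ⟨x₁, by grind, fun D hD _ hw => ?_⟩
        have := hD (a := w)
        simp only [Set.mem_ofPred_eq] at hw
        grind
      by_cases e3 : w = x₃
      · refine ⟨u, by grind, fun D hD hdom hw => ?_⟩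
        have := hD (a := w)
        simp only [Set.mem_ofPred_eq] at hw
        rcases hdom x₁ (by grind) with k | ⟨p, hp, k⟩
        · grind
        · have := hD hp
          have := (hH _ _).1 k
          grind
      · refine ⟨w, by grind, fun D hD _ hw => ?_⟩
        simp only [Set.mem_ofPred_eq] at hw
        grind
  · obtain ⟨i, hi, hgi⟩ := E.surj x₁ ⟨h12, h13, h14⟩
    obtain ⟨j, hj, k, hk, hjk, a1, a2⟩ := cores_two_adj B hB i (List.mem_range.2 hi)
    rw [List.mem_range] at hj hk
    have key : ∃ j < B.1, g j = v ∧ listAdj B.2 i j = true := by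
      have b1 := E.adj_of_listAdj a1
      have b2 := E.adj_of_listAdj a2
      have c1 := E.mem j hj
      have c2 := E.mem k hk
      have c3 : g j ≠ g k := fun e => hjk (E.inj j hj k hk e)
      rw [hgi, hH] at b1 b2
      by_cases e : g j = v
      · exact ⟨j, hj, e, a1⟩
      · exact ⟨k, hk, by grind, a2⟩
    obtain ⟨j, hj, hgj, a⟩ := key
    have hWn : ∀ w, w ∉ W ↔ w = x₂ ∨ w = x₃ ∨ w = x₄ := fun w => by rw [hWd]; tauto
    refine (?_ : GoodOn G Set.univ ∨ BadOn G Set.univ).elim hG.not_good hG.not_bad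
    rcases listAdj_iff.1 a with h | h
    · refine E.subdivide hB h (x := x₂) (y := x₃) (z := x₄) (by simp; grind)
        (fun w => by rw [hWn]; simp) (fun a b hab hne => ?_) ?_ ?_ ?_ ?_
      · exact ((hH a b).1 hab).resolve_right (by simpa [hgi, hgj] using hne)
      all_goals grind
    · refine E.subdivide hB h (x := x₄) (y := x₃) (z := x₂) (by simp; grind)
        (fun w => by rw [hWn]; simp; tauto) (fun a b hab hne => ?_) ?_ ?_ ?_ ?_
      · exact ((hH a b).1 hab).resolve_right (by simp only [hgi, hgj] at hne; tauto)
      all_goals grind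

end MinCounterexample

theorem RandSet.ex_lin (X : RandSet V) (a b c d : ℝ) (f g h : X.Ω → ℝ) :
    X.ex (fun ω => a + b * f ω + c * g ω + d * h ω) =
      a + b * X.ex f + c * X.ex g + d * X.ex h := by
  simp only [X.ex_add, X.ex_mul, X.ex_const]

/-- The vertices of the graph `K₂,₃` obtained from `coreC4` by a twin with neighbours `i`, `j`. -/
def twinnedC4 (i j k : ℕ) : ℕ := [i, j, (i + 1) % 4, (j + 1) % 4, 4].getD k 0

theorem twinnedC4_spec : ∀ e ∈ nonEdges coreC4, (∀ i < 5, twinnedC4 e.1 e.2 i < 5) ∧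
    (∀ i < 5, ∀ j < 5, twinnedC4 e.1 e.2 i = twinnedC4 e.1 e.2 j → i = j) ∧
    (∀ i < 5, ∃ j < 5, twinnedC4 e.1 e.2 j = i) ∧
    ∀ e' ∈ coreK23.2, listAdj (coreC4.2 ++ [(e.1, 4), (4, e.2)])
      (twinnedC4 e.1 e.2 e'.1) (twinnedC4 e.1 e.2 e'.2) = true := by
  decide +kernel

theorem nonEdges_lt {B : ℕ × List (ℕ × ℕ)} {e : ℕ × ℕ} (he : e ∈ nonEdges B) :
    e.1 < B.1 ∧ e.2 < B.1 := by
  simp only [nonEdges, List.mem_flatMap, List.mem_range] at he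
  obtain ⟨j, hj, i, hi, he⟩ := he
  cases h : listAdj B.2 i j <;> simp [h] at he
  subst he
  exact ⟨by omega, hj⟩

theorem Emb.exists_nonEdge {G : SimpleGraph V} {W : Set V} {B : ℕ × List (ℕ × ℕ)} {g : ℕ → V}
    (E : Emb G W B.1 B.2 g) {u v : V} (hu : u ∈ W) (hv : v ∈ W) (huv : u ≠ v)
    (h : ¬G.Adj u v) :
    ∃ e ∈ nonEdges B, g e.1 = u ∧ g e.2 = v ∨ g e.1 = v ∧ g e.2 = u := by
  obtain ⟨i, hi, rfl⟩ := E.surj u hu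
  obtain ⟨j, hj, rfl⟩ := E.surj v hv
  rcases lt_trichotomy i j with hij | rfl | hij
  · exact ⟨_, mem_nonEdges hij hj fun h' => h (E.adj_of_listAdj h'), Or.inl ⟨rfl, rfl⟩⟩
  · exact (huv rfl).elim
  · exact ⟨_, mem_nonEdges hij hi fun h' => h (E.adj_of_listAdj h').symm, Or.inr ⟨rfl, rfl⟩⟩

theorem Emb.addThree {G : SimpleGraph V} {W : Set V} {B : ℕ × List (ℕ × ℕ)} (hB : B ∈ cores)
    {g : ℕ → V} (E : Emb G W B.1 B.2 g) {e : ℕ × ℕ} (he : e ∈ nonEdges B) {x y z : V}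
    (hnd : [x, y, z].Nodup) (hW : ∀ v, v ∉ W ↔ v ∈ [x, y, z])
    (h1 : G.Adj (g e.1) x) (h2 : G.Adj x y) (h3 : G.Adj y z) (h4 : G.Adj z (g e.2)) :
    GoodOn G Set.univ := by
  obtain ⟨hn, hlt⟩ := cores_lt hB
  have he' := nonEdges_lt he
  refine Emb.goodOn (E.extend (es' := _) hnd (fun v hv => (hW v).2 hv) (fun v => ?_)
    fun e' he' => ?_) (by simp) (core_addThree B hB e he)
  · rw [← hW]; exact ⟨fun _ => em _, fun _ => trivial⟩
  · rcases List.mem_append.1 he' with h5 | h5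
    · rw [extendEnum_lt (hlt _ h5).1, extendEnum_lt (hlt _ h5).2]
      exact E.adj _ h5
    · simp only [List.mem_cons, List.not_mem_nil, or_false] at h5
      rcases h5 with rfl | rfl | rfl | rfl <;>
        simp [extendEnum_add, extendEnum_self, extendEnum_lt, *]

theorem Emb.addOne {G : SimpleGraph V} {W : Set V} {B : ℕ × List (ℕ × ℕ)} (hB : B ∈ cores)
    {g : ℕ → V} (E : Emb G W B.1 B.2 g) {e : ℕ × ℕ} (he : e ∈ nonEdges B) {x : V}
    (hW : ∀ v, v ∉ W ↔ v = x) (h1 : G.Adj (g e.1) x) (h2 : G.Adj x (g e.2)) :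
    GoodOn G Set.univ ∨ BadOn G Set.univ := by
  obtain ⟨hn, hlt⟩ := cores_lt hB
  have he' := nonEdges_lt he
  have E' : Emb G Set.univ (B.1 + 1) (B.2 ++ [(e.1, B.1), (B.1, e.2)])
      (extendEnum g B.1 [x]) := by
    refine E.extend (List.nodup_singleton x) (fun v hv => (hW v).2 (List.mem_singleton.1 hv))
      (fun v => ?_) fun e' he' => ?_
    · rw [List.mem_singleton, ← hW]; exact ⟨fun _ => em _, fun _ => trivial⟩
    · rcases List.mem_append.1 he' with h5 | h5
      · rw [extendEnum_lt (hlt _ h5).1, extendEnum_lt (hlt _ h5).2]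
        exact E.adj _ h5
      · simp only [List.mem_cons, List.not_mem_nil, or_false] at h5
        rcases h5 with rfl | rfl <;>
          simp [extendEnum_self, extendEnum_lt, *]
  rcases List.mem_cons.1 hB with rfl | hB
  · obtain ⟨s1, s2, s3, s4⟩ := twinnedC4_spec e he
    exact Or.inr ⟨coreK23, by simp [cores], _, E'.reindex (twinnedC4 e.1 e.2) s1 s2 s3 s4⟩
  · exact Or.inl (E'.goodOn (by omega) (core_addOne B hB e he))

/-- The extension of an exact law to a path of three new vertices. -/
theorem GoodOn.addThree [Finite V] {G : SimpleGraph V} {x y z u v : V} (hxy : x ≠ y)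
    (hxz : x ≠ z) (hyz : y ≠ z) (hu : u ∉ [x, y, z]) (hv : v ∉ [x, y, z])
    (h1 : G.Adj u x) (h2 : G.Adj x y) (h3 : G.Adj y z) (h4 : G.Adj z v)
    (h : GoodOn G {w | w ∉ [x, y, z]}) : GoodOn G Set.univ := by
  obtain ⟨X, x1, x2, x3⟩ := h.exact
  have hxD : ∀ ω, x ∉ X.D ω := fun ω h => x1 ω h (by simp)
  have hyD : ∀ ω, y ∉ X.D ω := fun ω h => x1 ω h (by simp)
  have hzD : ∀ ω, z ∉ X.D ω := fun ω h => x1 ω h (by simp)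
  have hpu : X.ex (fun ω => ind (u ∈ X.D ω)) = 2 / 5 := x3 u hu
  have hpv : X.ex (fun ω => ind (v ∈ X.D ω)) = 2 / 5 := x3 v hv
  set r := X.ex fun ω => ind (u ∈ X.D ω ∧ v ∈ X.D ω) with hr
  have hr0 : 0 ≤ r := X.ex_nonneg fun _ => ind_nonneg _
  have hr1 : r ≤ 2 / 5 := hpu ▸ X.ex_mono fun ω _ => ind_mono And.left
  obtain ⟨s, hs0, hs1, hs⟩ : ∃ s : ℝ, 0 ≤ s ∧ s ≤ 1 ∧ s * (1 / 5 + r) = 1 / 5 + r / 2 :=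
    ⟨(1 / 5 + r / 2) / (1 / 5 + r), by positivity,
      (div_le_one (by positivity)).2 (by linarith), div_mul_cancel₀ _ (by positivity)⟩
  let t : X.Ω → ℝ := fun ω => if u ∈ X.D ω ∧ v ∈ X.D ω then 1 / 2 else s
  have ht : ∀ ω, 0 ≤ t ω ∧ t ω ≤ 1 := fun ω => by
    simp only [t]; split_ifs
    · norm_num
    · exact ⟨hs0, hs1⟩
  let F : X.Ω → Bool → Set V := fun ω b => {w | w ∈ X.D ω ∨
    w = x ∧ (v ∈ X.D ω ∧ (u ∉ X.D ω ∨ b = true) ∨ u ∉ X.D ω ∧ v ∉ X.D ω ∧ b = false) ∨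
    w = z ∧ (u ∈ X.D ω ∧ (v ∉ X.D ω ∨ b = false) ∨ u ∉ X.D ω ∧ v ∉ X.D ω ∧ b = false) ∨
    w = y ∧ u ∉ X.D ω ∧ v ∉ X.D ω ∧ b = true}
  refine X.goodOn_bind (fun ω b => if b then t ω else 1 - t ω)
    (fun ω b => by have := ht ω; cases b <;> simp <;> linarith) (fun ω => by simp)
    F (fun _ _ => Set.subset_univ _) ?_ ?_
  · intro ω b h0 _ w _
    by_cases hw : w ∈ [x, y, z]
    · simp only [DomBy, F, Set.mem_ofPred_eq]
      have s1 := h2.symm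
      have s2 := h3.symm
      have s3 := h4.symm
      simp only [List.mem_cons, List.not_mem_nil, or_false] at hw
      by_cases k1 : u ∈ X.D ω <;> by_cases k2 : v ∈ X.D ω <;> cases b <;>
        rcases hw with rfl | rfl | rfl <;> simp only [k1, k2] <;> grind
    · exact (x2 ω h0 w hw).mono (fun _ h => Or.inl h) fun _ _ h => h
  · intro w _
    have key : ∀ w (a b c d : ℝ), (∀ ω, t ω * ind (w ∈ F ω true) + (1 - t ω) * ind (w ∈ F ω false) =
        a + b * ind (u ∈ X.D ω) + c * ind (v ∈ X.D ω) + d * ind (u ∈ X.D ω ∧ v ∈ X.D ω)) →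
        a + b * (2 / 5) + c * (2 / 5) + d * r ≤ 2 / 5 → X.ex (fun ω => ∑ b,
        (if b = true then t ω else 1 - t ω) * ind (w ∈ F ω b)) ≤ 2 / 5 := by
      intro w a b c d h1 h2
      simp only [Fintype.sum_bool, if_true, Bool.false_eq_true, if_false]
      rw [X.ex_congr fun ω _ => h1 ω, X.ex_lin, hpu, hpv]
      exact h2
    by_cases e1 : w = x
    · subst e1
      refine key w (1 - s) (-(1 - s)) (1 - (1 - s)) (1 - s - 1 / 2) (fun ω => ?_) (by nlinarith)
      by_cases k1 : u ∈ X.D ω <;> by_cases k2 : v ∈ X.D ω <;>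
        simp [ind, F, k1, k2, t, hxD, hxy, hxz] <;> ring
    by_cases e2 : w = z
    · subst e2
      refine key w (1 - s) (1 - (1 - s)) (-(1 - s)) (1 - s - 1 / 2) (fun ω => ?_) (by nlinarith)
      by_cases k1 : u ∈ X.D ω <;> by_cases k2 : v ∈ X.D ω <;>
        simp [ind, F, k1, k2, t, hzD, e1, hyz.symm] <;> ring
    by_cases e3 : w = y
    · subst e3
      refine key w s (-s) (-s) s (fun ω => ?_) (by nlinarith)
      by_cases k1 : u ∈ X.D ω <;> by_cases k2 : v ∈ X.D ω <;>
        simp [ind, F, k1, k2, t, hyD, e1, e2]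
    · refine le_of_eq_of_le (X.ex_congr fun ω _ => ?_) (x3 w (by simp [e1, e2, e3])).le
      unfold ind
      simp [F, e1, e2, e3]

namespace MinCounterexample

variable {G : SimpleGraph V}

theorem no_three_path [Finite V] (hG : MinCounterexample G) {x y z u v : V}
    (h1 : Two G x u y) (h2 : Two G y x z) (h3 : Two G z y v) : False := by
  have l1 := h1.left
  have r1 := h1.right
  have l2 := h2.left
  have r2 := h2.right
  have l3 := h3.left
  have r3 := h3.right
  have n1 := h1.2
  have n2 := h2.2
  have n3 := h3.2
  have hxz := h2.1
  have hxy : x ≠ y := r1.ne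
  have hyz : y ≠ z := r2.ne
  have huy := h1.1
  have hyv := h3.1
  have hsy : ∀ a b, G.Adj a b → G.Adj b a := fun _ _ h => h.symm
  have hirr : ∀ a, ¬G.Adj a a := fun a => G.loopless.irrefl a
  have hnd : [x, y, z].Nodup := by simp; grind
  have hux : u ≠ x := l1.ne'
  have hvz : v ≠ z := r3.ne'
  by_cases huz : u = z
  · have hall := hG.mem_of_closed (A := {x, y, z}) (a := x) (by simp) (by
      rintro p (rfl | rfl | rfl) q h <;> simp only [Set.mem_insert_iff,
        Set.mem_singleton_iff] <;> grind)
    exact hG.not_good ((Emb.of_list (es := [(0, 1), (1, 2), (2, 0)]) x hnd (by simpa using hall)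
      (by simp; grind)).goodOn (by simp) (show labelable 3 _ 0 0 = true by decide +kernel))
  have hvx : v ≠ x := by grind
  by_cases huv : u = v
  · subst huv
    have hall := hG.mem_of_gate (A := {x, y, z}) (a := x) (c := u) (by simp) (by
      simp; grind) (by
      rintro p (rfl | rfl | rfl) q h <;> simp only [Set.mem_insert_iff,
        Set.mem_singleton_iff] <;> grind)
    refine hG.not_bad ⟨coreC4, by simp [cores], _, Emb.of_list (xs := [u, x, y, z]) u
      (by simp; grind) (fun v => ?_) (by simp [coreC4]; grind)⟩
    have := hall v
    simp only [Set.mem_insert_iff, Set.mem_singleton_iff] at this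
    simp; tauto
  have hu : Hub G u := by
    by_contra hu
    obtain ⟨a, b, h⟩ := hG.two_of_not_hub hu
    obtain ⟨p, h⟩ := h.exists_other l1.symm
    exact hG.no_four_path (by simp; grind) h.symm h1 h2 h3
  have hv : Hub G v := by
    by_contra hv
    obtain ⟨a, b, h⟩ := hG.two_of_not_hub hv
    obtain ⟨p, h⟩ := h.exists_other r3.symm
    exact hG.no_four_path (by simp; grind) h.symm h3.symm h2.symm h1.symm
  have huv' := hG.not_adj_hubs hu hv
  have hW : ∀ w, w ∈ {w | w ∉ [x, y, z]} ↔ w ≠ x ∧ w ≠ y ∧ w ≠ z := fun w => by simp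
  have hcon : CutConn G {w | w ∉ [x, y, z]} := by
    rintro A hA ⟨a, ha⟩ ⟨b, hbW, hb⟩
    have hA' : ∀ p ∈ A, p ≠ x ∧ p ≠ y ∧ p ≠ z := fun p hp => (hW p).1 (hA hp)
    by_cases e1 : u ∈ A <;> by_cases e2 : v ∈ A
    · obtain ⟨p, hp, q, hq, hpq⟩ := hG.conn' (A := {w | w ∈ A ∨ w = x ∨ w = y ∨ w = z})
        (x := a) (y := b) (Or.inl ha) (fun h => h.elim hb (by have := (hW b).1 hbW; grind))
      simp only [Set.mem_ofPred_eq, not_or] at hp hq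
      exact ⟨p, by grind, q, ⟨(hW q).2 hq.2, hq.1⟩, hpq⟩
    · obtain ⟨p, hp, q, hq, hpq, hne⟩ := hG.exists_other_crossing e1
        (fun h => (hA' _ h).1 rfl) l1.symm
      exact ⟨p, hp, q, ⟨(hW q).2 (by have := hA' p hp; grind), hq⟩, hpq⟩
    · obtain ⟨p, hp, q, hq, hpq, hne⟩ := hG.exists_other_crossing e2
        (fun h => (hA' _ h).2.2 rfl) r3.symm
      exact ⟨p, hp, q, ⟨(hW q).2 (by have := hA' p hp; grind), hq⟩, hpq⟩
    · obtain ⟨p, hp, q, hq, hpq⟩ := hG.conn' ha hb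
      exact ⟨p, hp, q, ⟨(hW q).2 (by have := hA' p hp; grind), hq⟩, hpq⟩
  have hdeg : MinDegTwo G {w | w ∉ [x, y, z]} := by
    intro w hw
    rw [hW] at hw
    simp only [hW]
    by_cases e1 : w = u
    · obtain ⟨a, b, hab, ha, hb, k1, k2⟩ := hu.exists_two x
      exact ⟨a, by grind, b, by grind, hab, e1 ▸ k1, e1 ▸ k2⟩
    by_cases e2 : w = v
    · obtain ⟨a, b, hab, ha, hb, k1, k2⟩ := hv.exists_two z
      exact ⟨a, by grind, b, by grind, hab, e2 ▸ k1, e2 ▸ k2⟩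
    · obtain ⟨a, -, b, -, hab, k1, k2⟩ := hG.deg w trivial
      exact ⟨a, by grind, b, by grind, hab, k1, k2⟩
  have huW : u ∈ {w | w ∉ [x, y, z]} := (hW u).2 ⟨hux, huy, huz⟩
  have hvW : v ∈ {w | w ∉ [x, y, z]} := (hW v).2 ⟨hvx, hyv.symm, hvz⟩
  rcases hG.small _ (fun e => ((hW x).1 ((Set.ext_iff.1 e x).2 trivial)).1 rfl) G hcon hdeg
    ⟨u, huW⟩ with h | ⟨B, hB, g, E⟩
  · exact hG.not_good (h.addThree hxy hxz hyz huW hvW l1.symm r1 r2 r3)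
  · obtain ⟨e, he, ⟨rfl, rfl⟩ | ⟨rfl, rfl⟩⟩ := E.exists_nonEdge huW hvW huv huv'
    · exact hG.not_good (E.addThree hB he hnd (fun w => not_not) l1.symm r1 r2 r3)
    · exact hG.not_good (E.addThree hB he (x := z) (y := y) (z := x) (by simp; grind)
        (fun w => not_not.trans (by simp; tauto)) r3.symm l3 l2 l1)

theorem twin_hub [Finite V] (hG : MinCounterexample G) {x x' u v : V}
    (h : Two G x u v) (h' : Two G x' u v) (hx : x ≠ x') : Hub G u := by
  by_contra hu
  obtain ⟨a, b, k⟩ := hG.two_of_not_hub hu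
  have l1 := h.left
  have r1 := h.right
  have l2 := h'.left
  have r2 := h'.right
  have n1 := h.2
  have n2 := h'.2
  have n3 := k.2
  have huv := h.1
  have hsy : ∀ a b, G.Adj a b → G.Adj b a := fun _ _ h => h.symm
  have hirr : ∀ a, ¬G.Adj a a := fun a => G.loopless.irrefl a
  have hxa := (n3 x).1 l1.symm
  have hxb := (n3 x').1 l2.symm
  have hvu : v ≠ x := r1.ne'
  have hvu' : v ≠ x' := r2.ne'
  have hall := hG.mem_of_gate (A := {x, x', u}) (a := x) (c := v) (by simp) (by
    simp; grind) (by
    rintro p (rfl | rfl | rfl) q h <;> simp only [Set.mem_insert_iff,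
      Set.mem_singleton_iff] <;> grind)
  refine hG.not_bad ⟨coreC4, by simp [cores], _, Emb.of_list (xs := [x, u, x', v]) u
    (by simp; grind) (fun v => ?_) (by simp [coreC4]; grind)⟩
  have := hall v
  simp only [Set.mem_insert_iff, Set.mem_singleton_iff] at this
  simp; tauto

/-- There are no twins of degree two. -/
theorem twin_free [Finite V] (hG : MinCounterexample G) {x x' u v : V}
    (h : Two G x u v) (h' : Two G x' u v) : x = x' := by
  by_contra hx
  have hu := hG.twin_hub h h' hx
  have hv := hG.twin_hub h.symm h'.symm hx
  have hux : u ≠ x' := h'.left.ne'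
  have hvx : v ≠ x' := h'.right.ne'
  have hcon : CutConn G {w | w ≠ x'} := by
    rintro A hA ⟨a, ha⟩ ⟨b, hbW, hb⟩
    obtain ⟨p, hp, q, hq, hqx, hpq⟩ :=
      hG.exists_crossing_avoiding (fun h => hA h rfl : x' ∉ A) ha hb hbW
    exact ⟨p, hp, q, ⟨hqx, hq⟩, hpq⟩
  have hdeg : MinDegTwo G {w | w ≠ x'} := by
    intro w hw
    by_cases e1 : w = u
    · obtain ⟨a, b, hab, ha, hb, k1, k2⟩ := hu.exists_two x'
      exact ⟨a, ha, b, hb, hab, e1 ▸ k1, e1 ▸ k2⟩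
    by_cases e2 : w = v
    · obtain ⟨a, b, hab, ha, hb, k1, k2⟩ := hv.exists_two x'
      exact ⟨a, ha, b, hb, hab, e2 ▸ k1, e2 ▸ k2⟩
    · obtain ⟨a, -, b, -, hab, k1, k2⟩ := hG.deg w trivial
      have : ∀ a, G.Adj w a → a ≠ x' := fun a ha e => by
        subst e
        exact ((h'.2 w).1 ha.symm).elim e1 e2
      exact ⟨a, this a k1, b, this b k2, hab, k1, k2⟩
  rcases hG.small {w | w ≠ x'} (fun e => (Set.ext_iff.1 e x').2 trivial rfl) G hcon hdeg
    ⟨x, hx⟩ with k | ⟨B, hB, g, E⟩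
  · refine hG.not_good (k.extend (fun D => {w | w ∈ D ∨ w = x' ∧ u ∉ D ∧ v ∉ D})
      (fun D hD hdom w => ?_) fun w => ?_)
    · by_cases e : w = x'
      · by_cases k1 : u ∈ D
        · exact Or.inr ⟨u, Or.inl k1, e ▸ h'.left.symm⟩
        by_cases k2 : v ∈ D
        · exact Or.inr ⟨v, Or.inl k2, e ▸ h'.right.symm⟩
        · exact Or.inl (Or.inr ⟨e, k1, k2⟩)
      · exact (hdom w e).mono (fun _ h => Or.inl h) fun _ _ h => h
    · by_cases e : w = x'
      · refine ⟨x, hx, fun D hD hdom hw => ?_⟩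
        rcases hw with hw | ⟨-, k1, k2⟩
        · exact (hD hw e).elim
        · rcases hdom x hx with k | ⟨p, hp, k⟩
          · exact k
          · rcases (h.2 p).1 k.symm with rfl | rfl
            · exact (k1 hp).elim
            · exact (k2 hp).elim
      · exact ⟨w, e, fun D hD _ hw => hw.resolve_right fun h => e h.1⟩
  · obtain ⟨e, he, ⟨rfl, rfl⟩ | ⟨rfl, rfl⟩⟩ :=
      E.exists_nonEdge (u := u) (v := v) hux hvx h.1 (hG.not_adj_hubs hu hv)
    · exact (E.addOne hB he (x := x') (fun w => not_not) h'.left.symm h'.right).elim hG.not_good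
        hG.not_bad
    · exact (E.addOne hB he (x := x') (fun w => not_not) h'.right.symm h'.left).elim hG.not_good
        hG.not_bad

end MinCounterexample

theorem Emb.farFromHubs {G : SimpleGraph V} {W : Set V} {B : ℕ × List (ℕ × ℕ)} {g : ℕ → V}
    (E : Emb G W B.1 B.2 g) {i : ℕ} (h : ∀ v, Hub G v → ¬G.Adj (g i) v) :
    farFromHubs B i = true := by
  simp only [_root_.farFromHubs, List.all_eq_true, List.mem_range, Bool.or_eq_true,
    Bool.not_eq_true', Nat.ble_eq]
  intro j hj
  by_contra! hc
  obtain ⟨h1, h2⟩ := hc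
  refine h (g j) ?_ (E.adj_of_listAdj (by simpa using h1))
  set L := (List.range B.1).filter fun k => listAdj B.2 j k with hL
  have hnd : L.Nodup := List.nodup_range.filter _
  have hmem : ∀ k ∈ L, k < B.1 ∧ G.Adj (g j) (g k) := fun k hk => by
    rw [hL, List.mem_filter, List.mem_range] at hk
    exact ⟨hk.1, E.adj_of_listAdj hk.2⟩
  match L, hnd, hmem, h2 with
  | a :: b :: c :: _, hnd, hmem, _ =>
    have ha := hmem a (by simp)
    have hb := hmem b (by simp)
    have hc := hmem c (by simp)
    simp only [List.nodup_cons, List.mem_cons, not_or] at hnd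
    exact ⟨g a, g b, g c, fun e => hnd.1.1 (E.inj _ ha.1 _ hb.1 e),
      fun e => hnd.1.2.1 (E.inj _ ha.1 _ hc.1 e), fun e => hnd.2.1.1 (E.inj _ hb.1 _ hc.1 e),
      ha.2, hb.2, hc.2⟩

namespace MinCounterexample

variable {G : SimpleGraph V}

theorem exists_hub_adj [Finite V] (hG : MinCounterexample G) {x : V} (hx : ¬Hub G x) :
    ∃ u, Hub G u ∧ G.Adj x u := by
  obtain ⟨a, b, h⟩ := hG.two_of_not_hub hx
  by_contra! hc
  obtain ⟨_, _, ha⟩ := hG.two_of_not_hub fun h' => hc a h' h.left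
  obtain ⟨_, _, hb⟩ := hG.two_of_not_hub fun h' => hc b h' h.right
  obtain ⟨a', ha⟩ := ha.exists_other h.left.symm
  obtain ⟨b', hb⟩ := hb.exists_other h.right.symm
  exact hG.no_three_path ha.symm h hb

theorem exists_far_hub [Finite V] (hG : MinCounterexample G) {x y u : V} (hu : Hub G u)
    (h : Two G x u y) (hy : ¬Hub G y) : ∃ v, Hub G v ∧ u ≠ v ∧ Two G y x v := by
  obtain ⟨_, _, h'⟩ := hG.two_of_not_hub hy
  obtain ⟨v, h'⟩ := h'.exists_other h.right.symm
  refine ⟨v, by_contra fun hv => ?_, ?_, h'⟩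
  · obtain ⟨_, _, h3⟩ := hG.two_of_not_hub hv
    obtain ⟨w, h3⟩ := h3.exists_other h'.right.symm
    exact hG.no_three_path h h' h3
  · rintro rfl
    obtain ⟨a, hax, hay, ha⟩ := hu.exists_adj x y
    have := hG.mem_of_gate (A := {x, y}) (a := x) (c := u) (by simp)
      (by simp [h.left.ne', h'.right.ne']) (by
        rintro p (rfl | rfl) q hq
        · rcases (h.2 q).1 hq with rfl | rfl <;> simp
        · rcases (h'.2 q).1 hq with rfl | rfl <;> simp) a
    simp [hax, hay, ha.ne'] at this

theorem exists_farTriple [Finite V] (hG : MinCounterexample G) {W : Set V}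
    {B : ℕ × List (ℕ × ℕ)} (hB : B ∈ cores) {g : ℕ → V} (E : Emb G W B.1 B.2 g) {a b c : V}
    (ha : Hub G a) (hb : Hub G b) (hc : Hub G c) (haW : a ∈ W) (hbW : b ∈ W) (hcW : c ∈ W)
    (hab : a ≠ b) (hac : a ≠ c) (hbc : b ≠ c) :
    (∃ t ∈ farTriples B, t.1 < B.1 ∧ t.2.1 < B.1 ∧ t.2.2 < B.1 ∧
      g t.1 = a ∧ g t.2.1 = b ∧ g t.2.2 = c) ∧ ∀ d ∈ W, Hub G d → d = a ∨ d = b ∨ d = c := by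
  have far : ∀ i < B.1, Hub G (g i) → farFromHubs B i = true := fun i hi h =>
    E.farFromHubs fun v hv => hG.not_adj_hubs h hv
  have nadj : ∀ i j, Hub G (g i) → Hub G (g j) → ¬listAdj B.2 i j = true := fun i j hi hj h =>
    hG.not_adj_hubs hi hj (E.adj_of_listAdj h)
  obtain ⟨i, hi, rfl⟩ := E.surj a haW
  obtain ⟨j, hj, rfl⟩ := E.surj b hbW
  obtain ⟨k, hk, rfl⟩ := E.surj c hcW
  have ht := mem_farTriples hi hj hk (far i hi ha) (far j hj hb) (far k hk hc)
    (fun e => hab (e ▸ rfl)) (fun e => hac (e ▸ rfl)) (fun e => hbc (e ▸ rfl))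
    (nadj i j ha hb) (nadj i k ha hc) (nadj j k hb hc)
  refine ⟨⟨_, ht, hi, hj, hk, rfl, rfl, rfl⟩, fun d hd hdh => ?_⟩
  obtain ⟨l, hl, rfl⟩ := E.surj d hd
  rcases farTriples_maximal B hB _ ht l (List.mem_range.2 hl) (far l hl hdh) with
    h | h | h | h | h | h
  · exact Or.inl (h ▸ rfl)
  · exact Or.inr (Or.inl (h ▸ rfl))
  · exact Or.inr (Or.inr (h ▸ rfl))
  · exact (nadj i l ha hdh h).elim
  · exact (nadj j l hb hdh h).elim
  · exact (nadj k l hc hdh h).elim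

/-- Deletion of a hub together with the threads at it. -/
theorem dichotomy_of_delete [Finite V] (hG : MinCounterexample G) {S : Set V} {u a : V}
    {o : V → V} (hu : u ∈ S) (ha : a ∉ S) (ho : ∀ s ∈ S, s ≠ u → Hub G (o s) ∧ o s ∉ S)
    (hadj : ∀ s ∈ S, s ≠ u → ∀ t, t ≠ u → G.Adj s t → t = o s ∨ t ∈ S ∧ o t = o s)
    (hN : ∀ t, G.Adj u t → t ∈ S)
    (hinj : ∀ s ∈ S, ∀ s' ∈ S, ∀ w ∉ S, G.Adj s w → G.Adj s' w → s = s') :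
    GoodOn G Sᶜ ∨ BadOn G Sᶜ := by
  refine hG.small Sᶜ (fun e => (e ▸ Set.mem_univ u : u ∈ Sᶜ) hu) G ?_ ?_ ⟨a, ha⟩
  · rintro A hA ⟨p, hp⟩ ⟨q, hq, hqA⟩
    obtain ⟨x, hx, y, hy, hyu, hxy⟩ := hG.exists_crossing_avoiding
      (A := {w | w ∈ A ∨ w ∈ S ∧ w ≠ u ∧ o w ∈ A}) (a := p) (b := q) (c := u)
      (by simp only [Set.mem_ofPred_eq]; exact fun h => h.elim (fun h => hA h hu) fun h => h.2.1 rfl)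
      (Or.inl hp) (fun h => h.elim hqA fun h => hq h.1) (fun e => hq (e ▸ hu))
    simp only [Set.mem_ofPred_eq, not_or] at hx hy
    have hxS : x ∉ S := fun hxS => by
      have hx := hx.resolve_left fun h => hA h hxS
      rcases hadj x hx.1 hx.2.1 y hyu hxy with rfl | h
      · exact hy.1 hx.2.2
      · exact hy.2 ⟨h.1, hyu, h.2 ▸ hx.2.2⟩
    have hx := hx.resolve_right fun h => hxS h.1
    refine ⟨x, hx, y, ⟨fun hyS => ?_, hy.1⟩, hxy⟩
    have hxu : x ≠ u := fun e => hxS (e ▸ hu)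
    rcases hadj y hyS hyu x hxu hxy.symm with rfl | h
    · exact hy.2 ⟨hyS, hyu, hx⟩
    · exact hxS h.1
  · intro w hw
    by_cases h : ∃ s ∈ S, G.Adj s w
    · obtain ⟨s, hs, hsw⟩ := h
      have hsu : s ≠ u := fun e => hw (hN w (e ▸ hsw))
      rcases hadj s hs hsu w (fun e => hw (e ▸ hu)) hsw with rfl | h
      · obtain ⟨p, q, hpq, hp, hq, h1, h2⟩ := (ho s hs hsu).1.exists_two s
        exact ⟨p, fun h => hp (hinj p h s hs _ hw h1.symm hsw),
          q, fun h => hq (hinj q h s hs _ hw h2.symm hsw), hpq, h1, h2⟩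
      · exact (hw h.1).elim
    · obtain ⟨p, -, q, -, hpq, h1, h2⟩ := hG.deg w trivial
      exact ⟨p, fun e => h ⟨p, e, h1.symm⟩, q, fun e => h ⟨q, e, h2.symm⟩, hpq, h1, h2⟩

end MinCounterexample

/-- The extension of an exact law to a deleted star. -/
theorem GoodOn.addStar [Finite V] {G : SimpleGraph V} {u x₁ x₂ x₃ : V} {o : V → V}
    (h12 : x₁ ≠ x₂) (h13 : x₁ ≠ x₃) (h23 : x₂ ≠ x₃) (h1 : G.Adj u x₁) (h2 : G.Adj u x₂)
    (h3 : G.Adj u x₃) (ho : ∀ x, G.Adj u x → G.Adj x (o x))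
    (hoW : ∀ x, G.Adj u x → o x ≠ u ∧ ¬G.Adj u (o x))
    (h : GoodOn G {w | w ≠ u ∧ ¬G.Adj u w}) : GoodOn G Set.univ := by
  obtain ⟨X, d1, d2, d3⟩ := h.exact
  have huD : ∀ ω, u ∉ X.D ω := fun ω h => (d1 ω h).1 rfl
  have hxD : ∀ ω x, G.Adj u x → x ∉ X.D ω := fun ω x hx h => (d1 ω h).2 hx
  have hp : ∀ x, G.Adj u x → X.ex (fun ω => ind (o x ∈ X.D ω)) = 2 / 5 :=
    fun x hx => d3 _ (hoW x hx)
  let al : X.Ω → Prop := fun ω => ∀ x, G.Adj u x → o x ∈ X.D ω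
  set e := X.ex fun ω => ind (al ω) with he
  have he0 : 0 ≤ e := X.ex_nonneg fun _ => ind_nonneg _
  have he1 : e ≤ 2 / 5 := hp x₁ h1 ▸ X.ex_mono fun ω _ => ind_mono fun h => h _ h1
  obtain ⟨s, hs0, hs1, hs⟩ : ∃ s : ℝ, 0 ≤ s ∧ s ≤ 1 ∧ s * (1 - e) = 2 / 5 :=
    ⟨2 / 5 / (1 - e), div_nonneg (by norm_num) (by linarith),
      (div_le_one (by linarith)).2 (by linarith), div_mul_cancel₀ _ (by linarith)⟩
  let t : X.Ω → ℝ := fun ω => s * (1 - ind (al ω))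
  have ht : ∀ ω, 0 ≤ t ω ∧ t ω ≤ 1 := fun ω => by
    have h1 := ind_le_one (al ω)
    have h2 := ind_nonneg (al ω)
    exact ⟨mul_nonneg hs0 (by linarith), by simp only [t]; nlinarith⟩
  let m : Fin 3 → V := ![x₁, x₂, x₃]
  let F : X.Ω → Bool × Fin 3 → Set V := fun ω c => {w | w ∈ X.D ω ∨ w = u ∧ c.1 = true ∨
    G.Adj u w ∧ c.1 = false ∧ (o w ∉ X.D ω ∨ al ω ∧ w = m c.2)}
  refine X.goodOn_bind (fun ω c => (if c.1 then t ω else 1 - t ω) / 3) (fun ω c => ?_)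
    (fun ω => ?_) F (fun _ _ => Set.subset_univ _) ?_ ?_
  · have := ht ω
    split_ifs <;> linarith
  · rw [Fintype.sum_prod_type]
    simp
    ring
  · rintro ω ⟨b, j⟩ h0 hK w -
    have hm : G.Adj u (m j) := by fin_cases j <;> simpa [m]
    by_cases hw : w = u
    · subst hw
      cases b
      · by_cases hal : al ω
        · exact Or.inr ⟨m j, Or.inr (Or.inr ⟨hm, rfl, Or.inr ⟨hal, rfl⟩⟩), hm.symm⟩
        · simp only [al, not_forall] at hal
          obtain ⟨x, hx, hxo⟩ := hal
          exact Or.inr ⟨x, Or.inr (Or.inr ⟨hx, rfl, Or.inl hxo⟩), hx.symm⟩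
      · exact Or.inl (Or.inr (Or.inl ⟨rfl, rfl⟩))
    by_cases hw' : G.Adj u w
    · cases b
      · by_cases hwo : o w ∈ X.D ω
        · exact Or.inr ⟨o w, Or.inl hwo, (ho w hw').symm⟩
        · exact Or.inl (Or.inr (Or.inr ⟨hw', rfl, Or.inl hwo⟩))
      · exact Or.inr ⟨u, Or.inr (Or.inl ⟨rfl, rfl⟩), hw'⟩
    · exact (d2 ω h0 w ⟨hw, hw'⟩).mono (fun _ h => Or.inl h) fun _ _ h => h
  · intro w _
    by_cases hw : w = u
    · have : ∀ ω c, (w ∈ F ω c) ↔ c.1 = true := fun ω c => by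
        simp only [F, Set.mem_ofPred_eq]
        simp [hw, huD]
      simp only [this, Fintype.sum_prod_type]
      refine le_of_eq ((X.ex_congr (g := fun ω => s * (1 - ind (al ω))) fun ω _ => ?_).trans ?_)
      · simp [ind, t]; ring
      · rw [X.ex_mul, X.ex_sub, X.ex_const, ← he, hs]
    by_cases hw' : G.Adj u w
    · have key : ∀ ω c, ind (w ∈ F ω c) ≤ if c.1 then 0 else
          (1 - ind (o w ∈ X.D ω)) + ind (al ω) * ind (w = m c.2) := fun ω c => by
        have : w ∈ F ω c ↔ c.1 = false ∧ (o w ∉ X.D ω ∨ al ω ∧ w = m c.2) := by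
          simp only [F, Set.mem_ofPred_eq]
          simp [hw, hxD ω w hw', hw']
        rw [propext this]
        unfold ind
        generalize (o w ∈ X.D ω) = P
        generalize al ω = Q
        generalize (w = m c.2) = R
        by_cases P <;> by_cases Q <;> by_cases R <;> cases c.1 <;> simp [*]
      have hm : ∑ j, ind (w = m j) ≤ 1 := by
        rw [Fin.sum_univ_three]
        change ind (w = x₁) + ind (w = x₂) + ind (w = x₃) ≤ 1
        by_cases k1 : w = x₁
        · rw [ind_true k1, ind_false (k1 ▸ h12), ind_false (k1 ▸ h13)]; norm_num
        by_cases k2 : w = x₂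
        · rw [ind_false k1, ind_true k2, ind_false (k2 ▸ h23)]; norm_num
        · rw [ind_false k1, ind_false k2]; linarith [ind_le_one (w = x₃)]
      refine (X.ex_mono (g := fun ω => (1 - s) + (-(1 - s)) * ind (o w ∈ X.D ω) +
        (1 / 3) * ind (al ω) + 0 * 0) fun ω _ => ?_).trans ?_
      · refine (Finset.sum_le_sum fun c _ => mul_le_mul_of_nonneg_left (key ω c) ?_).trans ?_
        · have := ht ω
          split_ifs <;> linarith
        · rw [Fintype.sum_prod_type]
          simp only [Fintype.sum_bool, if_true, Bool.false_eq_true, if_false, mul_zero,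
            Finset.sum_const_zero, zero_add, ← Finset.mul_sum, Finset.sum_add_distrib]
          simp only [Finset.sum_const, Finset.card_univ, Fintype.card_fin, nsmul_eq_mul, t]
          by_cases k2 : al ω
          · rw [ind_true k2, ind_true (k2 w hw')]
            push_cast
            linarith
          · rw [ind_false k2]
            push_cast
            linarith
      · rw [X.ex_lin, hp w hw', ← he]
        nlinarith [sq_nonneg (3 * s - 4 / 3)]
    · have : ∀ ω c, (w ∈ F ω c) ↔ w ∈ X.D ω := fun ω c => by
        simp only [F, Set.mem_ofPred_eq]
        simp [hw, hw']
      simp only [this, Fintype.sum_prod_type]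
      refine le_of_eq ((X.ex_congr (g := fun ω => ind (w ∈ X.D ω)) fun ω _ => ?_).trans
        (d3 w ⟨hw, hw'⟩))
      simp
      ring

namespace MinCounterexample

variable {G : SimpleGraph V}

/-- Some thread at each hub has two inner vertices. -/
theorem exists_long_thread [Finite V] (hG : MinCounterexample G) {u : V} (hu : Hub G u) :
    ∃ x y v, ¬Hub G y ∧ Hub G v ∧ u ≠ v ∧ Two G x u y ∧ Two G y x v := by
  by_contra! hc
  have hmid : ∀ x, G.Adj u x → ∃ v, Hub G v ∧ Two G x u v := fun x hx => by
    obtain ⟨_, _, h⟩ := hG.two_of_not_hub fun h => hG.not_adj_hubs hu h hx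
    obtain ⟨y, h⟩ := h.exists_other hx.symm
    by_contra! hn
    have hy : ¬Hub G y := fun hy => hn y hy h
    obtain ⟨v, hv, huv, h'⟩ := hG.exists_far_hub hu h hy
    exact hc x y v hy hv huv h h'
  have hex : ∀ x, ∃ v, G.Adj u x → Hub G v ∧ Two G x u v := fun x => by
    by_cases hx : G.Adj u x
    · obtain ⟨v, hv⟩ := hmid x hx; exact ⟨v, fun _ => hv⟩
    · exact ⟨x, fun h => (hx h).elim⟩
  choose o ho using hex
  have hoW : ∀ x, G.Adj u x → o x ≠ u ∧ ¬G.Adj u (o x) := fun x hx =>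
    ⟨(ho x hx).2.1.symm, hG.not_adj_hubs hu (ho x hx).1⟩
  have hinj : ∀ x x', G.Adj u x → G.Adj u x' → o x = o x' → x = x' := fun x x' hx hx' e =>
    hG.twin_free (ho x hx).2 (e ▸ (ho x' hx').2)
  have hnh : ∀ x, G.Adj u x → ¬Hub G x := fun x hx h => hG.not_adj_hubs hu h hx
  obtain ⟨x₁, x₂, x₃, h12, h13, h23, h1, h2, h3⟩ := hu
  have hS : {w | w = u ∨ G.Adj u w}ᶜ = {w | w ≠ u ∧ ¬G.Adj u w} := by
    ext w; simp
  have hdich := hG.dichotomy_of_delete (S := {w | w = u ∨ G.Adj u w}) (u := u) (a := o x₁) (o := o)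
    (Or.inl rfl) (fun h => h.elim (hoW x₁ h1).1 (hoW x₁ h1).2)
    (fun s hs hsu => ⟨(ho s (hs.resolve_left hsu)).1,
      fun h => h.elim (hoW s (hs.resolve_left hsu)).1 (hoW s (hs.resolve_left hsu)).2⟩)
    (fun s hs hsu t htu hst =>
      Or.inl ((((ho s (hs.resolve_left hsu)).2.2 t).1 hst).resolve_left htu))
    (fun t ht => Or.inr ht) (by
      intro s hs s' hs' w hw h h'
      simp only [Set.mem_ofPred_eq, not_or] at hs hs' hw
      have hs := hs.resolve_left fun e => hw.2 (e ▸ h)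
      have hs' := hs'.resolve_left fun e => hw.2 (e ▸ h')
      refine hinj s s' hs hs' ?_
      rw [← (((ho s hs).2.2 w).1 h).resolve_left hw.1,
        ← (((ho s' hs').2.2 w).1 h').resolve_left hw.1])
  rw [hS] at hdich
  rcases hdich with h | ⟨B, hB, g, E⟩
  · exact hG.not_good (h.addStar h12 h13 h23 h1 h2 h3 (fun x hx => (ho x hx).2.right) hoW)
  · obtain ⟨⟨t, ht, i1, i2, i3, e1, e2, e3⟩, hall⟩ := hG.exists_farTriple hB E (ho x₁ h1).1
      (ho x₂ h2).1 (ho x₃ h3).1 (hoW x₁ h1) (hoW x₂ h2) (hoW x₃ h3)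
      (fun e => h12 (hinj _ _ h1 h2 e)) (fun e => h13 (hinj _ _ h1 h3 e))
      (fun e => h23 (hinj _ _ h2 h3 e))
    have hN : ∀ x, G.Adj u x → x = x₁ ∨ x = x₂ ∨ x = x₃ := fun x hx =>
      (hall (o x) (hoW x hx) (ho x hx).1).imp (hinj _ _ hx h1)
        (Or.imp (hinj _ _ hx h2) (hinj _ _ hx h3))
    refine hG.not_good ((E.extend (xs := [u, x₁, x₂, x₃]) (W' := Set.univ) (G := G)
      (by simp [h1.ne, h2.ne, h3.ne, h12, h13, h23]) (fun x hx => ?_) (fun v => ?_)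
      (es' := _) ?_).goodOn (by simp) (core_addStar B hB t ht))
    · simp only [List.mem_cons, List.not_mem_nil, or_false] at hx
      rcases hx with rfl | rfl | rfl | rfl <;> simp [*]
    · simp only [Set.mem_univ, Set.mem_ofPred_eq, List.mem_cons, List.not_mem_nil, or_false,
        true_iff]
      have := hN v
      tauto
    · have a1 := (ho x₁ h1).2.right
      have a2 := (ho x₂ h2).2.right
      have a3 := (ho x₃ h3).2.right
      intro e he
      rcases List.mem_append.1 he with h5 | h5
      · have hlt := cores_lt hB
        rw [extendEnum_lt (hlt.2 _ h5).1, extendEnum_lt (hlt.2 _ h5).2]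
        exact E.adj _ h5
      · simp only [List.mem_cons, List.not_mem_nil, or_false] at h5
        rcases h5 with rfl | rfl | rfl | rfl | rfl | rfl <;>
          simp [extendEnum_add, extendEnum_self, extendEnum_lt, *]

end MinCounterexample

theorem longStar_bound {P Q S S' : Prop} (hS : ¬(S ∧ S')) (hPQ : ¬P → ¬Q) (R : Prop) :
    ∑ i : Bool × Bool × Bool, (if i.1 then 1 / 3 + 1 / 6 * ind R else 1 - (1 / 3 + 1 / 6 * ind R)) /
      4 * ind (i.1 = false ∧ ¬P ∨ (Q ∧ ¬R) ∧ i.1 = false ∧ i.2.1 = false ∧ if i.2.2 then S else S') ≤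
      2 / 3 + -(1 / 6) * ind R + -(1 / 2) * ind P + 0 * 0 := by
  simp only [Fintype.sum_prod_type, Fintype.sum_bool, ind]
  by_cases hP : P
  · by_cases hR : R
    · simp [hP, hR]; norm_num
    · by_cases h : S
      · have h' : ¬S' := fun h' => hS ⟨h, h'⟩
        by_cases hQ : Q <;> simp [hP, hR, h, h', hQ] <;> norm_num
      · by_cases hQ : Q <;> by_cases h' : S' <;> simp [hP, hR, h, h', hQ] <;> norm_num
  · have hQ := hPQ hP
    by_cases hR : R <;> simp [hP, hR, hQ] <;> norm_num

/-- The extension of an exact law to a deleted star with one long thread. -/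
theorem GoodOn.addLongStar [Finite V] {G : SimpleGraph V} {u x₀ x₁ x₂ y v : V} {o : V → V}
    (h12 : x₁ ≠ x₂) (h10 : x₁ ≠ x₀) (h20 : x₂ ≠ x₀) (hyu : y ≠ u) (hay : ¬G.Adj u y)
    (h0 : G.Adj u x₀) (h1 : G.Adj u x₁) (h2 : G.Adj u x₂) (hxy : G.Adj x₀ y) (hyv : G.Adj y v)
    (ho : ∀ x, G.Adj u x → x ≠ x₀ → G.Adj x (o x))
    (hv : v ≠ u ∧ ¬G.Adj u v)
    (hoW : ∀ x, G.Adj u x → x ≠ x₀ → o x ≠ u ∧ ¬G.Adj u (o x) ∧ o x ≠ y)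
    (h : GoodOn G {w | w ≠ u ∧ ¬G.Adj u w ∧ w ≠ y}) : GoodOn G Set.univ := by
  obtain ⟨X, d1, d2, d3⟩ := h.exact
  have huD : ∀ ω, u ∉ X.D ω := fun ω h => (d1 ω h).1 rfl
  have hyD : ∀ ω, y ∉ X.D ω := fun ω h => (d1 ω h).2.2 rfl
  have hxD : ∀ ω x, G.Adj u x → x ∉ X.D ω := fun ω x hx h => (d1 ω h).2.1 hx
  have hp : ∀ x, G.Adj u x → x ≠ x₀ → X.ex (fun ω => ind (o x ∈ X.D ω)) = 2 / 5 :=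
    fun x hx h => d3 _ (hoW x hx h)
  have hpv : X.ex (fun ω => ind (v ∈ X.D ω)) = 2 / 5 := d3 _ ⟨hv.1, hv.2, hyv.ne'⟩
  let al : X.Ω → Prop := fun ω => ∀ x, G.Adj u x → x ≠ x₀ → o x ∈ X.D ω
  let t : X.Ω → ℝ := fun ω => 1 / 3 + 1 / 6 * ind (v ∈ X.D ω)
  have ht : ∀ ω, 0 ≤ t ω ∧ t ω ≤ 1 := fun ω => by
    have h1 := ind_le_one (v ∈ X.D ω)
    have h2 := ind_nonneg (v ∈ X.D ω)
    simp only [t]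
    constructor <;> linarith
  let m : Bool → V := fun j => if j then x₁ else x₂
  let F : X.Ω → Bool × Bool × Bool → Set V := fun ω c => {w | w ∈ X.D ω ∨ w = u ∧ c.1 = true ∨
    w = x₀ ∧ c.1 = false ∧ (v ∈ X.D ω ∨ c.2.1 = true) ∨
    w = y ∧ v ∉ X.D ω ∧ (c.1 = true ∨ c.2.1 = false) ∨
    (G.Adj u w ∧ w ≠ x₀) ∧ (c.1 = false ∧ o w ∉ X.D ω ∨
      (al ω ∧ v ∉ X.D ω) ∧ c.1 = false ∧ c.2.1 = false ∧ w = m c.2.2)}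
  refine X.goodOn_bind (fun ω c => (if c.1 then t ω else 1 - t ω) / 4) (fun ω c => ?_)
    (fun ω => ?_) F (fun _ _ => Set.subset_univ _) ?_ ?_
  · have := ht ω
    split_ifs <;> linarith
  · simp only [Fintype.sum_prod_type, Fintype.sum_bool]
    simp
    ring
  · rintro ω ⟨b, c, j⟩ hω hK w -
    have hm : G.Adj u (m j) ∧ m j ≠ x₀ := by cases j <;> simp [m, *]
    by_cases hw : w = u
    · subst hw
      cases b
      · by_cases hc : v ∈ X.D ω ∨ c = true
        · exact Or.inr ⟨x₀, Or.inr (Or.inr (Or.inl ⟨rfl, rfl, hc⟩)), h0.symm⟩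
        rw [not_or] at hc
        by_cases hal : al ω
        · exact Or.inr ⟨m j, Or.inr (Or.inr (Or.inr (Or.inr ⟨hm, Or.inr ⟨⟨hal, hc.1⟩, rfl,
            by simpa using hc.2, rfl⟩⟩))), hm.1.symm⟩
        · simp only [al, not_forall] at hal
          obtain ⟨x, hx, hx0, hxo⟩ := hal
          exact Or.inr ⟨x, Or.inr (Or.inr (Or.inr (Or.inr ⟨⟨hx, hx0⟩, Or.inl ⟨rfl, hxo⟩⟩))),
            hx.symm⟩
      · exact Or.inl (Or.inr (Or.inl ⟨rfl, rfl⟩))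
    by_cases hwy : w = y
    · subst hwy
      by_cases hvD : v ∈ X.D ω
      · exact Or.inr ⟨v, Or.inl hvD, hyv.symm⟩
      by_cases hbc : b = true ∨ c = false
      · exact Or.inl (Or.inr (Or.inr (Or.inr (Or.inl ⟨rfl, hvD, hbc⟩))))
      · simp only [not_or, Bool.not_eq_true, Bool.not_eq_false] at hbc
        exact Or.inr ⟨x₀, Or.inr (Or.inr (Or.inl ⟨rfl, hbc.1, Or.inr hbc.2⟩)), hxy⟩
    by_cases hw' : G.Adj u w
    · cases b
      · by_cases hw0 : w = x₀
        · subst hw0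
          by_cases hc : v ∈ X.D ω ∨ c = true
          · exact Or.inl (Or.inr (Or.inr (Or.inl ⟨rfl, rfl, hc⟩)))
          · simp only [not_or, Bool.not_eq_true] at hc
            exact Or.inr ⟨y, Or.inr (Or.inr (Or.inr (Or.inl ⟨rfl, hc.1, Or.inr hc.2⟩))),
              hxy.symm⟩
        by_cases hwo : o w ∈ X.D ω
        · exact Or.inr ⟨o w, Or.inl hwo, (ho w hw' hw0).symm⟩
        · exact Or.inl (Or.inr (Or.inr (Or.inr (Or.inr ⟨⟨hw', hw0⟩, Or.inl ⟨rfl, hwo⟩⟩))))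
      · exact Or.inr ⟨u, Or.inr (Or.inl ⟨rfl, rfl⟩), hw'⟩
    · exact (d2 ω hω w ⟨hw, hw', hwy⟩).mono (fun _ h => Or.inl h) fun _ _ h => h
  · intro w _
    have key : ∀ (a b c : ℝ) (f : X.Ω → ℝ), X.ex f = 2 / 5 →
        (∀ ω, ∑ i, (if i.1 then t ω else 1 - t ω) / 4 * ind (w ∈ F ω i) ≤
          a + b * ind (v ∈ X.D ω) + c * f ω + 0 * 0) → a + b * (2 / 5) + c * (2 / 5) ≤ 2 / 5 →
        X.ex (fun ω => ∑ i, (if i.1 then t ω else 1 - t ω) / 4 * ind (w ∈ F ω i)) ≤ 2 / 5 := by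
      intro a b c f hf h1 h2
      refine (X.ex_mono fun ω _ => h1 ω).trans ?_
      rw [X.ex_lin, hf, hpv]
      linarith
    by_cases hw : w = u
    · have : ∀ ω c, (w ∈ F ω c) ↔ c.1 = true := fun ω c => by
        simp only [F, Set.mem_ofPred_eq]
        simp [hw, huD, h0.ne, hyu.symm]
      refine key (1 / 3) (1 / 6) 0 _ hpv (fun ω => ?_) (by norm_num)
      simp only [this, Fintype.sum_prod_type, Fintype.sum_bool, t, ind]
      by_cases k : v ∈ X.D ω <;> simp [k] <;> norm_num
    by_cases hwy : w = y
    · have : ∀ ω c, (w ∈ F ω c) ↔ v ∉ X.D ω ∧ (c.1 = true ∨ c.2.1 = false) := fun ω c => by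
        simp only [F, Set.mem_ofPred_eq]
        simp [hwy, hyD, hxy.ne', hyu, hay]
      refine key (2 / 3) (-(2 / 3)) 0 _ hpv (fun ω => ?_) (by norm_num)
      simp only [this, Fintype.sum_prod_type, Fintype.sum_bool, t, ind]
      by_cases k : v ∈ X.D ω <;> simp [k] <;> norm_num
    by_cases hw0 : w = x₀
    · have : ∀ ω c, (w ∈ F ω c) ↔ c.1 = false ∧ (v ∈ X.D ω ∨ c.2.1 = true) := fun ω c => by
        simp only [F, Set.mem_ofPred_eq]
        simp [hw0, hxD _ _ h0, hxy.ne, h0.ne']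
      refine key (1 / 3) (1 / 6) 0 _ hpv (fun ω => ?_) (by norm_num)
      simp only [this, Fintype.sum_prod_type, Fintype.sum_bool, t, ind]
      by_cases k : v ∈ X.D ω <;> simp [k] <;> norm_num
    by_cases hw' : G.Adj u w
    · have : ∀ ω c, (w ∈ F ω c) ↔ c.1 = false ∧ o w ∉ X.D ω ∨
          (al ω ∧ v ∉ X.D ω) ∧ c.1 = false ∧ c.2.1 = false ∧ w = m c.2.2 := fun ω c => by
        simp only [F, Set.mem_ofPred_eq]
        simp [hw, hwy, hw0, hxD ω w hw', hw']
      refine key (2 / 3) (-(1 / 6)) (-(1 / 2)) _ (hp w hw' hw0) (fun ω => ?_) (by norm_num)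
      have hm : ¬(w = x₁ ∧ w = x₂) := fun h => h12 (h.1.symm.trans h.2)
      refine le_of_eq_of_le (Finset.sum_congr rfl fun i _ => ?_)
        (longStar_bound hm (fun h1 (h2 : al ω) => h1 (h2 w hw' hw0)) (v ∈ X.D ω))
      rw [propext (this ω i)]
      rcases i with ⟨_, _, _ | _⟩ <;> rfl
    · have : ∀ ω c, (w ∈ F ω c) ↔ w ∈ X.D ω := fun ω c => by
        simp only [F, Set.mem_ofPred_eq]
        simp [hw, hw', hwy, hw0]
      refine key 0 0 1 _ (d3 w ⟨hw, hw', hwy⟩) (fun ω => le_of_eq ?_) (by norm_num)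
      simp only [this, Fintype.sum_prod_type, Fintype.sum_bool]
      simp
      ring

namespace MinCounterexample

variable {G : SimpleGraph V}

theorem exists_second_thread [Finite V] (hG : MinCounterexample G) {u : V} (hu : Hub G u) :
    ∃ x y v, ¬Hub G y ∧ Hub G v ∧ Two G x u y ∧ Two G y x v ∧
      ∃ x', x' ≠ x ∧ (Two G x' u v ∨
        ∃ y' v', ¬Hub G y' ∧ Hub G v' ∧ Two G x' u y' ∧ Two G y' x' v') := by
  obtain ⟨x₀, y, v, hy, hv, huv, hx0, hy0⟩ := hG.exists_long_thread hu
  by_contra! hc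
  have hc := hc x₀ y v hy hv hx0 hy0
  have hex : ∀ x, ∃ w, G.Adj u x ∧ x ≠ x₀ → Hub G w ∧ Two G x u w ∧ w ≠ v := fun x => by
    by_cases hx : G.Adj u x ∧ x ≠ x₀
    · obtain ⟨_, _, h⟩ := hG.two_of_not_hub fun h => hG.not_adj_hubs hu h hx.1
      obtain ⟨w, h⟩ := h.exists_other hx.1.symm
      by_cases hw : Hub G w
      · exact ⟨w, fun _ => ⟨hw, h, fun e => (hc x hx.2).1 (e ▸ h)⟩⟩
      · obtain ⟨v', hv', -, h'⟩ := hG.exists_far_hub hu h hw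
        exact ((hc x hx.2).2 w v' hw hv' h h').elim
    · exact ⟨x, fun h => (hx h).elim⟩
  choose o ho using hex
  obtain ⟨x₁, x₂, h12, h10, h20, h1, h2⟩ := hu.exists_two x₀
  have h0 : G.Adj u x₀ := hx0.left.symm
  have hxy : G.Adj x₀ y := hx0.right
  have hyv : G.Adj y v := hy0.right
  have hyu : y ≠ u := fun e => hy (e ▸ hu)
  have hay : ¬G.Adj u y := fun h => ((hy0.2 u).1 h.symm).elim h0.ne huv
  have hvW : v ≠ u ∧ ¬G.Adj u v ∧ v ≠ y := ⟨huv.symm, hG.not_adj_hubs hu hv, hyv.ne'⟩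
  have hoW : ∀ x, G.Adj u x → x ≠ x₀ → o x ≠ u ∧ ¬G.Adj u (o x) ∧ o x ≠ y := fun x hx h =>
    ⟨(ho x ⟨hx, h⟩).2.1.1.symm, hG.not_adj_hubs hu (ho x ⟨hx, h⟩).1,
      fun e => hy (e ▸ (ho x ⟨hx, h⟩).1)⟩
  have hinj : ∀ x x', G.Adj u x → G.Adj u x' → x ≠ x₀ → x' ≠ x₀ → o x = o x' → x = x' :=
    fun x x' hx hx' h h' e => hG.twin_free (ho x ⟨hx, h⟩).2.1 (e ▸ (ho x' ⟨hx', h'⟩).2.1)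
  let o' : V → V := fun w => if w = x₀ ∨ w = y then v else o w
  have ho' : ∀ x, G.Adj u x → x ≠ x₀ → o' x = o x := fun x hx h =>
    if_neg fun h' => h'.elim h fun e => hay (e ▸ hx)
  have ho0 : o' x₀ = v := if_pos (Or.inl rfl)
  have hoy : o' y = v := if_pos (Or.inr rfl)
  set S : Set V := {w | w = u ∨ G.Adj u w ∨ w = y} with hS
  have hSc : Sᶜ = {w | w ≠ u ∧ ¬G.Adj u w ∧ w ≠ y} := by
    ext w; simp [hS]
  have hSm : ∀ s ∈ S, s ≠ u → s = x₀ ∨ s = y ∨ G.Adj u s ∧ s ≠ x₀ := fun s hs hsu => by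
    by_cases e : s = x₀
    · exact Or.inl e
    · exact Or.inr ((hs.resolve_left hsu).symm.imp_right fun h => ⟨h, e⟩)
  have hnS : ∀ w, w ∉ S ↔ w ≠ u ∧ ¬G.Adj u w ∧ w ≠ y := fun w => by simp [hS]
  have hout : ∀ s ∈ S, ∀ w ∉ S, G.Adj s w → s = y ∧ w = v ∨ (G.Adj u s ∧ s ≠ x₀) ∧ w = o s := by
    intro s hs w hw h
    rw [hnS] at hw
    rcases hSm s hs (fun e => hw.2.1 (e ▸ h)) with rfl | rfl | hs'
    · exact (((hx0.2 w).1 h).elim hw.1 hw.2.2).elim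
    · exact Or.inl ⟨rfl, ((hy0.2 w).1 h).resolve_left fun e => hw.2.1 (e ▸ h0)⟩
    · exact Or.inr ⟨hs', (((ho s hs').2.1.2 w).1 h).resolve_left hw.1⟩
  have hdich := hG.dichotomy_of_delete (S := S) (u := u) (a := v) (o := o') (Or.inl rfl)
    ((hnS v).2 hvW) (fun s hs hsu => by
      rw [hnS]
      rcases hSm s hs hsu with rfl | rfl | h
      · rw [ho0]; exact ⟨hv, hvW⟩
      · rw [hoy]; exact ⟨hv, hvW⟩
      · rw [ho' s h.1 h.2]; exact ⟨(ho s h).1, hoW s h.1 h.2⟩)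
    (fun s hs hsu t htu hst => by
      rcases hSm s hs hsu with rfl | rfl | h
      · obtain rfl := ((hx0.2 t).1 hst).resolve_left htu
        exact Or.inr ⟨Or.inr (Or.inr rfl), hoy.trans ho0.symm⟩
      · rcases (hy0.2 t).1 hst with rfl | rfl
        · exact Or.inr ⟨Or.inr (Or.inl h0), ho0.trans hoy.symm⟩
        · exact Or.inl hoy.symm
      · rw [ho' s h.1 h.2]
        exact Or.inl ((((ho s h).2.1.2 t).1 hst).resolve_left htu))
    (fun t ht => Or.inr (Or.inl ht)) (by
      intro s hs s' hs' w hw h h'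
      rcases hout s hs w hw h with ⟨rfl, rfl⟩ | ⟨k, rfl⟩ <;>
        rcases hout s' hs' _ hw h' with ⟨rfl, e⟩ | ⟨k', e⟩
      · rfl
      · exact ((ho s' k').2.2 e.symm).elim
      · exact ((ho s k).2.2 e).elim
      · exact hinj _ _ k.1 k'.1 k.2 k'.2 e)
  rw [hSc] at hdich
  rcases hdich with h | ⟨B, hB, g, E⟩
  · exact hG.not_good (h.addLongStar h12 h10 h20 hyu hay h0 h1 h2 hxy hyv
      (fun x hx hx0 => (ho x ⟨hx, hx0⟩).2.1.right) ⟨hvW.1, hvW.2.1⟩ hoW)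
  have k1 := ho x₁ ⟨h1, h10⟩
  have k2 := ho x₂ ⟨h2, h20⟩
  have hne : o x₁ ≠ o x₂ := fun e => h12 (hinj _ _ h1 h2 h10 h20 e)
  have main : ∀ x₁ x₂, x₁ ≠ x₂ → x₁ ≠ x₀ → x₂ ≠ x₀ → G.Adj u x₁ → G.Adj u x₂ →
      (∀ x, G.Adj u x → x ≠ x₀ → x = x₁ ∨ x = x₂) → ∀ t ∈ farTriples B, t.1 < t.2.1 →
      t.1 < B.1 → t.2.1 < B.1 → t.2.2 < B.1 → g t.1 = o x₁ → g t.2.1 = o x₂ → g t.2.2 = v →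
      False := by
    intro x₁ x₂ h12 h10 h20 h1 h2 hN t ht hlt i1 i2 i3 e1 e2 e3
    have a1 := (ho x₁ ⟨h1, h10⟩).2.1.right
    have a2 := (ho x₂ ⟨h2, h20⟩).2.1.right
    have n1 : x₁ ≠ y := fun e => hay (e ▸ h1)
    have n2 : x₂ ≠ y := fun e => hay (e ▸ h2)
    refine hG.not_good ((E.extend (xs := [u, x₁, x₂, x₀, y]) (W' := Set.univ) (G := G)
      (by simp [h1.ne, h2.ne, h0.ne, h12, h10, h20, hyu.symm, hxy.ne, n1, n2]) (fun x hx => ?_)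
      (fun v => ?_) (es' := _) ?_).goodOn (by simp) (core_addLongStar B hB t ht hlt))
    · simp only [List.mem_cons, List.not_mem_nil, or_false] at hx
      rcases hx with rfl | rfl | rfl | rfl | rfl <;> simp [*]
    · simp only [Set.mem_univ, Set.mem_ofPred_eq, List.mem_cons, List.not_mem_nil, or_false,
        true_iff]
      have := hN v
      tauto
    · intro e he
      rcases List.mem_append.1 he with h5 | h5
      · have hlt := cores_lt hB
        rw [extendEnum_lt (hlt.2 _ h5).1, extendEnum_lt (hlt.2 _ h5).2]
        exact E.adj _ h5
      · simp only [List.mem_cons, List.not_mem_nil, or_false] at h5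
        rcases h5 with rfl | rfl | rfl | rfl | rfl | rfl | rfl <;>
          simp [extendEnum_add, extendEnum_self, extendEnum_lt, *]
  obtain ⟨⟨t, ht, i1, i2, i3, e1, e2, e3⟩, hall⟩ := hG.exists_farTriple hB E k1.1 k2.1 hv
    (hoW x₁ h1 h10) (hoW x₂ h2 h20) hvW hne k1.2.2 k2.2.2
  obtain ⟨⟨t', ht', i1', i2', i3', e1', e2', e3'⟩, -⟩ := hG.exists_farTriple hB E k2.1 k1.1 hv
    (hoW x₂ h2 h20) (hoW x₁ h1 h10) hvW hne.symm k2.2.2 k1.2.2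
  have hN : ∀ x, G.Adj u x → x ≠ x₀ → x = x₁ ∨ x = x₂ := fun x hx hx0 =>
    have hox := ho x ⟨hx, hx0⟩
    (hall (o x) (hoW x hx hx0) hox.1).imp (hinj _ _ hx h1 hx0 h10) fun h =>
      hinj _ _ hx h2 hx0 h20 (h.resolve_right hox.2.2)
  rcases lt_trichotomy t.1 t.2.1 with hlt | he | hlt
  · exact main x₁ x₂ h12 h10 h20 h1 h2 hN t ht hlt i1 i2 i3 e1 e2 e3
  · exact hne (e1 ▸ e2 ▸ he ▸ rfl)
  · refine main x₂ x₁ h12.symm h20 h10 h2 h1 (fun x hx hx0 => (hN x hx hx0).symm) t' ht' ?_ i1'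
      i2' i3' e1' e2' e3'
    rwa [E.inj _ i1' _ i2 (e1'.trans e2.symm), E.inj _ i2' _ i1 (e2'.trans e1.symm)]

end MinCounterexample

/-- A matching of darts can be oriented so that every fibre of `η` with at least two darts contains
both kinds of darts. -/
theorem exists_orientation {α β : Type*} (η : α → β) (n : ℕ) : ∀ (M : Finset α) (π : α → α),
    #M = n → (∀ x ∈ M, π x ∈ M) → (∀ x ∈ M, π (π x) = x) → (∀ x ∈ M, π x ≠ x) →
    ∃ pick : α → Prop, (∀ x ∈ M, pick (π x) ↔ ¬pick x) ∧
      ∀ x ∈ M, ∀ x' ∈ M, x ≠ x' → η x = η x' →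
        (∃ z ∈ M, η z = η x ∧ pick z) ∧ ∃ z ∈ M, η z = η x ∧ ¬pick z := by
  induction n using Nat.strong_induction_on with
  | _ n ih =>
    intro M π hn h1 h2 h3
    by_cases hc : ∃ x ∈ M, ∃ x' ∈ M, x ≠ x' ∧ η x = η x'
    · obtain ⟨x, hx, x', hx', hne, he⟩ := hc
      have hM : ∀ z, z ∈ (M.erase x).erase x' ↔ z ≠ x' ∧ z ≠ x ∧ z ∈ M := fun z => by
        rw [mem_erase, mem_erase]
      have hcard : #((M.erase x).erase x') < n := hn ▸
        (card_le_card (erase_subset _ _)).trans_lt (card_erase_lt_of_mem hx)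
      have hinj : ∀ a ∈ M, ∀ b ∈ M, π a = π b → a = b := fun a ha b hb e => by
        rw [← h2 a ha, ← h2 b hb, e]
      obtain ⟨π', hπ1, hπ2, hπ3, hπ4⟩ : ∃ π' : α → α,
          (∀ z ∈ (M.erase x).erase x', π' z ∈ (M.erase x).erase x') ∧
          (∀ z ∈ (M.erase x).erase x', π' (π' z) = z) ∧
          (∀ z ∈ (M.erase x).erase x', π' z ≠ z) ∧
          ∀ z ∈ (M.erase x).erase x',
            z ≠ π x ∧ z ≠ π x' ∧ π' z = π z ∨ z = π x ∧ π' z = π x' ∨ z = π x' ∧ π' z = π x := by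
        refine ⟨fun z => if z = π x then π x' else if z = π x' then π x else π z, ?_⟩
        simp only [hM]
        have e1 := h2 x hx
        have e2 := h2 x' hx'
        have e3 := h3 x hx
        have e4 := h3 x' hx'
        have e5 := hinj x hx x' hx'
        have e6 := h1 x hx
        have e7 := h1 x' hx'
        refine ⟨?_, ?_, ?_, ?_⟩ <;> rintro z ⟨z1, z2, z3⟩ <;>
          have k1 := h1 z z3 <;> have k2 := h2 z z3 <;> have k3 := h3 z z3 <;> grind
      obtain ⟨p, hp, hp'⟩ := ih _ hcard _ π' rfl hπ1 hπ2 hπ3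
      have hx1 : π x ≠ x' → π x ∈ (M.erase x).erase x' := fun h =>
        (hM _).2 ⟨h, h3 x hx, h1 x hx⟩
      have hx2 : π x ≠ x' → π x' ∈ (M.erase x).erase x' := fun h =>
        (hM _).2 ⟨h3 x' hx', fun e => h (by rw [← e, h2 x' hx']), h1 x' hx'⟩
      have hpx : π x ≠ x' → (p (π x') ↔ ¬p (π x)) := fun h => by
        rw [← hp _ (hx1 h)]
        rcases hπ4 _ (hx1 h) with ⟨h', -⟩ | ⟨-, h'⟩ | ⟨h', -⟩
        · exact (h' rfl).elim
        · rw [h']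
        · exact (hne (hinj x hx x' hx' h')).elim
      let q : α → Prop := fun z => if z = x then ¬p (π x) else if z = x' then p (π x) else p z
      have q1 : q x ↔ ¬p (π x) := by simp [q]
      have q2 : q x' ↔ p (π x) := by simp [q, hne.symm]
      have q3 : ∀ z, z ≠ x → z ≠ x' → (q z ↔ p z) := fun z h h' => by simp [q, h, h']
      refine ⟨q, fun z hz => ?_, fun z hz z' hz' hzz e => ?_⟩
      · by_cases e1 : z = x
        · subst e1
          by_cases e2 : π z = x'
          · rw [e2, q2, q1, e2]; tauto
          · rw [q3 _ (h3 z hz) e2, q1]; tauto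
        by_cases e2 : z = x'
        · subst e2
          by_cases e3 : π x = z
          · rw [← e3, h2 x hx, e3, q1, q2, e3]
          · rw [q3 _ (fun e => e3 (by rw [← e, h2 z hz])) (h3 z hz), q2, hpx e3]
        have hz' := (hM z).2 ⟨e2, e1, hz⟩
        rw [q3 z e1 e2]
        rcases hπ4 z hz' with ⟨k1, k2, k3⟩ | ⟨rfl, k⟩ | ⟨rfl, k⟩
        · rw [q3 _ (fun e => k1 (by rw [← e, h2 z hz])) (fun e => k2 (by rw [← e, h2 z hz])), ← k3,
            hp z hz']
        · rw [h2 x hx, q1]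
        · have : π x ≠ x' := fun e => e1 (by rw [← e, h2 x hx])
          rw [h2 x' hx', q2, hpx this, not_not]
      · by_cases k : η z = η x
        · rw [k]
          by_cases hpi : p (π x)
          · exact ⟨⟨x', hx', he.symm, q2.2 hpi⟩, x, hx, rfl, fun h => q1.1 h hpi⟩
          · exact ⟨⟨x, hx, rfl, q1.2 hpi⟩, x', hx', he.symm, fun h => hpi (q2.1 h)⟩
        · have hmem : ∀ z ∈ M, η z ≠ η x → z ∈ (M.erase x).erase x' := fun z hz k =>
            (hM z).2 ⟨fun e => k (e ▸ he.symm), fun e => k (e ▸ rfl), hz⟩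
          obtain ⟨⟨a, ha, ha1, ha2⟩, b, hb, hb1, hb2⟩ :=
            hp' z (hmem z hz k) z' (hmem z' hz' (e ▸ k)) hzz e
          have ha := (hM a).1 ha
          have hb := (hM b).1 hb
          exact ⟨⟨a, ha.2.2, ha1, (q3 a ha.2.1 ha.1).2 ha2⟩, b, hb.2.2, hb1,
            fun h => hb2 ((q3 b hb.2.1 hb.1).1 h)⟩
    · refine ⟨fun x => WellOrderingRel x (π x), fun x hx => ?_, fun x hx x' hx' hne e =>
        (hc ⟨x, hx, x', hx', hne, e⟩).elim⟩
      change WellOrderingRel (π x) (π (π x)) ↔ ¬WellOrderingRel x (π x)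
      rw [h2 x hx]
      rcases trichotomous_of WellOrderingRel x (π x) with h | h | h
      · exact iff_of_false (fun h' => asymm h h') fun h' => h' h
      · exact (h3 x hx h.symm).elim
      · exact iff_of_true h fun h' => asymm h h'

/-- A pairwise independent family of fair coins indexed by `S`. -/
theorem exists_fair_coins (S : Finset V) : ∃ X : RandSet V, (∀ ω, X.D ω ⊆ S) ∧
    (∀ u ∈ S, X.ex (fun ω => ind (u ∈ X.D ω)) = 1 / 2) ∧
    ∀ u ∈ S, ∀ v ∈ S, u ≠ v → X.ex (fun ω => ind (u ∈ X.D ω ∧ v ∈ X.D ω)) = 1 / 4 := by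
  induction S using Finset.induction_on with
  | empty =>
    exact ⟨⟨Unit, fun _ => 1, fun _ => zero_le_one, by simp, fun _ => ∅⟩, by simp, by simp,
      by simp⟩
  | insert w S hw ih =>
    obtain ⟨X, x1, x2, x3⟩ := ih
    have hwD : ∀ ω, w ∉ X.D ω := fun ω h => hw (x1 ω h)
    refine ⟨X.bind (fun _ (_ : Bool) => 1 / 2) (fun _ _ => by norm_num) (fun _ => by simp)
      fun ω b => {v | v ∈ X.D ω ∨ v = w ∧ b = true}, ?_, ?_, ?_⟩
    · rintro ω v (hv | ⟨rfl, -⟩)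
      · exact mem_insert_of_mem (x1 _ hv)
      · exact mem_insert_self _ _
    · intro u hu
      refine (X.ex_bind _ _ _ _ _).trans ?_
      simp only [RandSet.bind, Set.mem_ofPred_eq, Fintype.sum_bool]
      rcases mem_insert.1 hu with rfl | hu'
      · refine (X.ex_congr (g := fun _ => 1 / 2) fun ω _ => ?_).trans (X.ex_const _)
        simp [ind, hwD]
      · refine (X.ex_congr (g := fun ω => ind (u ∈ X.D ω)) fun ω _ => ?_).trans (x2 u hu')
        have : u ≠ w := fun e => hw (e ▸ hu')
        simp [this]
        ring
    · have key : ∀ u ∈ S, (X.bind (fun _ (_ : Bool) => 1 / 2) (fun _ _ => by norm_num)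
          (fun _ => by simp) fun ω b => {v | v ∈ X.D ω ∨ v = w ∧ b = true}).ex
          (fun ω => ind ((u ∈ X.D ω.1 ∨ u = w ∧ ω.2 = true) ∧
            (w ∈ X.D ω.1 ∨ w = w ∧ ω.2 = true))) = 1 / 4 := by
        intro u hu
        have : u ≠ w := fun e => hw (e ▸ hu)
        refine (X.ex_bind _ _ _ _ _).trans ?_
        refine (X.ex_congr (g := fun ω => 1 / 2 * ind (u ∈ X.D ω)) fun ω _ => ?_).trans ?_
        · simp [this, hwD, ind]
        · rw [X.ex_mul, x2 u hu]; norm_num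
      intro u hu v hv huv
      rcases mem_insert.1 hu with rfl | hu' <;> rcases mem_insert.1 hv with rfl | hv'
      · exact (huv rfl).elim
      · rw [← key v hv']
        refine RandSet.ex_congr _ fun ω _ => ?_
        rw [and_comm]; rfl
      · exact key u hu'
      · have h1 : u ≠ w := fun e => hw (e ▸ hu')
        have h2 : v ≠ w := fun e => hw (e ▸ hv')
        refine (X.ex_bind _ _ _ _ _).trans ?_
        refine (X.ex_congr (g := fun ω => ind (u ∈ X.D ω ∧ v ∈ X.D ω)) fun ω _ => ?_).trans
          (x3 u hu' v hv' huv)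
        simp [RandSet.bind, h1, h2]

/-- The long threads of a minimal counterexample: `η x` is a hub next to the non-hub `x`, and `θ x`
is its other neighbour. -/
theorem MinCounterexample.exists_darts [Finite V] {G : SimpleGraph V} (hG : MinCounterexample G) :
    ∃ η θ : V → V, (∀ x, ¬Hub G x → Hub G (η x) ∧ Two G x (η x) (θ x)) ∧
      ∀ x, ¬Hub G x → ¬Hub G (θ x) → θ (θ x) = x ∧ η (θ x) ≠ η x := by
  have h : ∀ x, ∃ u y, ¬Hub G x → Hub G u ∧ Two G x u y := fun x => by
    by_cases hx : Hub G x
    · exact ⟨x, x, fun h => (h hx).elim⟩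
    · obtain ⟨u, hu, hxu⟩ := hG.exists_hub_adj hx
      obtain ⟨a, b, hab⟩ := hG.two_of_not_hub hx
      obtain ⟨y, hy⟩ := hab.exists_other hxu
      exact ⟨u, y, fun _ => ⟨hu, hy⟩⟩
  choose η θ h using h
  refine ⟨η, θ, h, fun x hx hy => ?_⟩
  obtain ⟨hu, hxT⟩ := h x hx
  obtain ⟨v, hv, huv, hyT⟩ := hG.exists_far_hub hu hxT hy
  obtain ⟨hu', hyT'⟩ := h _ hy
  have e1 : η (θ x) = v :=
    ((hyT.2 _).1 hyT'.left).resolve_left fun e => hx (e ▸ hu')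
  exact ⟨((hyT.2 _).1 hyT'.right).resolve_right fun e => hyT'.1 (e1.trans e.symm), e1 ▸ huv.symm⟩

/-- There is no minimal counterexample: hubs are selected by coarse random coins, and the threads
between them are completed so that all marginals are `2/5`. -/
theorem MinCounterexample.elim [Finite V] {G : SimpleGraph V} (hG : MinCounterexample G) :
    False := by
  have := Fintype.ofFinite V
  obtain ⟨η, θ, hT, hθ⟩ := hG.exists_darts
  obtain ⟨pick, hp1, hp2⟩ := exists_orientation η _ ({x | ¬Hub G x ∧ ¬Hub G (θ x)} : Finset V) θ rfl
    (by
      simp only [mem_filter_univ]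
      exact fun x hx => ⟨hx.2, (hθ x hx.1 hx.2).1.symm ▸ hx.1⟩)
    (by
      simp only [mem_filter_univ]
      exact fun x hx => (hθ x hx.1 hx.2).1)
    (by
      simp only [mem_filter_univ]
      exact fun x hx => (hT x hx.1).2.right.ne')
  simp only [mem_filter_univ] at hp1 hp2
  obtain ⟨X, -, x2, x3⟩ := exists_fair_coins (univ : Finset V)
  simp only [mem_univ, forall_const] at x2 x3
  let In : X.Ω → Bool × Bool → V → Prop := fun ω c u => u ∈ X.D ω ∧ c.1 = true
  let D' : X.Ω → Bool × Bool → Set V := fun ω c => {w | Hub G w ∧ In ω c w ∨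
    ¬Hub G w ∧ ¬In ω c (η w) ∧ (Hub G (θ w) ∧ ¬In ω c (θ w) ∨
      ¬Hub G (θ w) ∧ (In ω c (η (θ w)) ∨ (pick w ↔ c.2 = true)))}
  refine hG.not_good (X.goodOn_bind (fun _ (c : Bool × Bool) => (if c.1 then 4 / 5 else 1 / 5) / 2)
    (fun _ c => by split_ifs <;> norm_num)
    (fun _ => by simp [Fintype.sum_prod_type]; norm_num) D' (fun _ _ => Set.subset_univ _)
    (fun ω c _ _ w _ => ?_) fun w _ => ?_)
  · have hub_mem : ∀ u, Hub G u → In ω c u → u ∈ D' ω c := fun u h1 h2 => Or.inl ⟨h1, h2⟩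
    have short_mem : ∀ x, ¬Hub G x → Hub G (θ x) → ¬In ω c (η x) → ¬In ω c (θ x) → x ∈ D' ω c :=
      fun x h1 h2 h3 h4 => Or.inr ⟨h1, h3, Or.inl ⟨h2, h4⟩⟩
    have long_mem : ∀ x, ¬Hub G x → ¬Hub G (θ x) → ¬In ω c (η x) →
        (In ω c (η (θ x)) ∨ (pick x ↔ c.2 = true)) → x ∈ D' ω c :=
      fun x h1 h2 h3 h4 => Or.inr ⟨h1, h3, Or.inr ⟨h2, h4⟩⟩
    by_cases hw : Hub G w
    · by_cases hin : In ω c w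
      · exact Or.inl (hub_mem w hw hin)
      obtain ⟨x, y, v, hy, hv, hx, hyT, x', hne, hx'⟩ := hG.exists_second_thread hw
      have long : ∀ x y v, ¬Hub G y → Hub G v → Two G x w y → Two G y x v →
          ¬Hub G x ∧ θ x = y ∧ η x = w ∧ η y = v := by
        intro x y v hy hv hx hyT
        have hxh := hx.not_hub
        obtain ⟨h1, h2⟩ := hT x hxh
        have e1 : η x = w := ((hx.2 _).1 h2.left).resolve_right fun e => hy (e ▸ h1)
        have e2 : θ x = y := ((hx.2 _).1 h2.right).resolve_left fun e => h2.1 (e1.trans e.symm)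
        obtain ⟨h3, h4⟩ := hT y hy
        exact ⟨hxh, e2, e1, ((hyT.2 _).1 h4.left).resolve_left fun e => hxh (e ▸ h3)⟩
      obtain ⟨a1, a2, a3, a4⟩ := long x y v hy hv hx hyT
      rcases hx' with hx' | ⟨y', v', hy', hv', hx', hyT'⟩
      · by_cases hvin : In ω c v
        · exact Or.inr ⟨x, long_mem x a1 (a2 ▸ hy) (a3 ▸ hin) (Or.inl (by rwa [a2, a4])),
            hx.left⟩
        · have hxh := hx'.not_hub
          obtain ⟨h1, h2⟩ := hT x' hxh
          have hend : ∀ z, G.Adj x' z → Hub G z ∧ ¬In ω c z := fun z hz => by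
            rcases (hx'.2 z).1 hz with rfl | rfl
            · exact ⟨hw, hin⟩
            · exact ⟨hv, hvin⟩
          exact Or.inr ⟨x', short_mem x' hxh (hend _ h2.right).1 (hend _ h2.left).2
            (hend _ h2.right).2, hx'.left⟩
      · obtain ⟨b1, b2, b3, b4⟩ := long x' y' v' hy' hv' hx' hyT'
        obtain ⟨⟨z, hz, hz1, hz2⟩, z', hz', hz1', hz2'⟩ := hp2 x ⟨a1, a2 ▸ hy⟩ x' ⟨b1, b2 ▸ hy'⟩
          hne.symm (a3.trans b3.symm)
        have fin : ∀ z, ¬Hub G z ∧ ¬Hub G (θ z) → η z = η x → (pick z ↔ c.2 = true) →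
            DomBy G (D' ω c) w := fun z hz hz1 hz2 => by
          have e := hz1.trans a3
          exact Or.inr ⟨z, long_mem z hz.1 hz.2 (by rwa [e]) (Or.inr hz2),
            e ▸ (hT z hz.1).2.left⟩
        by_cases hc : c.2 = true
        · exact fin z hz hz1 (iff_of_true hz2 hc)
        · exact fin z' hz' hz1' (iff_of_false hz2' hc)
    · obtain ⟨hη, hwT⟩ := hT w hw
      by_cases h1 : In ω c (η w)
      · exact Or.inr ⟨_, hub_mem _ hη h1, hwT.left.symm⟩
      by_cases hθw : Hub G (θ w)
      · by_cases h2 : In ω c (θ w)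
        · exact Or.inr ⟨_, hub_mem _ hθw h2, hwT.right.symm⟩
        · exact Or.inl (short_mem w hw hθw h1 h2)
      · by_cases h2 : In ω c (η (θ w)) ∨ (pick w ↔ c.2 = true)
        · exact Or.inl (long_mem w hw hθw h1 h2)
        · rw [not_or] at h2
          have e := (hθ w hw hθw).1
          refine Or.inr ⟨_, long_mem (θ w) hθw (e.symm ▸ hw) h2.1 (Or.inr ?_), hwT.right.symm⟩
          rw [hp1 w ⟨hw, hθw⟩]
          tauto
  · have key : ∀ (u v : V) (a b c d : ℝ), u ≠ v → a + b / 2 + c / 2 + d / 4 = 2 / 5 →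
        X.ex (fun ω => a + b * ind (u ∈ X.D ω) + c * ind (v ∈ X.D ω) +
          d * ind (u ∈ X.D ω ∧ v ∈ X.D ω)) = 2 / 5 := by
      intro u v a b c d huv h
      rw [X.ex_lin, x2, x2, x3 u v huv, ← h]
      ring
    by_cases hw : Hub G w
    · refine ((X.ex_congr (g := fun ω => 4 / 5 * ind (w ∈ X.D ω)) fun ω _ => ?_).trans ?_).le
      · by_cases k : w ∈ X.D ω <;>
          simp [Fintype.sum_prod_type, D', In, hw, k, ind]
      · rw [X.ex_mul, x2]; norm_num
    obtain ⟨hη, hwT⟩ := hT w hw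
    by_cases hθw : Hub G (θ w)
    · refine ((X.ex_congr fun ω _ => ?_).trans
        (key (η w) (θ w) 1 (-4 / 5) (-4 / 5) (4 / 5) hwT.1 (by norm_num))).le
      by_cases k : η w ∈ X.D ω <;> by_cases k' : θ w ∈ X.D ω <;>
        simp [Fintype.sum_prod_type, D', In, hw, hθw, k, k', ind] <;> norm_num
    · refine ((X.ex_congr fun ω _ => ?_).trans
        (key (η w) (η (θ w)) (1 / 2) (-2 / 5) (2 / 5) (-2 / 5) (hθ w hw hθw).2.symm
          (by norm_num))).le
      by_cases k : η w ∈ X.D ω <;> by_cases k' : η (θ w) ∈ X.D ω <;> by_cases k'' : pick w <;>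
        simp [Fintype.sum_prod_type, D', In, hw, hθw, k, k', k'', ind] <;> norm_num

/-- A connected graph of minimum degree at least two has a good law or a spanning subgraph from
the list `cores`. -/
theorem good_or_bad_univ (n : ℕ) : ∀ {V : Type u} [Finite V], Nat.card V = n →
    ∀ G : SimpleGraph V, CutConn G Set.univ → MinDegTwo G Set.univ →
      GoodOn G Set.univ ∨ BadOn G Set.univ := by
  induction n using Nat.strong_induction_on with
  | _ n ih =>
    intro V _ hn G
    induction G using WellFoundedLT.induction with
    | _ G ihG =>
      intro hconn hdeg
      by_contra hc
      rw [not_or] at hc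
      refine MinCounterexample.elim ⟨hconn, hdeg, hc.1, hc.2, fun W hW H h1 h2 _ => ?_, ihG⟩
      refine dichotomy_of_subtype (ih _ ?_ rfl _ h1.subtype h2.subtype)
      rw [← hn, Nat.card_coe_set_eq, ← Set.ncard_univ]
      exact Set.ncard_lt_ncard (Set.ssubset_univ_iff.2 hW)

theorem SimpleGraph.Connected.cutConn {G : SimpleGraph V} (h : G.Connected) :
    CutConn G Set.univ := by
  rintro A - ⟨a, ha⟩ ⟨b, -, hb⟩
  obtain ⟨p⟩ := h.preconnected a b
  obtain ⟨d, -, h1, h2⟩ := p.exists_boundary_dart A ha hb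
  exact ⟨d.fst, h1, d.snd, ⟨trivial, h2⟩, d.adj⟩

theorem minDegTwo_of_two_le_degree [Fintype V] {G : SimpleGraph V} [DecidableRel G.Adj]
    (h : ∀ v, 2 ≤ G.degree v) : MinDegTwo G Set.univ := by
  intro v _
  obtain ⟨a, ha, b, hb, hab⟩ := one_lt_card.1 (h v)
  rw [SimpleGraph.mem_neighborFinset] at ha hb
  exact ⟨a, trivial, b, trivial, hab, ha, hb⟩

theorem GoodOn.exists_isDomDistribution [Fintype V] [DecidableEq V] {G : SimpleGraph V}
    (h : GoodOn G Set.univ) : ∃ w : Finset V → ℝ, IsDomDistribution G w (2 / 5) := by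
  obtain ⟨X, -, h2, h3⟩ := h
  refine ⟨fun E => X.ex fun ω => ind (X.D ω = E), fun E => X.ex_nonneg fun ω => ind_nonneg _, ?_, ?_,
    fun v => ?_⟩
  · simp only [RandSet.ex]
    rw [sum_comm, ← X.total]
    refine sum_congr rfl fun ω _ => ?_
    rw [← mul_sum, sum_eq_single (X.D ω).toFinset]
    · simp [ind]
    · intro E _ hE
      have : X.D ω ≠ E := fun e => hE (by ext; simp [e])
      simp [ind, this]
    · simp
  · intro E hE v
    obtain ⟨ω, -, hω⟩ := exists_ne_zero_of_sum_ne_zero hE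
    have e : X.D ω = E := by
      by_contra h
      simp [ind, h] at hω
    rcases h2 ω (left_ne_zero_of_mul hω) v trivial with h | ⟨u, hu, h⟩
    · exact ⟨v, by simpa [e] using h, Or.inl rfl⟩
    · exact ⟨u, by simpa [e] using hu, Or.inr h⟩
  · refine le_trans (le_of_eq ?_) (h3 v trivial)
    simp only [RandSet.pr, RandSet.ex]
    rw [sum_comm]
    refine sum_congr rfl fun ω _ => ?_
    rw [← mul_sum]
    congr 1
    by_cases hv : v ∈ X.D ω
    · rw [sum_eq_single (X.D ω).toFinset]
      · simp [ind, hv]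
      · intro E _ hE
        have : X.D ω ≠ E := fun e => hE (by ext; simp [e])
        simp [ind, this]
      · simp [hv]
    · refine (sum_eq_zero fun E hE => ?_).trans (by simp [ind, hv])
      have : X.D ω ≠ E := fun e => hv (e ▸ (mem_filter.1 hE).2)
      simp [ind, this]

theorem IsDomDistribution.one_div_le_card [Fintype V] [DecidableEq V] [Nonempty V]
    {G : SimpleGraph V} {w : Finset V → ℝ} {p : ℝ} (h : IsDomDistribution G w p) (hp : 0 < p) :
    1 / p ≤ Fintype.card V := by
  obtain ⟨h0, h1, h2, h3⟩ := h
  rw [div_le_iff₀ hp, ← h1]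
  calc ∑ D, w D ≤ ∑ D, ∑ v, if v ∈ D then w D else 0 := by
        refine sum_le_sum fun D _ => ?_
        by_cases hD : w D = 0
        · simp [hD]
        · obtain ⟨u, hu, -⟩ := h2 D hD (Classical.arbitrary V)
          refine le_of_eq_of_le (if_pos hu).symm (single_le_sum
            (f := fun v => if v ∈ D then w D else 0) (fun v _ => ?_) (mem_univ u))
          split_ifs
          exacts [h0 D, le_rfl]
    _ = ∑ v, ∑ D with v ∈ D, w D := by
        rw [sum_comm]
        simp only [sum_filter]
    _ ≤ ∑ _v : V, p := sum_le_sum fun v _ => h3 v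
    _ = Fintype.card V * p := by simp

end

/-- Every connected graph of minimum degree at least 2 that is not one of the eight
exceptional graphs has fractional domatic number at least `5/2`; equivalently, it carries a
finitely supported probability distribution over its dominating sets giving each vertex
probability at most `2/5`. -/
theorem fdom_ge_five_halves {V : Type*} [Fintype V] [DecidableEq V] (G : SimpleGraph V)
    (hconn : G.Connected) (hdeg : ∀ v : V, 2 ≤ G.degree v) (hbad : ¬ InBadFamily G) :
    (5 / 2 : ℝ) ≤ fdom G ∧ ∃ w : Finset V → ℝ, IsDomDistribution G w (2 / 5) := by
  have hgood : GoodOn G Set.univ :=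
    (good_or_bad_univ _ rfl G hconn.cutConn (minDegTwo_of_two_le_degree hdeg)).elim id
      fun h => h.good_or_inBadFamily.resolve_right hbad
  obtain ⟨w, hw⟩ := hgood.exists_isDomDistribution
  have := hconn.nonempty
  refine ⟨le_csSup ⟨Fintype.card V, ?_⟩ ⟨2 / 5, by norm_num, by norm_num, by norm_num, w, hw⟩,
    w, hw⟩
  rintro _ ⟨p, hp, -, rfl, w', hw'⟩
  exact hw'.one_div_le_card hp
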